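/- arXiv:1912.03532 — 2 statements merged into one kernel-verified Lean document; each statement's English description precedes it below -/
import Mathlib

section
/- Let n ≥ 2, m ∈ ℕ with m < n, and d ∈ (0, n−m). For a nonnegative measurable f on (0,1) define S₂f(t) = t^{−m/(n−d)} ∫₀^{t^{n/d}} f(s) s^{−1+m/(n−d)} ds, t ∈ (0,1). Then: (a) for p ∈ ((n−d)/m, n/m) there is a constant C = C(n,m,d,p) with ‖ t^{(n−mp)/(dp) − 1/p} (S₂f)*(t) ‖_{L^p(0,1)} ≤ C ‖f‖_{L^p(0,1)}, i.e. S₂ : L^p(0,1) → L^{dp/(n−mp),p}(0,1) is bounded; (b) for p = n/m, ‖ t^{−m/n} (log(e/t))^{−1} (S₂f)*(t) ‖_{L^{n/m}(0,1)} ≤ C ‖f‖_{L^{n/m}(0,1)}, i.e. S₂ : L^{n/m}(0,1) → L^{∞,n/m;−1}(0,1) is bounded; (c) for p ∈ (n/m, ∞], ess sup_{t ∈ (0,1)} S₂f(t) ≤ C ‖f‖_{L^p(0,1)}. -/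
open MeasureTheory Set
open scoped ENNReal NNReal

/-- Lebesgue measure on the interval `(0,1)`. -/
noncomputable def vol01 : MeasureTheory.Measure ℝ :=
  MeasureTheory.volume.restrict (Set.Ioo 0 1)

/-- The non-increasing rearrangement on `(0,1)` of an extended-nonnegative function. -/
noncomputable def decRearr (f : ℝ → ℝ≥0∞) (s : ℝ) : ℝ≥0∞ :=
  sInf {ρ : ℝ≥0∞ | vol01 {t | ρ < f t} ≤ ENNReal.ofReal s}

/-- The non-increasing rearrangement of a real-valued function with respect to a measure. -/
noncomputable def rearr {α : Type*} [MeasurableSpace α] (ν : MeasureTheory.Measure α)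
    (u : α → ℝ) (s : ℝ) : ℝ≥0∞ :=
  sInf {ρ : ℝ≥0∞ | ν {x | ρ < ENNReal.ofReal |u x|} ≤ ENNReal.ofReal s}

/-- A rearrangement-invariant function norm on `(0,1)`: properties (P1)–(P6). -/
structure IsRINorm (N : (ℝ → ℝ≥0∞) → ℝ≥0∞) : Prop where
  eq_zero_iff : ∀ f : ℝ → ℝ≥0∞, N f = 0 ↔ (∀ᵐ t ∂vol01, f t = 0)
  smul : ∀ (c : ℝ≥0) (f : ℝ → ℝ≥0∞), N (fun t => (c : ℝ≥0∞) * f t) = (c : ℝ≥0∞) * N f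
  add_le : ∀ f g : ℝ → ℝ≥0∞, N (fun t => f t + g t) ≤ N f + N g
  mono : ∀ f g : ℝ → ℝ≥0∞, (∀ᵐ t ∂vol01, f t ≤ g t) → N f ≤ N g
  iSup_eq : ∀ (f : ℕ → ℝ → ℝ≥0∞) (g : ℝ → ℝ≥0∞),
    (∀ k, ∀ᵐ t ∂vol01, f k t ≤ f (k + 1) t) →
    (∀ᵐ t ∂vol01, (⨆ k, f k t) = g t) → N g = ⨆ k, N (f k)
  indicator_lt_top : ∀ E : Set ℝ, MeasurableSet E → E ⊆ Set.Ioo 0 1 → N (E.indicator 1) < ⊤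
  exists_integral_le : ∀ E : Set ℝ, MeasurableSet E → E ⊆ Set.Ioo 0 1 →
    ∃ C : ℝ≥0, ∀ f : ℝ → ℝ≥0∞, (∫⁻ t in E, f t) ≤ (C : ℝ≥0∞) * N f
  rearr_invariant : ∀ f g : ℝ → ℝ≥0∞, decRearr f = decRearr g → N f = N g
/-- The Hardy-type operator `S₁f(t) = ∫_{t^{n/d}}^1 f(s) s^{-1+m/n} ds`. -/
noncomputable def S1 (n m : ℕ) (d : ℝ) (f : ℝ → ℝ≥0∞) (t : ℝ) : ℝ≥0∞ :=
  ∫⁻ s in Set.Ioo (t ^ ((n : ℝ) / d)) 1, ENNReal.ofReal (s ^ ((m : ℝ) / n - 1)) * f s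

/-- The Hardy-type operator
`S₂f(t) = t^{-m/(n-d)} ∫_0^{t^{n/d}} f(s) s^{-1+m/(n-d)} ds`. -/
noncomputable def S2 (n m : ℕ) (d : ℝ) (f : ℝ → ℝ≥0∞) (t : ℝ) : ℝ≥0∞ :=
  ENNReal.ofReal (t ^ (-((m : ℝ) / ((n : ℝ) - d)))) *
    ∫⁻ s in Set.Ioo (0 : ℝ) (t ^ ((n : ℝ) / d)),
      ENNReal.ofReal (s ^ ((m : ℝ) / ((n : ℝ) - d) - 1)) * f s


theorem lintegral_Ioo_zero_ofReal_rpow {e T : ℝ} (he : 0 < e) (hT : 0 ≤ T) :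
    ∫⁻ s in Ioo (0 : ℝ) T, ENNReal.ofReal (s ^ (e - 1)) = ENNReal.ofReal (T ^ e / e) := by
  have hint : IntegrableOn (fun s : ℝ => s ^ (e - 1)) (Ioo 0 T) :=
    ((intervalIntegrable_iff_integrableOn_Ioc_of_le hT).1
      (intervalIntegral.intervalIntegrable_rpow' (by linarith))).mono_set Ioo_subset_Ioc_self
  rw [← ofReal_integral_eq_lintegral_ofReal hint
    (by filter_upwards [ae_restrict_mem measurableSet_Ioo] with s hs
        exact Real.rpow_nonneg hs.1.le _),
    ← integral_Ioc_eq_integral_Ioo, ← intervalIntegral.integral_of_le hT,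
    integral_rpow (Or.inl (by linarith))]
  simp [Real.zero_rpow he.ne']

theorem lintegral_Ioi_ofReal_rpow {e T : ℝ} (he : e < 0) (hT : 0 < T) :
    ∫⁻ s in Ioi T, ENNReal.ofReal (s ^ (e - 1)) = ENNReal.ofReal (T ^ e / -e) := by
  rw [← ofReal_integral_eq_lintegral_ofReal (integrableOn_Ioi_rpow_of_lt (by linarith) hT)
    (by filter_upwards [ae_restrict_mem measurableSet_Ioi] with s hs
        exact Real.rpow_nonneg (hT.trans hs).le _),
    integral_Ioi_rpow_of_lt (by linarith) hT]
  congr 1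
  simp [div_neg, neg_div]

/-- A Schur test for integral operators with kernel `1_R(t,s) v₁(s) v₂(s)`. -/
theorem lintegral_mul_rpow_setLIntegral_le {p q : ℝ} (hpq : p.HolderConjugate q)
    (μ : Measure ℝ) [SFinite μ] {R : Set (ℝ × ℝ)} (hR : MeasurableSet R)
    {v₁ v₂ W w f : ℝ → ℝ≥0∞} {B : ℝ≥0∞} (hv₁ : Measurable v₁) (hv₂ : Measurable v₂)
    (hW : Measurable W) (hw : Measurable w) (hf : Measurable f)
    (h₁ : ∀ᵐ t ∂μ, (∫⁻ s in {s | (t, s) ∈ R}, v₁ s ^ q ∂μ) ^ (p / q) ≤ w t)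
    (h₂ : ∀ᵐ s ∂μ, v₂ s ^ p * ∫⁻ t in {t | (t, s) ∈ R}, W t * w t ∂μ ≤ B) :
    ∫⁻ t, W t * (∫⁻ s in {s | (t, s) ∈ R}, v₁ s * v₂ s * f s ∂μ) ^ p ∂μ ≤
      B * ∫⁻ s, f s ^ p ∂μ := by
  have hp : 0 < p := hpq.pos
  have hRt (t : ℝ) : MeasurableSet {s | (t, s) ∈ R} := measurable_prodMk_left hR
  have hRs (s : ℝ) : MeasurableSet {t | (t, s) ∈ R} := measurable_prodMk_right hR
  let G : ℝ → ℝ → ℝ≥0∞ := fun t s =>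
    R.indicator (fun z => W z.1 * w z.1 * (v₂ z.2 * f z.2) ^ p) (t, s)
  have hG : Measurable (Function.uncurry G) := by
    have : Measurable fun z : ℝ × ℝ => W z.1 * w z.1 * (v₂ z.2 * f z.2) ^ p := by fun_prop
    exact this.indicator hR
  calc ∫⁻ t, W t * (∫⁻ s in {s | (t, s) ∈ R}, v₁ s * v₂ s * f s ∂μ) ^ p ∂μ
      ≤ ∫⁻ t, ∫⁻ s, G t s ∂μ ∂μ := by
        refine lintegral_mono_ae ?_
        filter_upwards [h₁] with t ht
        have hol := ENNReal.lintegral_mul_le_Lp_mul_Lq (μ.restrict {s | (t, s) ∈ R}) hpq.symm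
          hv₁.aemeasurable (hv₂.mul hf).aemeasurable
        have hol' : (∫⁻ s in {s | (t, s) ∈ R}, v₁ s * v₂ s * f s ∂μ) ^ p ≤
            w t * ∫⁻ s in {s | (t, s) ∈ R}, (v₂ s * f s) ^ p ∂μ := by
          calc _ ≤ ((∫⁻ s in {s | (t, s) ∈ R}, v₁ s ^ q ∂μ) ^ (1 / q) *
                (∫⁻ s in {s | (t, s) ∈ R}, (v₂ s * f s) ^ p ∂μ) ^ (1 / p)) ^ p := by
                refine ENNReal.rpow_le_rpow ?_ hp.le
                simpa [mul_assoc] using hol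
            _ = (∫⁻ s in {s | (t, s) ∈ R}, v₁ s ^ q ∂μ) ^ (p / q) *
                ∫⁻ s in {s | (t, s) ∈ R}, (v₂ s * f s) ^ p ∂μ := by
                rw [ENNReal.mul_rpow_of_nonneg _ _ hp.le, ← ENNReal.rpow_mul, ← ENNReal.rpow_mul,
                  one_div_mul_cancel hp.ne', ENNReal.rpow_one, one_div_mul_eq_div]
            _ ≤ _ := by gcongr
        calc _ ≤ W t * (w t * ∫⁻ s in {s | (t, s) ∈ R}, (v₂ s * f s) ^ p ∂μ) := by gcongr
          _ = ∫⁻ s in {s | (t, s) ∈ R}, W t * w t * (v₂ s * f s) ^ p ∂μ := by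
            rw [lintegral_const_mul _ (by fun_prop), mul_assoc]
          _ = ∫⁻ s, G t s ∂μ := by
            rw [← lintegral_indicator (hRt t)]; rfl
    _ = ∫⁻ s, ∫⁻ t, G t s ∂μ ∂μ := lintegral_lintegral_swap hG.aemeasurable
    _ ≤ ∫⁻ s, B * f s ^ p ∂μ := by
        refine lintegral_mono_ae ?_
        filter_upwards [h₂] with s hs
        calc ∫⁻ t, G t s ∂μ
            = ∫⁻ t in {t | (t, s) ∈ R}, W t * w t * (v₂ s * f s) ^ p ∂μ := by
              rw [← lintegral_indicator (hRs s)]; rfl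
          _ = (v₂ s ^ p * ∫⁻ t in {t | (t, s) ∈ R}, W t * w t ∂μ) * f s ^ p := by
              rw [lintegral_mul_const _ (by fun_prop), ENNReal.mul_rpow_of_nonneg _ _ hp.le]
              ring
          _ ≤ B * f s ^ p := by gcongr
    _ = B * ∫⁻ s, f s ^ p ∂μ := lintegral_const_mul _ (by fun_prop)

/-- A Hardy inequality with power weights, for the integral over `(0, t ^ b)`. -/
theorem hardy_Ioo_zero {p b α e : ℝ} (hp : 1 < p) (hb : 0 < b) (hα : 1 / p < α)
    (he : e + 1 = b * (1 - α * p)) :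
    ∃ C : ℝ, 0 < C ∧ ∀ f : ℝ → ℝ≥0∞, Measurable f →
      ∫⁻ t in Ioo (0 : ℝ) 1, ENNReal.ofReal (t ^ e) *
        (∫⁻ s in Ioo 0 (t ^ b), ENNReal.ofReal (s ^ (α - 1)) * f s) ^ p ≤
      ENNReal.ofReal C * ∫⁻ s in Ioo (0 : ℝ) 1, f s ^ p := by
  have hpq := Real.HolderConjugate.conjExponent hp
  set q := Real.conjExponent p
  have hp0 : 0 < p := by linarith
  have hq0 : 0 < q := hpq.symm.pos
  obtain ⟨y, hy⟩ : ∃ y, y = (α - 1 / p) / 2 := ⟨_, rfl⟩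
  have hy0 : 0 < y := by rw [hy]; linarith
  have hinv : q⁻¹ = 1 - p⁻¹ := by have := hpq.inv_add_inv_eq_one; linarith
  have hx : (α - 1 - y) * q = q * y - 1 := by
    have : q * q⁻¹ = 1 := mul_inv_cancel₀ hq0.ne'
    rw [hinv] at this
    rw [hy]; simp only [one_div]; linear_combination -this
  have hE : e + b * (p * y) = -(b * (p * y)) - 1 := by
    have : p * p⁻¹ = 1 := mul_inv_cancel₀ hp0.ne'
    rw [hy]; simp only [one_div]; linear_combination he - b * this
  have hyp : 0 < b * (p * y) := by positivity
  obtain ⟨c, hc⟩ : ∃ c : ℝ, c = (q * y)⁻¹ ^ (p / q) := ⟨_, rfl⟩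
  have hc0 : 0 < c := by rw [hc]; positivity
  refine ⟨c / (b * (p * y)), by positivity, fun f hf => ?_⟩
  have key := lintegral_mul_rpow_setLIntegral_le hpq (volume.restrict (Ioo (0 : ℝ) 1))
    (R := {z : ℝ × ℝ | z.2 < z.1 ^ b}) (measurableSet_lt (by fun_prop) (by fun_prop))
    (v₁ := fun s => ENNReal.ofReal (s ^ (α - 1 - y))) (v₂ := fun s => ENNReal.ofReal (s ^ y))
    (W := fun t => ENNReal.ofReal (t ^ e))
    (w := fun t => ENNReal.ofReal (c * t ^ (b * (p * y))))
    (B := ENNReal.ofReal (c / (b * (p * y)))) (by fun_prop) (by fun_prop) (by fun_prop)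
    (by fun_prop) hf ?_ ?_
  · refine le_trans (le_of_eq ?_) key
    refine setLIntegral_congr_fun measurableSet_Ioo fun t ht => ?_
    have htb : t ^ b ≤ 1 := Real.rpow_le_one ht.1.le ht.2.le hb.le
    have hset : {s | (t, s) ∈ {z : ℝ × ℝ | z.2 < z.1 ^ b}} ∩ Ioo 0 1 = Ioo 0 (t ^ b) := by
      ext s; simp only [mem_inter_iff, mem_ofPred_eq, mem_Ioo]
      exact ⟨fun h => ⟨h.2.1, h.1⟩, fun h => ⟨h.2, h.1, h.2.trans_le htb⟩⟩
    rw [Measure.restrict_restrict' measurableSet_Ioo, hset]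
    congr 2
    refine setLIntegral_congr_fun measurableSet_Ioo fun s hs => ?_
    rw [← ENNReal.ofReal_mul (Real.rpow_nonneg hs.1.le _), ← Real.rpow_add hs.1]
    ring_nf
  · filter_upwards [ae_restrict_mem measurableSet_Ioo] with t ht
    rw [Measure.restrict_restrict' measurableSet_Ioo]
    calc _ ≤ (∫⁻ s in Ioo 0 (t ^ b), ENNReal.ofReal (s ^ (q * y - 1))) ^ (p / q) := by
          gcongr ?_ ^ _
          refine (lintegral_mono_set (t := Ioo 0 (t ^ b)) fun s hs => ⟨hs.2.1, hs.1⟩).trans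
            (le_of_eq ?_)
          refine setLIntegral_congr_fun measurableSet_Ioo fun s hs => ?_
          rw [ENNReal.ofReal_rpow_of_nonneg (Real.rpow_nonneg hs.1.le _) hq0.le,
            ← Real.rpow_mul hs.1.le, hx]
      _ = _ := by
          have ht0 := ht.1
          rw [lintegral_Ioo_zero_ofReal_rpow (by positivity) (by positivity),
            ENNReal.ofReal_rpow_of_nonneg (by positivity) (by positivity), div_eq_inv_mul,
            Real.mul_rpow (by positivity) (by positivity), hc, ← Real.rpow_mul ht0.le,
            ← Real.rpow_mul ht0.le]
          congr 3
          field_simp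
  · filter_upwards [ae_restrict_mem measurableSet_Ioo] with s hs
    have hs0 := hs.1
    rw [Measure.restrict_restrict' measurableSet_Ioo]
    calc _ ≤ ENNReal.ofReal (s ^ y) ^ p *
          ∫⁻ t in Ioi (s ^ b⁻¹), ENNReal.ofReal c *
            ENNReal.ofReal (t ^ (-(b * (p * y)) - 1)) := by
          refine mul_le_mul_right ?_ _
          refine (lintegral_mono_set' (t := Ioi (s ^ b⁻¹)) ?_).trans (le_of_eq ?_)
          · refine Filter.Eventually.of_forall fun t ht => ?_
            exact (Real.rpow_inv_lt_iff_of_pos hs0.le ht.2.1.le hb).2 ht.1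
          refine setLIntegral_congr_fun measurableSet_Ioi fun t ht => ?_
          have ht0 : 0 < t := lt_trans (by positivity) ht
          rw [← ENNReal.ofReal_mul (by positivity), ← ENNReal.ofReal_mul (by positivity), ← hE,
            Real.rpow_add ht0]
          ring_nf
      _ = _ := by
          rw [lintegral_const_mul _ (by fun_prop),
            lintegral_Ioi_ofReal_rpow (by linarith) (by positivity),
            ENNReal.ofReal_rpow_of_nonneg (by positivity) (by positivity),
            ← ENNReal.ofReal_mul (by positivity), ← ENNReal.ofReal_mul (by positivity),
            ← Real.rpow_mul hs0.le, ← Real.rpow_mul hs0.le]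
          have : b⁻¹ * -(b * (p * y)) = -(y * p) := by field_simp
          rw [this, neg_neg, Real.rpow_neg hs0.le]
          have : 0 < s ^ (y * p) := by positivity
          congr 1
          field_simp

/-- A Hardy inequality with power weights, for the integral over `(t ^ b, 1)`. -/
theorem hardy_Ioo_one {p b α e : ℝ} (hp : 1 < p) (hb : 0 < b) (hα : α < 1 / p)
    (he : e + 1 = b * (1 - α * p)) :
    ∃ C : ℝ, 0 < C ∧ ∀ f : ℝ → ℝ≥0∞, Measurable f →
      ∫⁻ t in Ioo (0 : ℝ) 1, ENNReal.ofReal (t ^ e) *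
        (∫⁻ s in Ioo (t ^ b) 1, ENNReal.ofReal (s ^ (α - 1)) * f s) ^ p ≤
      ENNReal.ofReal C * ∫⁻ s in Ioo (0 : ℝ) 1, f s ^ p := by
  have hpq := Real.HolderConjugate.conjExponent hp
  set q := Real.conjExponent p
  have hp0 : 0 < p := by linarith
  have hq0 : 0 < q := hpq.symm.pos
  obtain ⟨y, hy⟩ : ∃ y, y = (1 / p - α) / 2 := ⟨_, rfl⟩
  have hy0 : 0 < y := by rw [hy]; linarith
  have hinv : q⁻¹ = 1 - p⁻¹ := by have := hpq.inv_add_inv_eq_one; linarith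
  have hx : (α - 1 + y) * q = -(q * y) - 1 := by
    have : q * q⁻¹ = 1 := mul_inv_cancel₀ hq0.ne'
    rw [hinv] at this
    rw [hy]; simp only [one_div]; linear_combination -this
  have hE : e - b * (p * y) = b * (p * y) - 1 := by
    have : p * p⁻¹ = 1 := mul_inv_cancel₀ hp0.ne'
    rw [hy]; simp only [one_div]; linear_combination he - b * this
  have hyp : 0 < b * (p * y) := by positivity
  obtain ⟨c, hc⟩ : ∃ c : ℝ, c = (q * y)⁻¹ ^ (p / q) := ⟨_, rfl⟩
  have hc0 : 0 < c := by rw [hc]; positivity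
  refine ⟨c / (b * (p * y)), by positivity, fun f hf => ?_⟩
  have key := lintegral_mul_rpow_setLIntegral_le hpq (volume.restrict (Ioo (0 : ℝ) 1))
    (R := {z : ℝ × ℝ | z.1 ^ b < z.2}) (measurableSet_lt (by fun_prop) (by fun_prop))
    (v₁ := fun s => ENNReal.ofReal (s ^ (α - 1 + y))) (v₂ := fun s => ENNReal.ofReal (s ^ (-y)))
    (W := fun t => ENNReal.ofReal (t ^ e))
    (w := fun t => ENNReal.ofReal (c * t ^ (-(b * (p * y)))))
    (B := ENNReal.ofReal (c / (b * (p * y)))) (by fun_prop) (by fun_prop) (by fun_prop)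
    (by fun_prop) hf ?_ ?_
  · refine le_trans (le_of_eq ?_) key
    refine setLIntegral_congr_fun measurableSet_Ioo fun t ht => ?_
    have htb : 0 < t ^ b := Real.rpow_pos_of_pos ht.1 _
    have hset : {s | (t, s) ∈ {z : ℝ × ℝ | z.1 ^ b < z.2}} ∩ Ioo 0 1 = Ioo (t ^ b) 1 := by
      ext s; simp only [mem_inter_iff, mem_ofPred_eq, mem_Ioo]
      exact ⟨fun h => ⟨h.1, h.2.2⟩, fun h => ⟨h.1, htb.trans h.1, h.2⟩⟩
    rw [Measure.restrict_restrict' measurableSet_Ioo, hset]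
    congr 2
    refine setLIntegral_congr_fun measurableSet_Ioo fun s hs => ?_
    have hs0 : 0 < s := htb.trans hs.1
    rw [← ENNReal.ofReal_mul (by positivity), ← Real.rpow_add hs0]
    ring_nf
  · filter_upwards [ae_restrict_mem measurableSet_Ioo] with t ht
    have ht0 := ht.1
    have htb : 0 < t ^ b := Real.rpow_pos_of_pos ht.1 _
    rw [Measure.restrict_restrict' measurableSet_Ioo]
    calc _ ≤ (∫⁻ s in Ioi (t ^ b), ENNReal.ofReal (s ^ (-(q * y) - 1))) ^ (p / q) := by
          gcongr ?_ ^ _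
          refine (lintegral_mono_set (t := Ioi (t ^ b)) fun s hs => hs.1).trans
            (le_of_eq ?_)
          refine setLIntegral_congr_fun measurableSet_Ioi fun s hs => ?_
          have hs0 : 0 < s := htb.trans hs
          rw [ENNReal.ofReal_rpow_of_nonneg (by positivity) hq0.le,
            ← Real.rpow_mul hs0.le, hx]
      _ = _ := by
          have hqy : 0 < q * y := by positivity
          rw [lintegral_Ioi_ofReal_rpow (by linarith) htb, neg_neg,
            ENNReal.ofReal_rpow_of_nonneg (by positivity) (by positivity), div_eq_inv_mul,
            Real.mul_rpow (by positivity) (by positivity), hc, ← Real.rpow_mul ht0.le,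
            ← Real.rpow_mul ht0.le]
          congr 3
          field_simp
  · filter_upwards [ae_restrict_mem measurableSet_Ioo] with s hs
    have hs0 := hs.1
    rw [Measure.restrict_restrict' measurableSet_Ioo]
    calc _ ≤ ENNReal.ofReal (s ^ (-y)) ^ p *
          ∫⁻ t in Ioo 0 (s ^ b⁻¹), ENNReal.ofReal c *
            ENNReal.ofReal (t ^ (b * (p * y) - 1)) := by
          refine mul_le_mul_right ?_ _
          refine (lintegral_mono_set' (t := Ioo 0 (s ^ b⁻¹)) ?_).trans (le_of_eq ?_)
          · refine Filter.Eventually.of_forall fun t ht => ⟨ht.2.1, ?_⟩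
            exact (Real.lt_rpow_inv_iff_of_pos ht.2.1.le hs0.le hb).2 ht.1
          refine setLIntegral_congr_fun measurableSet_Ioo fun t ht => ?_
          have ht0 : 0 < t := ht.1
          rw [← ENNReal.ofReal_mul (by positivity), ← ENNReal.ofReal_mul (by positivity), ← hE,
            sub_eq_add_neg, Real.rpow_add ht0]
          ring_nf
      _ = _ := by
          rw [lintegral_const_mul _ (by fun_prop),
            lintegral_Ioo_zero_ofReal_rpow hyp (by positivity),
            ENNReal.ofReal_rpow_of_nonneg (by positivity) (by positivity),
            ← ENNReal.ofReal_mul (by positivity), ← ENNReal.ofReal_mul (by positivity),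
            ← Real.rpow_mul hs0.le, ← Real.rpow_mul hs0.le]
          have : b⁻¹ * (b * (p * y)) = y * p := by field_simp
          rw [this, neg_mul, Real.rpow_neg hs0.le]
          have : 0 < s ^ (y * p) := by positivity
          congr 1
          field_simp

/-- The rearrangement is dominated at `t` by any bound valid on `(t, 1)`. -/
theorem decRearr_le_of_forall_lt {g : ℝ → ℝ≥0∞} {t : ℝ} {ρ : ℝ≥0∞}
    (h : ∀ s ∈ Ioo t 1, g s ≤ ρ) : decRearr g t ≤ ρ := by
  refine sInf_le ?_
  change vol01 {s | ρ < g s} ≤ ENNReal.ofReal t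
  rw [vol01, Measure.restrict_apply' measurableSet_Ioo]
  calc volume ({s | ρ < g s} ∩ Ioo 0 1) ≤ volume (Ioc 0 t) := by
        refine measure_mono fun s hs => ⟨hs.2.1, ?_⟩
        by_contra! hts
        exact (h s ⟨hts, hs.2.2⟩).not_gt hs.1
    _ = ENNReal.ofReal t := by simp

theorem S2_le_add_S1 {n m : ℕ} {d t s : ℝ} (hm : 1 ≤ m) (hd0 : 0 < d) (hd : d < n)
    (ht : 0 < t) (hts : t < s) (hs : s < 1) (f : ℝ → ℝ≥0∞) :
    S2 n m d f s ≤ S2 n m d f t + S1 n m d f t := by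
  have hs0 := ht.trans hts
  have hn0 : (0 : ℝ) < n := hd0.trans hd
  have hnd : 0 < (n : ℝ) - d := sub_pos.2 hd
  have hm0 : (0 : ℝ) < m := by exact_mod_cast hm
  set a := (m : ℝ) / (n - d) with ha
  have ha0 : 0 < a := by positivity
  have hb : 0 < (n : ℝ) / d := by positivity
  set b := (n : ℝ) / d with hbdef
  have htb : 0 < t ^ b := by positivity
  have hexp : (m : ℝ) / n - a = -a / b := by
    rw [ha, hbdef]; field_simp; ring
  have hexp0 : (m : ℝ) / n - a < 0 := by rw [hexp, neg_div]; exact neg_neg_of_pos (by positivity)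
  have hsub : Ioo 0 (s ^ b) ⊆ Ioo 0 (t ^ b) ∪ Ico (t ^ b) (s ^ b) := fun x hx => by
    rcases lt_or_ge x (t ^ b) with h | h
    · exact Or.inl ⟨hx.1, h⟩
    · exact Or.inr ⟨h, hx.2⟩
  calc S2 n m d f s
      ≤ ENNReal.ofReal (s ^ (-a)) *
        ((∫⁻ x in Ioo 0 (t ^ b), ENNReal.ofReal (x ^ (a - 1)) * f x) +
          ∫⁻ x in Ico (t ^ b) (s ^ b), ENNReal.ofReal (x ^ (a - 1)) * f x) :=
        mul_le_mul_right ((lintegral_mono_set hsub).trans (lintegral_union_le _ _ _)) _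
    _ = ENNReal.ofReal (s ^ (-a)) * (∫⁻ x in Ioo 0 (t ^ b), ENNReal.ofReal (x ^ (a - 1)) * f x) +
        ∫⁻ x in Ioo (t ^ b) (s ^ b),
          ENNReal.ofReal (s ^ (-a)) * (ENNReal.ofReal (x ^ (a - 1)) * f x) := by
        rw [mul_add, lintegral_const_mul' _ _ ENNReal.ofReal_ne_top,
          setLIntegral_congr (Ioo_ae_eq_Ico (a := t ^ b))]
    _ ≤ S2 n m d f t + S1 n m d f t := by
        refine add_le_add (mul_le_mul_left (ENNReal.ofReal_le_ofReal
          (Real.rpow_le_rpow_of_nonpos ht hts.le (by linarith))) _) ?_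
        refine (setLIntegral_mono' measurableSet_Ioo fun x hx => ?_).trans
          (lintegral_mono_set (Ioo_subset_Ioo_right (Real.rpow_le_one hs0.le hs.le hb.le)))
        have hx0 : 0 < x := htb.trans hx.1
        rw [← mul_assoc, ← ENNReal.ofReal_mul (by positivity)]
        refine mul_le_mul_left (ENNReal.ofReal_le_ofReal ?_) _
        have h1 : s ^ (-a) ≤ x ^ ((m : ℝ) / n - a) := by
          calc s ^ (-a) = (s ^ b) ^ ((m : ℝ) / n - a) := by
                rw [← Real.rpow_mul hs0.le, hexp, mul_div_cancel₀ _ hb.ne']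
            _ ≤ _ := Real.rpow_le_rpow_of_nonpos hx0 hx.2.le hexp0.le
        calc s ^ (-a) * x ^ (a - 1) ≤ x ^ ((m : ℝ) / n - a) * x ^ (a - 1) := by gcongr
          _ = x ^ ((m : ℝ) / n - 1) := by rw [← Real.rpow_add hx0]; ring_nf

/-- Pointwise bound for `S₂ f` in terms of the `L^p` norm of `f`, for `p ≥ n / m`. -/
theorem S2_le_of_le {n m : ℕ} {d p : ℝ} (hm : 1 ≤ m) (hmn : m < n) (hd0 : 0 < d)
    (hd : d < n) (hp : (n : ℝ) / m ≤ p) :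
    ∃ C : ℝ, 0 < C ∧ ∀ f : ℝ → ℝ≥0∞, Measurable f → ∀ t ∈ Ioo (0 : ℝ) 1,
      S2 n m d f t ≤ ENNReal.ofReal C * (∫⁻ s in Ioo (0 : ℝ) 1, f s ^ p) ^ (1 / p) := by
  have hn0 : (0 : ℝ) < n := hd0.trans hd
  have hnd : 0 < (n : ℝ) - d := sub_pos.2 hd
  have hm0 : (0 : ℝ) < m := by exact_mod_cast hm
  have hmn' : (m : ℝ) < n := by exact_mod_cast hmn
  have hp1 : 1 < p := lt_of_lt_of_le ((one_lt_div hm0).2 hmn') hp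
  have hpq := Real.HolderConjugate.conjExponent hp1
  set q := Real.conjExponent p
  have hp0 : 0 < p := by linarith
  have hq0 : 0 < q := hpq.symm.pos
  set a := (m : ℝ) / (n - d) with ha
  set b := (n : ℝ) / d with hbdef
  have hb : 0 < b := by positivity
  have hpm : p⁻¹ ≤ (m : ℝ) / n := by
    rw [← inv_div]; exact inv_anti₀ (by positivity) hp
  have ham : b * ((m : ℝ) / n - a) = -a := by rw [ha, hbdef]; field_simp; ring
  have hma : (m : ℝ) / n < a := by
    rw [ha]; exact div_lt_div_of_pos_left hm0 hnd (by linarith)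
  have hap : 0 < a - p⁻¹ := by linarith
  have hinv : q⁻¹ = 1 - p⁻¹ := by have := hpq.inv_add_inv_eq_one; linarith
  have hx : (a - 1) * q = q * (a - p⁻¹) - 1 := by
    have : q * q⁻¹ = 1 := mul_inv_cancel₀ hq0.ne'
    rw [hinv] at this
    linear_combination -this
  refine ⟨(q * (a - p⁻¹))⁻¹ ^ q⁻¹, by positivity, fun f hf t ht => ?_⟩
  have ht0 := ht.1
  have htb : t ^ b ≤ 1 := Real.rpow_le_one ht.1.le ht.2.le hb.le
  calc S2 n m d f t
      ≤ ENNReal.ofReal (t ^ (-a)) *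
        ((∫⁻ s in Ioo 0 (t ^ b), ENNReal.ofReal (s ^ (a - 1)) ^ q) ^ (1 / q) *
          (∫⁻ s in Ioo 0 (t ^ b), f s ^ p) ^ (1 / p)) :=
        mul_le_mul_right (ENNReal.lintegral_mul_le_Lp_mul_Lq _ hpq.symm (by fun_prop)
          hf.aemeasurable) _
    _ ≤ ENNReal.ofReal (t ^ (-a)) *
        ((∫⁻ s in Ioo 0 (t ^ b), ENNReal.ofReal (s ^ (a - 1)) ^ q) ^ (1 / q) *
          (∫⁻ s in Ioo (0 : ℝ) 1, f s ^ p) ^ (1 / p)) := by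
        gcongr
    _ = ENNReal.ofReal ((q * (a - p⁻¹))⁻¹ ^ q⁻¹ * t ^ (-a + b * (a - p⁻¹))) *
          (∫⁻ s in Ioo (0 : ℝ) 1, f s ^ p) ^ (1 / p) := by
        have : ∫⁻ s in Ioo 0 (t ^ b), ENNReal.ofReal (s ^ (a - 1)) ^ q =
            ∫⁻ s in Ioo 0 (t ^ b), ENNReal.ofReal (s ^ (q * (a - p⁻¹) - 1)) := by
          refine setLIntegral_congr_fun measurableSet_Ioo fun s hs => ?_
          have hs0 := hs.1
          rw [ENNReal.ofReal_rpow_of_nonneg (by positivity) hq0.le, ← Real.rpow_mul hs0.le, hx]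
        rw [this, lintegral_Ioo_zero_ofReal_rpow (by positivity) (by positivity),
          ENNReal.ofReal_rpow_of_nonneg (by positivity) (by positivity), ← mul_assoc,
          ← ENNReal.ofReal_mul (by positivity), div_eq_inv_mul,
          Real.mul_rpow (by positivity) (by positivity), Real.rpow_add ht0,
          ← Real.rpow_mul ht0.le, ← Real.rpow_mul ht0.le]
        have : b * (q * (a - p⁻¹)) * (1 / q) = b * (a - p⁻¹) := by field_simp
        rw [this, one_div]
        ring_nf
    _ ≤ _ := by
        refine mul_le_mul_left (ENNReal.ofReal_le_ofReal ?_) _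
        refine mul_le_of_le_one_right (by positivity) (Real.rpow_le_one ht0.le ht.2.le ?_)
        rw [← ham, ← mul_add]
        exact mul_nonneg hb.le (by linarith)

theorem S2_le_essSup {n m : ℕ} {d : ℝ} (hm : 1 ≤ m) (hd0 : 0 < d) (hd : d < n) :
    ∃ C : ℝ, 0 < C ∧ ∀ (f : ℝ → ℝ≥0∞), ∀ t ∈ Ioo (0 : ℝ) 1,
      S2 n m d f t ≤ ENNReal.ofReal C * essSup f vol01 := by
  have hn0 : (0 : ℝ) < n := hd0.trans hd
  have hnd : 0 < (n : ℝ) - d := sub_pos.2 hd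
  have hm0 : (0 : ℝ) < m := by exact_mod_cast hm
  set a := (m : ℝ) / (n - d) with ha
  set b := (n : ℝ) / d with hbdef
  have hb : 0 < b := by positivity
  have ha0 : 0 < a := by positivity
  have ham : 0 < b * a - a := by
    have : b * a - a = m / d := by rw [ha, hbdef]; field_simp
    rw [this]; positivity
  refine ⟨a⁻¹, by positivity, fun f t ht => ?_⟩
  have ht0 := ht.1
  have htb : t ^ b ≤ 1 := Real.rpow_le_one ht.1.le ht.2.le hb.le
  have hf : ∀ᵐ s ∂volume.restrict (Ioo 0 (t ^ b)), f s ≤ essSup f vol01 :=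
    ae_restrict_of_ae_restrict_of_subset (Ioo_subset_Ioo_right htb)
      (ENNReal.ae_le_essSup f : ∀ᵐ s ∂vol01, f s ≤ essSup f vol01)
  calc S2 n m d f t
      ≤ ENNReal.ofReal (t ^ (-a)) *
        ∫⁻ s in Ioo 0 (t ^ b), ENNReal.ofReal (s ^ (a - 1)) * essSup f vol01 := by
        refine mul_le_mul_right (lintegral_mono_ae ?_) _
        filter_upwards [hf] with s hs
        gcongr
    _ = ENNReal.ofReal (a⁻¹ * t ^ (b * a - a)) * essSup f vol01 := by
        rw [lintegral_mul_const _ (by fun_prop), lintegral_Ioo_zero_ofReal_rpow ha0 (by positivity),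
          ← mul_assoc, ← ENNReal.ofReal_mul (by positivity), sub_eq_neg_add, Real.rpow_add ht0,
          Real.rpow_mul ht0.le]
        ring_nf
    _ ≤ _ := by
        refine mul_le_mul_left (ENNReal.ofReal_le_ofReal ?_) _
        exact mul_le_of_le_one_right (by positivity) (Real.rpow_le_one ht0.le ht.2.le ham.le)

theorem integrableOn_inv_mul_one_sub_log_rpow {r : ℝ} (hr : 1 < r) :
    IntegrableOn (fun t : ℝ => t⁻¹ * (1 - Real.log t) ^ (-r)) (Ioo 0 1) := by
  let F : ℝ → ℝ := fun t => (r - 1)⁻¹ * (1 - Real.log t) ^ (1 - r)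
  have hpos {t : ℝ} (ht : t ∈ Ioo (0 : ℝ) 1) : 0 < 1 - Real.log t := by
    have := Real.log_neg ht.1 ht.2; linarith
  have hderiv {t : ℝ} (ht : t ∈ Ioo (0 : ℝ) 1) :
      HasDerivAt F (t⁻¹ * (1 - Real.log t) ^ (-r)) t := by
    have h1 := (((Real.hasDerivAt_log ht.1.ne').const_sub 1).rpow_const (p := 1 - r)
      (Or.inl (hpos ht).ne')).const_mul (r - 1)⁻¹
    refine h1.congr_deriv ?_
    have : r - 1 ≠ 0 := by linarith
    rw [show 1 - r - 1 = -r by ring]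
    field_simp
    ring
  have h0 : Filter.Tendsto F (nhdsWithin 0 (Ioi 0)) (nhds 0) := by
    have hl : Filter.Tendsto (fun t => 1 - Real.log t) (nhdsWithin 0 (Ioi 0)) Filter.atTop :=
      Filter.tendsto_atTop_add_const_left _ 1
        (Filter.tendsto_neg_atBot_atTop.comp Real.tendsto_log_nhdsGT_zero)
    have := ((tendsto_rpow_neg_atTop (sub_pos.2 hr)).comp hl).const_mul (r - 1)⁻¹
    simpa [F, Function.comp_def] using this
  have h1 : Filter.Tendsto F (nhdsWithin 1 (Iio 1)) (nhds (F 1)) := by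
    have : ContinuousAt F 1 :=
      ((continuousAt_const.sub (Real.continuousAt_log one_ne_zero)).rpow_const
        (Or.inl (by simp))).const_mul _
    exact this.tendsto.mono_left nhdsWithin_le_nhds
  have hcont := continuousOn_Icc_extendFrom_Ioo
    (fun t ht => (hderiv ht).continuousAt.continuousWithinAt : ContinuousOn F (Ioo 0 1)) h0 h1
  have hFeq : EqOn (extendFrom (Ioo 0 1) F) F (Ioo 0 1) := fun t ht =>
    extendFrom_extends (fun s hs => (hderiv hs).continuousAt.continuousWithinAt) t ht
  refine (intervalIntegral.integrableOn_deriv_of_nonneg hcont (fun t ht => ?_)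
    fun t ht => ?_).mono_set Ioo_subset_Ioc_self
  · exact (hderiv ht).congr_of_eventuallyEq (hFeq.eventuallyEq_of_mem (Ioo_mem_nhds ht.1 ht.2))
  · have := hpos ht
    have := ht.1
    positivity

theorem measurable_S2 (n m : ℕ) (d : ℝ) (f : ℝ → ℝ≥0∞) : Measurable (S2 n m d f) := by
  have hmono : Monotone fun u : ℝ => ∫⁻ s in Ioo (0 : ℝ) u,
      ENNReal.ofReal (s ^ ((m : ℝ) / ((n : ℝ) - d) - 1)) * f s :=
    fun u v huv => lintegral_mono_set (Ioo_subset_Ioo_right huv)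
  have hcomp := hmono.measurable.comp (show Measurable fun t : ℝ => t ^ ((n : ℝ) / d) by fun_prop)
  exact (show Measurable fun t : ℝ => ENNReal.ofReal (t ^ (-((m : ℝ) / ((n : ℝ) - d)))) by
    fun_prop).mul hcomp

theorem rpow_one_div_le_of_le_ofReal_mul {p K : ℝ} (hp : 0 < p) (hK : 0 ≤ K) {x y : ℝ≥0∞}
    (h : x ≤ ENNReal.ofReal K * y) :
    x ^ (1 / p) ≤ ENNReal.ofReal (K ^ (1 / p)) * y ^ (1 / p) := by
  rw [← ENNReal.ofReal_rpow_of_nonneg hK (by positivity),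
    ← ENNReal.mul_rpow_of_nonneg _ _ (by positivity)]
  exact ENNReal.rpow_le_rpow h (by positivity)

theorem S2_lorentz_bound {n m : ℕ} {d p : ℝ} (hm : 1 ≤ m) (hd0 : 0 < d) (hd : d < (n : ℝ) - m)
    (hp : ((n : ℝ) - d) / m < p) (hpn : p < (n : ℝ) / m) :
    ∃ C : ℝ, 0 < C ∧ ∀ f : ℝ → ℝ≥0∞, Measurable f →
      (∫⁻ t in Ioo (0 : ℝ) 1,
          (ENNReal.ofReal (t ^ (((n : ℝ) - m * p) / (d * p) - 1 / p)) *
            decRearr (S2 n m d f) t) ^ p) ^ (1 / p) ≤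
        ENNReal.ofReal C * (∫⁻ s in Ioo (0 : ℝ) 1, f s ^ p) ^ (1 / p) := by
  have hm0 : (0 : ℝ) < m := by exact_mod_cast hm
  have hdn : d < n := by linarith
  have hn0 : (0 : ℝ) < n := hd0.trans hdn
  have hnd : 0 < (n : ℝ) - d := sub_pos.2 hdn
  have hp1 : 1 < p := lt_trans ((one_lt_div hm0).2 (by linarith)) hp
  have hp0 : 0 < p := by linarith
  have hb : 0 < (n : ℝ) / d := by positivity
  obtain ⟨C₂, hC₂, h₂⟩ := hardy_Ioo_zero (α := (m : ℝ) / (n - d))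
    (e := (n - m * p) / d - 1 - m / (n - d) * p) hp1 hb
    (by rw [div_lt_iff₀ hm0] at hp; rw [div_lt_div_iff₀ hp0 hnd]; linarith)
    (by field_simp; ring)
  obtain ⟨C₁, hC₁, h₁⟩ := hardy_Ioo_one (α := (m : ℝ) / n) (e := (n - m * p) / d - 1) hp1 hb
    (by rw [lt_div_iff₀ hm0] at hpn; rw [div_lt_div_iff₀ hn0 hp0]; linarith)
    (by field_simp; ring)
  obtain ⟨c, hc⟩ : ∃ c : ℝ, c = 2 ^ (p - 1) := ⟨_, rfl⟩
  have hc0 : 0 < c := by rw [hc]; positivity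
  have hcE : (2 : ℝ≥0∞) ^ (p - 1) = ENNReal.ofReal c := by
    rw [hc, ← ENNReal.ofReal_rpow_of_pos two_pos]; simp
  refine ⟨(c * (C₂ + C₁)) ^ (1 / p), by positivity, fun f hf =>
    rpow_one_div_le_of_le_ofReal_mul hp0 (by positivity) ?_⟩
  calc ∫⁻ t in Ioo (0 : ℝ) 1, (ENNReal.ofReal (t ^ (((n : ℝ) - m * p) / (d * p) - 1 / p)) *
          decRearr (S2 n m d f) t) ^ p
      ≤ ∫⁻ t in Ioo (0 : ℝ) 1, ENNReal.ofReal c *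
          (ENNReal.ofReal (t ^ (((n : ℝ) - m * p) / d - 1)) * S2 n m d f t ^ p +
            ENNReal.ofReal (t ^ (((n : ℝ) - m * p) / d - 1)) * S1 n m d f t ^ p) := by
        refine setLIntegral_mono' measurableSet_Ioo fun t ht => ?_
        have ht0 := ht.1
        have hrearr : decRearr (S2 n m d f) t ≤ S2 n m d f t + S1 n m d f t :=
          decRearr_le_of_forall_lt fun s hs => S2_le_add_S1 hm hd0 hdn ht0 hs.1 hs.2 f
        have hexp : (((n : ℝ) - m * p) / (d * p) - 1 / p) * p = (n - m * p) / d - 1 := by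
          field_simp
        rw [ENNReal.mul_rpow_of_nonneg _ _ hp0.le,
          ENNReal.ofReal_rpow_of_nonneg (by positivity) hp0.le, ← Real.rpow_mul ht0.le, hexp,
          ← mul_add, mul_left_comm, ← hcE]
        gcongr
        exact (ENNReal.rpow_le_rpow hrearr hp0.le).trans
          (ENNReal.rpow_add_le_mul_rpow_add_rpow _ _ hp1.le)
    _ = ENNReal.ofReal c *
          ((∫⁻ t in Ioo (0 : ℝ) 1,
              ENNReal.ofReal (t ^ (((n : ℝ) - m * p) / d - 1)) * S2 n m d f t ^ p) +
            ∫⁻ t in Ioo (0 : ℝ) 1,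
              ENNReal.ofReal (t ^ (((n : ℝ) - m * p) / d - 1)) * S1 n m d f t ^ p) := by
        have := measurable_S2 n m d f
        rw [lintegral_const_mul' _ _ ENNReal.ofReal_ne_top, lintegral_add_left (by fun_prop)]
    _ ≤ ENNReal.ofReal c * (ENNReal.ofReal C₂ * (∫⁻ s in Ioo (0 : ℝ) 1, f s ^ p) +
          ENNReal.ofReal C₁ * ∫⁻ s in Ioo (0 : ℝ) 1, f s ^ p) := by
        gcongr _ * (?_ + ?_)
        · refine (le_of_eq ?_).trans (h₂ f hf)
          refine setLIntegral_congr_fun measurableSet_Ioo fun t ht => ?_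
          have ht0 := ht.1
          rw [S2, ENNReal.mul_rpow_of_nonneg _ _ hp0.le,
            ENNReal.ofReal_rpow_of_nonneg (by positivity) hp0.le, ← mul_assoc,
            ← ENNReal.ofReal_mul (by positivity), ← Real.rpow_mul ht0.le, ← Real.rpow_add ht0]
          ring_nf
        · exact h₁ f hf
    _ = _ := by
        rw [ENNReal.ofReal_mul hc0.le, ENNReal.ofReal_add hC₂.le hC₁.le]
        ring

theorem S2_lorentz_zygmund_bound {n m : ℕ} {d : ℝ} (hm : 1 ≤ m) (hmn : m < n) (hd0 : 0 < d)
    (hd : d < n) :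
    ∃ C : ℝ, 0 < C ∧ ∀ f : ℝ → ℝ≥0∞, Measurable f →
      (∫⁻ t in Ioo (0 : ℝ) 1,
          (ENNReal.ofReal (t ^ (-(m : ℝ) / n) * (Real.log (Real.exp 1 / t))⁻¹) *
            decRearr (S2 n m d f) t) ^ ((n : ℝ) / m)) ^ ((m : ℝ) / n) ≤
        ENNReal.ofReal C *
          (∫⁻ s in Ioo (0 : ℝ) 1, f s ^ ((n : ℝ) / m)) ^ ((m : ℝ) / n) := by
  have hm0 : (0 : ℝ) < m := by exact_mod_cast hm
  have hn0 : (0 : ℝ) < n := hd0.trans hd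
  have hp1 : 1 < (n : ℝ) / m := (one_lt_div hm0).2 (by exact_mod_cast hmn)
  have hp0 : 0 < (n : ℝ) / m := by linarith
  obtain ⟨C, hC, hS⟩ := S2_le_of_le (d := d) hm hmn hd0 hd le_rfl
  have hinv : 1 / ((n : ℝ) / m) = m / n := one_div_div _ _
  obtain ⟨J, hJ⟩ : ∃ J : ℝ, J = ∫ t in Ioo (0 : ℝ) 1,
    t⁻¹ * (1 - Real.log t) ^ (-((n : ℝ) / m)) := ⟨_, rfl⟩
  have hpos : ∀ t ∈ Ioo (0 : ℝ) 1, 0 < 1 - Real.log t := fun t ht => by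
    have := Real.log_neg ht.1 ht.2; linarith
  have hnn : ∀ t ∈ Ioo (0 : ℝ) 1, 0 ≤ t⁻¹ * (1 - Real.log t) ^ (-((n : ℝ) / m)) := fun t ht =>
    mul_nonneg (inv_nonneg.2 ht.1.le) (Real.rpow_nonneg (hpos t ht).le _)
  have hJ0 : 0 ≤ J := hJ ▸ setIntegral_nonneg measurableSet_Ioo hnn
  have hJE : ∫⁻ t in Ioo (0 : ℝ) 1,
      ENNReal.ofReal (t⁻¹ * (1 - Real.log t) ^ (-((n : ℝ) / m))) = ENNReal.ofReal J := by
    rw [hJ, ofReal_integral_eq_lintegral_ofReal (integrableOn_inv_mul_one_sub_log_rpow hp1)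
      ((ae_restrict_mem measurableSet_Ioo).mono hnn)]
  refine ⟨((J + 1) * C ^ ((n : ℝ) / m)) ^ (1 / ((n : ℝ) / m)), by positivity, fun f hf => ?_⟩
  have hbound := hS f hf
  rw [← hinv]
  refine rpow_one_div_le_of_le_ofReal_mul hp0 (by positivity) ?_
  set N := ∫⁻ s in Ioo (0 : ℝ) 1, f s ^ ((n : ℝ) / m) with hN
  calc _ ≤ ∫⁻ t in Ioo (0 : ℝ) 1,
          ENNReal.ofReal (t⁻¹ * (1 - Real.log t) ^ (-((n : ℝ) / m))) *
            (ENNReal.ofReal (C ^ ((n : ℝ) / m)) * N) := by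
        refine setLIntegral_mono' measurableSet_Ioo fun t ht => ?_
        have ht0 := ht.1
        have hl := hpos t ht
        have hrearr : decRearr (S2 n m d f) t ≤ _ :=
          decRearr_le_of_forall_lt fun s hs => hbound s ⟨ht0.trans hs.1, hs.2⟩
        rw [Real.log_div (Real.exp_ne_zero _) ht0.ne', Real.log_exp]
        calc _ ≤ (ENNReal.ofReal (t ^ (-(m : ℝ) / n) * (1 - Real.log t)⁻¹) *
              (ENNReal.ofReal C * N ^ (1 / ((n : ℝ) / m)))) ^ ((n : ℝ) / m) := by gcongr
          _ = _ := by
            have hexp : -(m : ℝ) / n * (n / m) = -1 := by field_simp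
            rw [ENNReal.mul_rpow_of_nonneg _ _ hp0.le, ENNReal.mul_rpow_of_nonneg _ _ hp0.le,
              ENNReal.ofReal_rpow_of_nonneg (by positivity) hp0.le,
              ENNReal.ofReal_rpow_of_nonneg hC.le hp0.le, ← ENNReal.rpow_mul,
              one_div_mul_cancel hp0.ne', ENNReal.rpow_one,
              Real.mul_rpow (by positivity) (by positivity), ← Real.rpow_mul ht0.le, hexp,
              Real.rpow_neg_one, Real.inv_rpow hl.le, Real.rpow_neg hl.le]
    _ = ENNReal.ofReal J * (ENNReal.ofReal (C ^ ((n : ℝ) / m)) * N) := by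
        rw [lintegral_mul_const _ (by fun_prop), hJE]
    _ ≤ ENNReal.ofReal (J + 1) * (ENNReal.ofReal (C ^ ((n : ℝ) / m)) * N) := by
        gcongr; linarith
    _ = _ := by rw [ENNReal.ofReal_mul (by positivity), mul_assoc]

/-- **Boundedness of the Hardy-type operator `S₂` (`0 < d < n-m`):**
(a) `S₂ : L^p → L^{dp/(n-mp),p}` for `p ∈ ((n-d)/m, n/m)`;
(b) `S₂ : L^{n/m} → L^{∞,n/m;-1}`;
(c) `S₂ : L^p → L^∞` for `p ∈ (n/m, ∞]`. -/
theorem S2_boundedness (n m : ℕ) (hn : 2 ≤ n) (hm : 1 ≤ m) (hmn : m < n)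
    (d : ℝ) (hd0 : 0 < d) (hd : d < (n : ℝ) - m) :
    -- (a)
    (∀ p : ℝ, ((n : ℝ) - d) / m < p → p < (n : ℝ) / m →
      ∃ C : ℝ, 0 < C ∧ ∀ f : ℝ → ℝ≥0∞, Measurable f →
        (∫⁻ t in Set.Ioo (0 : ℝ) 1,
            (ENNReal.ofReal (t ^ (((n : ℝ) - m * p) / (d * p) - 1 / p)) *
              decRearr (S2 n m d f) t) ^ p) ^ (1 / p) ≤
          ENNReal.ofReal C * (∫⁻ s in Set.Ioo (0 : ℝ) 1, f s ^ p) ^ (1 / p)) ∧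
    -- (b)
    (∃ C : ℝ, 0 < C ∧ ∀ f : ℝ → ℝ≥0∞, Measurable f →
      (∫⁻ t in Set.Ioo (0 : ℝ) 1,
          (ENNReal.ofReal (t ^ (-(m : ℝ) / n) * (Real.log (Real.exp 1 / t))⁻¹) *
            decRearr (S2 n m d f) t) ^ ((n : ℝ) / m)) ^ ((m : ℝ) / n) ≤
        ENNReal.ofReal C *
          (∫⁻ s in Set.Ioo (0 : ℝ) 1, f s ^ ((n : ℝ) / m)) ^ ((m : ℝ) / n)) ∧
    -- (c), finite p
    (∀ p : ℝ, (n : ℝ) / m < p →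
      ∃ C : ℝ, 0 < C ∧ ∀ f : ℝ → ℝ≥0∞, Measurable f →
        essSup (S2 n m d f) vol01 ≤
          ENNReal.ofReal C * (∫⁻ s in Set.Ioo (0 : ℝ) 1, f s ^ p) ^ (1 / p)) ∧
    -- (c), p = ∞
    (∃ C : ℝ, 0 < C ∧ ∀ f : ℝ → ℝ≥0∞, Measurable f →
      essSup (S2 n m d f) vol01 ≤ ENNReal.ofReal C * essSup f vol01) := by
  have hm0 : (0 : ℝ) < m := by exact_mod_cast hm
  have hdn : d < n := by linarith
  refine ⟨fun p hp hpn => S2_lorentz_bound hm hd0 hd hp hpn,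
    S2_lorentz_zygmund_bound hm hmn hd0 hdn, fun p hp => ?_, ?_⟩
  · obtain ⟨C, hC, h⟩ := S2_le_of_le hm hmn hd0 hdn hp.le
    exact ⟨C, hC, fun f hf => essSup_le_of_ae_le _
      ((ae_restrict_mem measurableSet_Ioo).mono (h f hf))⟩
  · obtain ⟨C, hC, h⟩ := S2_le_essSup hm hd0 hdn
    exact ⟨C, hC, fun f _ => essSup_le_of_ae_le _
      ((ae_restrict_mem measurableSet_Ioo).mono (h f))⟩
end

section
/- Let Ω be an open set of finite Lebesgue measure in ℝⁿ, n ≥ 2, let m ∈ ℕ with m < n, and assume either d ∈ [n−m, n] and p ∈ [1, n/m), or d ∈ (0, n−m) and p ∈ ((n−d)/m, n/m). Let μ be a finite Borel measure on Ω satisfying sup_{x ∈ ℝⁿ, r > 0} μ(B_r(x) ∩ Ω)/r^d < ∞. Then there exists a constant C (depending on n, m, d, p, Ω and μ) such that for every u ∈ C_c^∞(Ω): ( ∫₀^{μ(Ω)} ( t^{(n−mp)/(dp) − 1/p} · u*_μ(t) )^p dt )^{1/p} ≤ C ( ∫_Ω |∇^m u(x)|^p dx )^{1/p}, i.e. ‖u‖_{L^{dp/(n−mp),p}(Ω,μ)}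 ≤ C ‖∇^m u‖_{L^p(Ω)}. (This sharpens the classical trace embeddings of Adams and Maz'ya: the Lorentz space L^{dp/(n−mp),p}(Ω,μ) is strictly smaller than the Lebesgue space L^{dp/(n−mp)}(Ω,μ).) -/
open MeasureTheory Set
open scoped ENNReal NNReal

theorem ENNReal.rpow_neg_le_rpow_neg {s : ℝ} (hs : 0 ≤ s) {a b : ℝ≥0∞} (h : a ≤ b) :
    b ^ (-s) ≤ a ^ (-s) := by
  rw [ENNReal.rpow_neg, ENNReal.rpow_neg]
  exact ENNReal.inv_le_inv.2 (ENNReal.rpow_le_rpow h hs)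

/-- If the sublevel sets of `φ` have measure `π {φ < r} ≤ P r ^ D`, negative powers `φ ^ (-s)`,
`s < D`, are integrable with the natural bound. -/
theorem lintegral_rpow_neg_le {X : Type*} [MeasurableSpace X] {s D : ℝ} (hs : 0 ≤ s)
    (hsD : s < D) : ∃ C : ℝ≥0∞, C ≠ ∞ ∧ ∀ (π : Measure X) (φ : X → ℝ≥0∞), Measurable φ →
      ∀ P : ℝ≥0∞, P ≠ 0 → P ≠ ∞ → (∀ r : ℝ≥0, 0 < r → π {x | φ x < r} ≤ P * (r : ℝ≥0∞) ^ D) →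
        ∫⁻ x, φ x ^ (-s) ∂π ≤ C * (P ^ (s / D) * π univ ^ (1 - s / D)) := by
  have hD : 0 < D := hs.trans_lt hsD
  set q : ℝ≥0∞ := (2⁻¹ : ℝ≥0∞) ^ (D - s) with hq
  have hq1 : q < 1 := ENNReal.rpow_lt_one (by norm_num) (by linarith)
  refine ⟨1 + 2 ^ s * (1 - q)⁻¹, ?_, ?_⟩
  · refine ENNReal.add_ne_top.2 ⟨by simp, ENNReal.mul_ne_top (by simp) ?_⟩
    exact ENNReal.inv_ne_top.2 (tsub_pos_of_lt hq1).ne'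
  intro π φ hφ P hP0 hPt hsub
  rcases eq_or_ne (π univ) 0 with hQ0 | hQ0
  · simp [Measure.measure_univ_eq_zero.1 hQ0]
  rcases eq_or_ne (π univ) ∞ with hQt | hQt
  · have h1 : P ^ (s / D) ≠ 0 := by simp [hP0, hPt]
    have h2 : (0 : ℝ) < 1 - s / D := by
      rw [sub_pos, div_lt_one hD]; exact hsD
    rw [hQt, ENNReal.top_rpow_of_pos h2, ENNReal.mul_top h1, ENNReal.mul_top (by simp)]
    exact le_top
  set Q := π univ
  obtain ⟨R, hR⟩ : ∃ R : ℝ≥0, (R : ℝ≥0∞) = (Q / P) ^ (1 / D) :=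
    ⟨_, ENNReal.coe_toNNReal (ENNReal.rpow_ne_top_of_nonneg (by positivity)
      (ENNReal.div_ne_top hQt hP0))⟩
  have hR0 : (R : ℝ≥0∞) ≠ 0 := by
    rw [hR]
    simp [ENNReal.div_eq_top, hQ0, hPt, hP0, hQt]
  have hRpos : 0 < R := pos_iff_ne_zero.2 (by exact_mod_cast hR0)
  have hRt : (R : ℝ≥0∞) ≠ ∞ := ENNReal.coe_ne_top
  have hRD : P * (R : ℝ≥0∞) ^ D = Q := by
    rw [hR, ← ENNReal.rpow_mul, one_div, inv_mul_cancel₀ hD.ne', ENNReal.rpow_one,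
      ENNReal.mul_div_cancel hP0 hPt]
  have hRs : (R : ℝ≥0∞) ^ (-s) * Q = P ^ (s / D) * Q ^ (1 - s / D) := by
    have he : 1 / D * -s = -(s / D) := by ring
    rw [hR, ← ENNReal.rpow_mul, he, div_eq_mul_inv,
      ENNReal.mul_rpow_of_ne_top hQt (ENNReal.inv_ne_top.2 hP0), ENNReal.inv_rpow,
      ← ENNReal.rpow_neg, neg_neg, sub_eq_neg_add, ENNReal.rpow_add _ _ hQ0 hQt, ENNReal.rpow_one]
    ring
  have h0 : π {x | φ x = 0} = 0 := by
    refine le_antisymm (ENNReal.le_of_forall_pos_le_add fun ε hε _ => ?_) zero_le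
    lift P to ℝ≥0 using hPt
    have hP : 0 < P := pos_iff_ne_zero.2 (by exact_mod_cast hP0)
    have hr : 0 < (ε / P) ^ (1 / D) := NNReal.rpow_pos (by positivity)
    refine (measure_mono ?_).trans ((hsub _ hr).trans (le_of_eq ?_))
    · intro x (hx : φ x = 0)
      simpa [hx] using hr
    · rw [← ENNReal.coe_rpow_of_nonneg _ hD.le, ← NNReal.rpow_mul, one_div, inv_mul_cancel₀ hD.ne',
        NNReal.rpow_one, ← ENNReal.coe_mul, mul_div_cancel₀ _ hP.ne', zero_add]
  have hpt : ∀ᵐ x ∂π, φ x ^ (-s) ≤ (R : ℝ≥0∞) ^ (-s) +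
      ∑' k : ℕ, {x | φ x < (R * (2⁻¹) ^ k : ℝ≥0)}.indicator
        (fun _ => ((R * (2⁻¹) ^ (k+1) : ℝ≥0) : ℝ≥0∞) ^ (-s)) x := by
    filter_upwards [measure_eq_zero_iff_ae_notMem.1 h0] with x hx
    have hx0 : φ x ≠ 0 := hx
    rcases le_or_gt (R : ℝ≥0∞) (φ x) with h | h
    · exact (ENNReal.rpow_neg_le_rpow_neg hs h).trans le_self_add
    refine le_trans ?_ le_add_self
    obtain ⟨y, hy⟩ : ∃ y : ℝ≥0, φ x = y := ⟨_, (ENNReal.coe_toNNReal h.ne_top).symm⟩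
    have hy0 : 0 < y := pos_iff_ne_zero.2 (by rintro rfl; simp [hy] at hx0)
    have hyR : y < R := by rw [hy] at h; exact_mod_cast h
    have hex : ∃ k : ℕ, R * (2⁻¹ : ℝ≥0) ^ k ≤ y := by
      obtain ⟨k, hk⟩ := exists_pow_lt_of_lt_one (x := y / R) (y := (2⁻¹ : ℝ≥0)) (by positivity)
        (by rw [inv_lt_one₀] <;> norm_num)
      exact ⟨k, by rw [mul_comm]; exact ((lt_div_iff₀ hRpos).1 hk).le⟩
    obtain ⟨k, hk1, hk2⟩ : ∃ k : ℕ, R * (2⁻¹ : ℝ≥0) ^ (k + 1) ≤ y ∧ y < R * (2⁻¹ : ℝ≥0) ^ k := by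
      classical
      have hne : Nat.find hex ≠ 0 := by
        intro h0
        have := Nat.find_spec hex
        rw [h0, pow_zero, mul_one] at this
        exact absurd this hyR.not_ge
      obtain ⟨k, hk⟩ := Nat.exists_eq_succ_of_ne_zero hne
      have hspec := Nat.find_spec hex
      rw [hk] at hspec
      exact ⟨k, hspec, not_le.1 (Nat.find_min hex (by lia))⟩
    refine le_trans ?_ (ENNReal.le_tsum k)
    rw [indicator_of_mem (by rw [mem_ofPred_eq, hy]; exact_mod_cast hk2), hy]
    exact ENNReal.rpow_neg_le_rpow_neg hs (by exact_mod_cast hk1)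
  calc ∫⁻ x, φ x ^ (-s) ∂π ≤ ∫⁻ x, ((R : ℝ≥0∞) ^ (-s) +
      ∑' k : ℕ, {x | φ x < (R * (2⁻¹) ^ k : ℝ≥0)}.indicator
        (fun _ => ((R * (2⁻¹) ^ (k+1) : ℝ≥0) : ℝ≥0∞) ^ (-s)) x) ∂π := lintegral_mono_ae hpt
    _ = (R : ℝ≥0∞) ^ (-s) * Q + ∑' k : ℕ, ((R * (2⁻¹) ^ (k+1) : ℝ≥0) : ℝ≥0∞) ^ (-s) *
          π {x | φ x < (R * (2⁻¹) ^ k : ℝ≥0)} := by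
        rw [lintegral_add_left measurable_const, lintegral_const, lintegral_tsum]
        · congr 2
          ext k
          rw [lintegral_indicator_const]
          exact measurableSet_lt hφ measurable_const
        · intro k
          exact (measurable_const.indicator (measurableSet_lt hφ measurable_const)).aemeasurable
    _ ≤ (R : ℝ≥0∞) ^ (-s) * Q + ∑' k : ℕ, (2 ^ s * ((R : ℝ≥0∞) ^ (-s) * Q)) * q ^ k := by
        refine add_le_add le_rfl (ENNReal.tsum_le_tsum fun k => ?_)
        refine (mul_le_mul_right (hsub _ (by positivity)) _).trans (le_of_eq ?_)
        have hk : ((2⁻¹ : ℝ≥0∞) ^ k) ≠ ∞ := by simp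
        have hk0 : ((2⁻¹ : ℝ≥0∞) ^ k) ≠ 0 := by simp
        have e2 : ((2⁻¹ : ℝ≥0∞)) ^ (-s) = 2 ^ s := by rw [ENNReal.inv_rpow, ← ENNReal.rpow_neg, neg_neg]
        have e3 : ((2⁻¹ : ℝ≥0∞) ^ k) ^ (-s) * ((2⁻¹ : ℝ≥0∞) ^ k) ^ D = q ^ k := by
          rw [← ENNReal.rpow_add _ _ hk0 hk, hq, ← ENNReal.rpow_natCast, ← ENNReal.rpow_natCast,
            ← ENNReal.rpow_mul, ← ENNReal.rpow_mul]
          congr 1; ring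
        push_cast
        rw [← mul_assoc, pow_succ,
          ENNReal.mul_rpow_of_ne_top hRt (by finiteness), ENNReal.mul_rpow_of_ne_top hk (by simp),
          ENNReal.mul_rpow_of_ne_top hRt hk, ← hRD, ← e3, e2]
        ring
    _ = (1 + 2 ^ s * (1 - q)⁻¹) * ((R : ℝ≥0∞) ^ (-s) * Q) := by
        rw [ENNReal.tsum_mul_left, ENNReal.tsum_geometric]
        ring
    _ = _ := by rw [hRs]

section Frostman

/-- The growth condition `μ (B_r(x)) ≤ A r ^ d` for all balls. -/
def IsFrostman {X : Type*} [PseudoMetricSpace X] [MeasurableSpace X] (μ : Measure X)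
    (A : ℝ≥0) (d : ℝ) : Prop :=
  ∀ (x : X) (r : ℝ≥0), 0 < r → μ (Metric.ball x r) ≤ A * (r : ℝ≥0∞) ^ d

variable {E : Type*} [NormedAddCommGroup E] [InnerProductSpace ℝ E] [FiniteDimensional ℝ E]
  [MeasurableSpace E] [BorelSpace E]

theorem IsFrostman.mono {X : Type*} [PseudoMetricSpace X] [MeasurableSpace X] {μ ν : Measure X}
    {A B : ℝ≥0} {d : ℝ} (h : IsFrostman μ A d) (hν : ν ≤ μ) (hAB : A ≤ B) : IsFrostman ν B d :=
  fun x r hr => (hν _).trans ((h x r hr).trans (by gcongr))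

theorem volume_ball_eq (x : E) {r : ℝ≥0} (hr : 0 < r) :
    volume (Metric.ball x r) =
      volume (Metric.ball (0 : E) 1) * (r : ℝ≥0∞) ^ (Module.finrank ℝ E) := by
  rw [Measure.addHaar_ball_of_pos volume x (by exact_mod_cast hr), mul_comm,
    ENNReal.ofReal_pow r.coe_nonneg, ENNReal.ofReal_coe_nnreal]

theorem isFrostman_volume :
    IsFrostman (volume : Measure E) (volume (Metric.ball (0 : E) 1)).toNNReal
      (Module.finrank ℝ E) := fun x r hr => by
  rw [volume_ball_eq x hr, ENNReal.coe_toNNReal measure_ball_lt_top.ne, ENNReal.rpow_natCast]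

theorem ofPred_edist_lt {X : Type*} [PseudoMetricSpace X] (x : X) (r : ℝ≥0) :
    {y | edist x y < r} = Metric.ball x r := by
  ext y
  rw [mem_ofPred_eq, edist_comm, edist_lt_coe, Metric.mem_ball, ← NNReal.coe_lt_coe, coe_nndist]

theorem ofPred_edist_lt' {X : Type*} [PseudoMetricSpace X] (x : X) (r : ℝ≥0) :
    {y | edist y x < r} = Metric.ball x r := by
  simp_rw [edist_comm _ x, ofPred_edist_lt]

theorem le_rpow_mul_rpow_of_le {a b c : ℝ≥0∞} {τ : ℝ} (h0 : 0 ≤ τ) (h1 : τ ≤ 1) (hb : a ≤ b)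
    (hc : a ≤ c) : a ≤ b ^ τ * c ^ (1 - τ) := by
  calc a = a ^ τ * a ^ (1 - τ) := by
        rw [← ENNReal.rpow_add_of_nonneg _ _ h0 (by linarith)]; simp
    _ ≤ _ := mul_le_mul' (ENNReal.rpow_le_rpow hb h0) (ENNReal.rpow_le_rpow hc (by linarith))

/-- The bilinear Riesz form on characteristic functions, with respect to a Frostman measure and
Lebesgue measure. -/
theorem IsFrostman.exists_riesz_bilinear_le {μ : Measure E} [IsFiniteMeasure μ] {A : ℝ≥0} {d : ℝ}
    (hμ : IsFrostman μ A d) (hd : 0 < d) (hn : 0 < Module.finrank ℝ E) {a b : ℝ} (ha : 0 ≤ a)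
    (hb : 0 ≤ b) (hab : 0 < a + b) (h : a / d + b / Module.finrank ℝ E < 1) :
    ∃ C : ℝ≥0∞, C ≠ ∞ ∧ ∀ G F : Set E, MeasurableSet G → MeasurableSet F → volume F ≠ ∞ →
      ∫⁻ x in G, (∫⁻ y in F, edist x y ^ (-(a + b))) ∂μ ≤
        C * (μ G ^ (1 - a / d) * volume F ^ (1 - b / Module.finrank ℝ E)) := by
  set n : ℝ := (Module.finrank ℝ E : ℝ)
  have hn' : 0 < n := Nat.cast_pos.2 hn
  set θ := a / d + b / n with hθ
  have hθ0 : 0 < θ := by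
    rcases ha.eq_or_lt with rfl | ha'
    · have : 0 < b := by linarith
      positivity
    · positivity
  set τ := a / d / θ with hτ
  have hτ0 : 0 ≤ τ := by positivity
  have hτ1 : τ ≤ 1 := by
    rw [hτ, div_le_one hθ0, hθ]
    have : 0 ≤ b / n := by positivity
    linarith
  set D := (a + b) / θ with hD
  have hsD : a + b < D := by
    rw [hD, lt_div_iff₀ hθ0]
    nlinarith
  have hDeq : D = d * τ + n * (1 - τ) := by
    have hdτ : d * τ = a / θ := by rw [hτ]; field_simp
    have hnτ : n * (1 - τ) = b / θ := by
      rw [eq_div_iff hθ0.ne', hτ, mul_assoc, sub_mul, div_mul_cancel₀ _ hθ0.ne', one_mul, hθ]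
      field_simp
      ring
    rw [hdτ, hnτ, hD, add_div]
  have hsDθ : (a + b) / D = θ := by rw [hD]; field_simp
  have hA : IsFrostman μ (A + 1) d := hμ.mono le_rfl (by simp)
  set c : ℝ≥0 := (volume (Metric.ball (0 : E) 1)).toNNReal with hc
  have hc0 : 0 < c := ENNReal.toNNReal_pos (Metric.measure_ball_pos _ _ one_pos).ne'
    measure_ball_lt_top.ne
  obtain ⟨C, hC, hCle⟩ := lintegral_rpow_neg_le (X := E × E) hab.le hsD
  set K : ℝ≥0∞ := ((A + 1 : ℝ≥0) : ℝ≥0∞) ^ τ * (c : ℝ≥0∞) ^ (1 - τ) with hK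
  have hKt : K ≠ ∞ := ENNReal.mul_ne_top (by simp) (by simp [hτ1])
  have hK0 : K ≠ 0 := by
    rw [hK, ← ENNReal.coe_rpow_of_nonneg _ hτ0, ← ENNReal.coe_rpow_of_nonneg _ (by linarith)]
    norm_cast
    positivity
  refine ⟨C * K ^ θ, ENNReal.mul_ne_top hC (by finiteness), fun G F hG hF hFt => ?_⟩
  rcases eq_or_ne (volume F) 0 with hF0 | hF0
  · simp [Measure.restrict_eq_zero.2 hF0]
  rcases eq_or_ne (μ G) 0 with hG0 | hG0
  · simp [Measure.restrict_eq_zero.2 hG0]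
  have hGt : μ G ≠ ∞ := measure_ne_top _ _
  have : IsFiniteMeasure (volume.restrict F : Measure E) := ⟨by simpa using hFt.lt_top⟩
  set π : Measure (E × E) := (μ.restrict G).prod (volume.restrict F) with hπ
  have hm : Measurable fun p : E × E => edist p.1 p.2 := by fun_prop
  have hkey : ∀ r : ℝ≥0, 0 < r → π {p | edist p.1 p.2 < r} ≤
      (K * (volume F ^ τ * μ G ^ (1 - τ))) * (r : ℝ≥0∞) ^ D := by
    intro r hr
    have hms : MeasurableSet {p : E × E | edist p.1 p.2 < r} := measurableSet_lt hm measurable_const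
    have h1 : π {p | edist p.1 p.2 < r} ≤ ((A + 1 : ℝ≥0) * (r : ℝ≥0∞) ^ d) * volume F := by
      rw [hπ, Measure.prod_apply_symm hms]
      calc _ ≤ ∫⁻ y in F, ((A + 1 : ℝ≥0) * (r : ℝ≥0∞) ^ d) := by
            refine lintegral_mono fun y => ?_
            simp only [preimage_ofPred_eq, ofPred_edist_lt']
            exact (Measure.restrict_apply_le _ _).trans (hA y r hr)
        _ = _ := by simp
    have h2 : π {p | edist p.1 p.2 < r} ≤ (c * (r : ℝ≥0∞) ^ n) * μ G := by
      rw [hπ, Measure.prod_apply hms]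
      calc _ ≤ ∫⁻ x in G, (c * (r : ℝ≥0∞) ^ n) ∂μ := by
            refine lintegral_mono fun y => ?_
            simp only [preimage_ofPred_eq, ofPred_edist_lt]
            exact (Measure.restrict_apply_le _ _).trans (isFrostman_volume y r hr)
        _ = _ := by simp
    refine (le_rpow_mul_rpow_of_le hτ0 hτ1 h1 h2).trans (le_of_eq ?_)
    have hr0 : (r : ℝ≥0∞) ≠ 0 := by exact_mod_cast hr.ne'
    have h1τ : 0 ≤ 1 - τ := by linarith
    rw [ENNReal.mul_rpow_of_nonneg _ _ hτ0, ENNReal.mul_rpow_of_nonneg _ _ hτ0,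
      ENNReal.mul_rpow_of_nonneg _ _ h1τ, ENNReal.mul_rpow_of_nonneg _ _ h1τ,
      ← ENNReal.rpow_mul, ← ENNReal.rpow_mul, hDeq, ENNReal.rpow_add _ _ hr0 ENNReal.coe_ne_top, hK]
    ring
  have := hCle π _ hm _ (by
    refine mul_ne_zero hK0 (mul_ne_zero ?_ ?_) <;> simp [hF0, hG0, hFt, hGt]) (by
    refine ENNReal.mul_ne_top hKt (ENNReal.mul_ne_top ?_ ?_) <;> simp [hF0, hG0, hFt, hGt]) hkey
  rw [hπ, lintegral_prod _ (hm.pow_const _).aemeasurable] at this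
  refine this.trans (le_of_eq ?_)
  have hu : (μ.restrict G).prod (volume.restrict F) univ = μ G * volume F := by
    rw [← univ_prod_univ, Measure.prod_prod]; simp
  have e1 : 1 - a / d = (1 - τ) * θ + (1 - θ) := by rw [hτ]; field_simp; ring
  have e2 : 1 - b / n = τ * θ + (1 - θ) := by rw [hτ]; field_simp; rw [hθ]; field_simp; ring
  have h1θ : 0 ≤ 1 - θ := by linarith
  rw [hu, hsDθ, ENNReal.mul_rpow_of_nonneg K _ hθ0.le,
    ENNReal.mul_rpow_of_nonneg (volume F ^ τ) _ hθ0.le,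
    ENNReal.mul_rpow_of_nonneg _ _ h1θ, e1, e2, ENNReal.rpow_add _ _ hF0 hFt,
    ENNReal.rpow_add _ _ hG0 hGt, ENNReal.rpow_mul, ENNReal.rpow_mul]
  ring

end Frostman

section Potential

variable {E : Type*} [NormedAddCommGroup E] [InnerProductSpace ℝ E] [FiniteDimensional ℝ E]
  [MeasurableSpace E] [BorelSpace E]

theorem HasCompactSupport.enorm_le_lintegral_Ioi_deriv {F : Type*} [NormedAddCommGroup F]
    [NormedSpace ℝ F] {f : ℝ → F} (hf : ContDiff ℝ 1 f) (hc : HasCompactSupport f) (x : ℝ) :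
    ‖f x‖ₑ ≤ ∫⁻ y in Ioi x, ‖deriv f y‖ₑ := by
  have h := HasCompactSupport.enorm_le_lintegral_Ici_deriv (f := fun y => f (-y))
    (hf.comp contDiff_neg) (hc.comp_homeomorph (Homeomorph.neg ℝ)) (-x)
  have e : ∫⁻ y in Iic (-x), ‖deriv (fun y => f (-y)) y‖ₑ = ∫⁻ y in Ici x, ‖deriv f y‖ₑ := by
    have := (Measure.measurePreserving_neg (volume : Measure ℝ)).setLIntegral_comp_preimage_emb
      (MeasurableEquiv.neg ℝ).measurableEmbedding (fun y => ‖deriv f y‖ₑ) (Ici x)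
    rw [← this]
    simp [deriv_comp_neg]
  rw [e, neg_neg] at h
  rwa [setLIntegral_congr Ioi_ae_eq_Ici]

omit [FiniteDimensional ℝ E] [MeasurableSpace E] [BorelSpace E] in
/-- The value of a compactly supported function is controlled by the integral of the derivative
along any ray. -/
theorem HasCompactSupport.enorm_le_lintegral_ray {F : Type*} [NormedAddCommGroup F]
    [NormedSpace ℝ F] {v : E → F} (hv : ContDiff ℝ 1 v) (hc : HasCompactSupport v) (x : E) {z : E}
    (hz : z ≠ 0) (t : ℝ) :
    ‖v (x + t • z)‖ₑ ≤ ‖z‖ₑ * ∫⁻ r in Ioi t, ‖fderiv ℝ v (x + r • z)‖ₑ := by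
  have hemb : Topology.IsClosedEmbedding fun r : ℝ => x + r • z :=
    (Homeomorph.addLeft x).isClosedEmbedding.comp (isClosedEmbedding_smul_left hz)
  have h := HasCompactSupport.enorm_le_lintegral_Ioi_deriv (f := fun r : ℝ => v (x + r • z))
    (hv.comp (by fun_prop)) (hc.comp_isClosedEmbedding hemb) t
  refine h.trans ?_
  rw [← lintegral_const_mul' _ _ enorm_ne_top]
  refine lintegral_mono fun r => ?_
  have hd : HasDerivAt (fun r : ℝ => v (x + r • z)) (fderiv ℝ v (x + r • z) z) r := by
    have h1 : HasDerivAt (fun r : ℝ => x + r • z) z r := by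
      simpa using ((hasDerivAt_id r).smul_const z).const_add x
    exact ((hv.differentiable one_ne_zero) _).hasFDerivAt.comp_hasDerivAt r h1
  simp only [hd.deriv]
  rw [mul_comm]
  exact ContinuousLinearMap.le_opENorm _ _

omit [FiniteDimensional ℝ E] [MeasurableSpace E] [BorelSpace E] in
theorem enorm_fderiv_iteratedFDeriv {F : Type*} [NormedAddCommGroup F] [NormedSpace ℝ F]
    (u : E → F) (k : ℕ) (x : E) :
    ‖fderiv ℝ (iteratedFDeriv ℝ k u) x‖ₑ = ‖iteratedFDeriv ℝ (k + 1) u x‖ₑ := by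
  rw [← ofReal_norm, ← ofReal_norm, norm_fderiv_iteratedFDeriv]

omit [FiniteDimensional ℝ E] [MeasurableSpace E] [BorelSpace E] in
theorem enorm_le_lintegral_ray_iteratedFDeriv {u : E → ℝ} (hu : ContDiff ℝ (⊤ : ℕ∞) u)
    (hc : HasCompactSupport u) (x : E) {z : E} (hz : z ≠ 0) (k : ℕ) :
    ‖u x‖ₑ ≤ ‖z‖ₑ ^ (k + 1) *
      ∫⁻ t in Ioi (0 : ℝ), ENNReal.ofReal t ^ k * ‖iteratedFDeriv ℝ (k + 1) u (x + t • z)‖ₑ := by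
  have hcd : ∀ j : ℕ, ContDiff ℝ 1 (iteratedFDeriv ℝ j u) := fun j =>
    hu.iteratedFDeriv_right (by exact_mod_cast le_top)
  have hcont : ∀ j : ℕ, Continuous fun t : ℝ => ‖iteratedFDeriv ℝ j u (x + t • z)‖ₑ := fun j =>
    ((hcd j).continuous.comp (by fun_prop)).enorm
  have hray : ∀ (j : ℕ) (t : ℝ), ‖iteratedFDeriv ℝ j u (x + t • z)‖ₑ ≤
      ‖z‖ₑ * ∫⁻ r in Ioi t, ‖iteratedFDeriv ℝ (j + 1) u (x + r • z)‖ₑ := fun j t => by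
    simpa only [enorm_fderiv_iteratedFDeriv] using
      HasCompactSupport.enorm_le_lintegral_ray (hcd j) (hc.iteratedFDeriv j) x hz t
  induction k with
  | zero =>
    have h0 : ‖u x‖ₑ = ‖iteratedFDeriv ℝ 0 u (x + (0 : ℝ) • z)‖ₑ := by
      rw [← ofReal_norm, ← ofReal_norm, norm_iteratedFDeriv_zero]; simp
    rw [h0]
    simpa using hray 0 0
  | succ k ih =>
    refine ih.trans ?_
    rw [pow_succ _ (k + 1), mul_assoc]
    gcongr
    set φ : ℝ → ℝ≥0∞ := fun r => ‖iteratedFDeriv ℝ (k + 2) u (x + r • z)‖ₑ with hφ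
    have hφm : Measurable φ := (hcont (k + 2)).measurable
    calc ∫⁻ t in Ioi (0 : ℝ), ENNReal.ofReal t ^ k * ‖iteratedFDeriv ℝ (k + 1) u (x + t • z)‖ₑ
        ≤ ∫⁻ t in Ioi (0 : ℝ), ‖z‖ₑ * ∫⁻ r in Ioi (0 : ℝ),
            (Ioi t).indicator (fun r => ENNReal.ofReal t ^ k * φ r) r := by
          refine setLIntegral_mono' measurableSet_Ioi fun t (ht : 0 < t) => ?_
          refine (mul_le_mul_right (hray (k + 1) t) _).trans (le_of_eq ?_)
          rw [mul_left_comm]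
          congr 1
          rw [← lintegral_const_mul _ hφm, lintegral_indicator measurableSet_Ioi,
            Measure.restrict_restrict measurableSet_Ioi,
            inter_eq_left.2 (Ioi_subset_Ioi ht.le)]
      _ = ‖z‖ₑ * ∫⁻ r in Ioi (0 : ℝ), ∫⁻ t in Ioi (0 : ℝ),
            (Ioi t).indicator (fun r => ENNReal.ofReal t ^ k * φ r) r := by
          have hm : Measurable (Function.uncurry fun t r : ℝ =>
              (Ioi t).indicator (fun r => ENNReal.ofReal t ^ k * φ r) r) := by
            have : (Function.uncurry fun t r : ℝ =>
              (Ioi t).indicator (fun r => ENNReal.ofReal t ^ k * φ r) r) =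
              {p : ℝ × ℝ | p.1 < p.2}.indicator fun p => ENNReal.ofReal p.1 ^ k * φ p.2 := by
              ext ⟨t, r⟩
              simp [indicator_apply]
            rw [this]
            exact Measurable.indicator (by fun_prop) (measurableSet_lt measurable_fst measurable_snd)
          rw [lintegral_const_mul, lintegral_lintegral_swap hm.aemeasurable]
          exact hm.lintegral_prod_right
      _ ≤ ‖z‖ₑ * ∫⁻ r in Ioi (0 : ℝ), ENNReal.ofReal r ^ (k + 1) * φ r := by
          gcongr ‖z‖ₑ * ?_
          refine setLIntegral_mono' measurableSet_Ioi fun r (hr : 0 < r) => ?_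
          calc ∫⁻ t in Ioi (0 : ℝ), (Ioi t).indicator (fun r => ENNReal.ofReal t ^ k * φ r) r
              ≤ ∫⁻ t in Ioi (0 : ℝ), (Iio r).indicator (fun _ => ENNReal.ofReal r ^ k * φ r) t := by
                refine lintegral_mono fun t => ?_
                by_cases h : t < r
                · simp only [indicator_of_mem (mem_Ioi.2 h), indicator_of_mem (mem_Iio.2 h)]
                  gcongr
                · simp [h]
            _ = ENNReal.ofReal r ^ (k + 1) * φ r := by
                rw [lintegral_indicator measurableSet_Iio, Measure.restrict_restrict measurableSet_Iio,
                  setLIntegral_const, inter_comm, Ioi_inter_Iio, Real.volume_Ioo, sub_zero]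
                ring

theorem setLIntegral_Ioi_ofReal_rpow_neg {n : ℕ} (hn : 0 < n) {c : ℝ} (hc : 0 < c) :
    ∫⁻ t in Ioi c, ENNReal.ofReal t ^ (-((n : ℝ) + 1)) ≤ ENNReal.ofReal c ^ (-(n : ℝ)) := by
  have hn_one : (1 : ℝ) ≤ n := by exact_mod_cast hn
  have hlt : -((n : ℝ) + 1) < -1 := by linarith
  calc ∫⁻ t in Ioi c, ENNReal.ofReal t ^ (-((n : ℝ) + 1))
      = ∫⁻ t in Ioi c, ENNReal.ofReal (t ^ (-((n : ℝ) + 1))) :=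
        setLIntegral_congr_fun measurableSet_Ioi fun t (ht : c < t) =>
          ENNReal.ofReal_rpow_of_pos (hc.trans ht)
    _ = ENNReal.ofReal (∫ t in Ioi c, t ^ (-((n : ℝ) + 1))) := by
        rw [ofReal_integral_eq_lintegral_ofReal (integrableOn_Ioi_rpow_of_lt hlt hc)]
        filter_upwards [ae_restrict_mem measurableSet_Ioi] with t (ht : c < t)
        exact Real.rpow_nonneg (hc.trans ht).le _
    _ ≤ _ := by
        rw [integral_Ioi_rpow_of_lt hlt hc, ENNReal.ofReal_rpow_of_pos hc]
        refine ENNReal.ofReal_le_ofReal ?_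
        have e : -((n : ℝ) + 1) + 1 = -n := by ring
        rw [e, neg_div_neg_eq]
        exact div_le_self (Real.rpow_nonneg hc.le _) hn_one

/-- Pointwise bound of a test function by the Riesz potential of its `m`-th derivative. -/
theorem exists_enorm_le_riesz_potential {m : ℕ} (hm : 1 ≤ m) (hmn : m < Module.finrank ℝ E) :
    ∃ C : ℝ≥0∞, C ≠ ∞ ∧ ∀ u : E → ℝ, ContDiff ℝ (⊤ : ℕ∞) u → HasCompactSupport u → ∀ x,
      ‖u x‖ₑ ≤ C * ∫⁻ y, ‖iteratedFDeriv ℝ m u y‖ₑ *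
        edist x y ^ (-((Module.finrank ℝ E : ℝ) - m)) := by
  set n := Module.finrank ℝ E with hn
  have hn0 : 0 < n := by lia
  obtain ⟨k, rfl⟩ : ∃ k, m = k + 1 := ⟨m - 1, by lia⟩
  set B : Set E := Metric.ball 0 1
  have hB0 : volume B ≠ 0 := (Metric.measure_ball_pos _ _ one_pos).ne'
  have hBt : volume B ≠ ∞ := measure_ball_lt_top.ne
  refine ⟨(volume B)⁻¹, ENNReal.inv_ne_top.2 hB0, fun u hu hc x => ?_⟩
  rw [mul_comm, ← div_eq_mul_inv, ENNReal.le_div_iff_mul_le (.inl hB0) (.inl hBt), mul_comm]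
  set f : E → ℝ≥0∞ := fun y => ‖iteratedFDeriv ℝ (k + 1) u y‖ₑ with hf
  have hfm : Measurable f := by
    have : ContDiff ℝ 1 (iteratedFDeriv ℝ (k + 1) u) :=
      hu.iteratedFDeriv_right (by exact_mod_cast le_top)
    exact this.continuous.enorm.measurable
  have hnt : Nontrivial E := Module.nontrivial_of_finrank_pos (R := ℝ) hn0
  calc volume B * ‖u x‖ₑ = ∫⁻ z in B, ‖u x‖ₑ := by simp [mul_comm]
    _ ≤ ∫⁻ z in B, ∫⁻ t in Ioi (0 : ℝ), ‖z‖ₑ ^ (k + 1) * (ENNReal.ofReal t ^ k * f (x + t • z)) := by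
        refine lintegral_mono_ae (ae_restrict_of_ae ?_)
        filter_upwards [measure_eq_zero_iff_ae_notMem.1 (measure_singleton (μ := volume) (0 : E))]
          with z hz
        rw [lintegral_const_mul _ (by fun_prop)]
        exact enorm_le_lintegral_ray_iteratedFDeriv hu hc x hz k
    _ = ∫⁻ t in Ioi (0 : ℝ), ∫⁻ z in B, ‖z‖ₑ ^ (k + 1) * (ENNReal.ofReal t ^ k * f (x + t • z)) :=
        lintegral_lintegral_swap (by fun_prop)
    _ = ∫⁻ t in Ioi (0 : ℝ), ∫⁻ w, {w : E | ‖w‖ < t}.indicator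
          (fun w => ENNReal.ofReal t ^ (-((n : ℝ) + 1)) * (‖w‖ₑ ^ (k + 1) * f (x + w))) w := by
        refine setLIntegral_congr_fun measurableSet_Ioi fun t (ht : 0 < t) => ?_
        set T := ENNReal.ofReal t
        have hT0 : T ≠ 0 := (ENNReal.ofReal_pos.2 ht).ne'
        have hTt : T ≠ ∞ := ENNReal.ofReal_ne_top
        have hball : MeasurableSet {w : E | ‖w‖ < t} := measurableSet_lt (by fun_prop) (by fun_prop)
        set g : E → ℝ≥0∞ := {w : E | ‖w‖ < t}.indicator
          (fun w => T⁻¹ * (‖w‖ₑ ^ (k + 1) * f (x + w))) with hg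
        have hgm : Measurable g := Measurable.indicator (by fun_prop) hball
        have hscale : ∫⁻ z, g (t • z) = T ^ (-(n : ℝ)) * ∫⁻ w, g w := by
          rw [← lintegral_map hgm (by fun_prop), Measure.map_addHaar_smul _ ht.ne',
            lintegral_smul_measure, abs_of_pos (by positivity), smul_eq_mul,
            ENNReal.ofReal_inv_of_pos (by positivity), ENNReal.ofReal_pow ht.le, ENNReal.rpow_neg,
            ENNReal.rpow_natCast]
        calc _ = ∫⁻ z, g (t • z) := by
              rw [← lintegral_indicator measurableSet_ball]
              congr 1 with z
              have hmem : t • z ∈ {w : E | ‖w‖ < t} ↔ z ∈ B := by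
                simp only [mem_ofPred_eq, norm_smul, Real.norm_of_nonneg ht.le, B,
                  mem_ball_zero_iff]
                exact mul_lt_iff_lt_one_right ht
              by_cases hz : z ∈ B
              · rw [indicator_of_mem hz, hg, indicator_of_mem (hmem.2 hz), enorm_smul,
                  Real.enorm_of_nonneg ht.le, mul_pow, pow_succ T]
                calc _ = (T⁻¹ * T) * (T ^ k * ‖z‖ₑ ^ (k + 1) * f (x + t • z)) := by
                      rw [ENNReal.inv_mul_cancel hT0 hTt]; ring
                  _ = _ := by ring
              · rw [indicator_of_notMem hz, hg, indicator_of_notMem (mt hmem.1 hz)]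
          _ = _ := by
              rw [hscale, ← lintegral_const_mul _ hgm]
              congr 1 with w
              have e : -((n : ℝ) + 1) = -n + -1 := by ring
              by_cases hw : w ∈ {w : E | ‖w‖ < t}
              · rw [hg, indicator_of_mem hw, indicator_of_mem hw, e,
                  ENNReal.rpow_add _ _ hT0 hTt, ENNReal.rpow_neg_one, mul_assoc]
              · rw [hg, indicator_of_notMem hw, indicator_of_notMem hw, mul_zero]
    _ = ∫⁻ w, ∫⁻ t in Ioi (0 : ℝ), {w : E | ‖w‖ < t}.indicator
          (fun w => ENNReal.ofReal t ^ (-((n : ℝ) + 1)) * (‖w‖ₑ ^ (k + 1) * f (x + w))) w := by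
        refine lintegral_lintegral_swap (Measurable.aemeasurable ?_)
        have : (Function.uncurry fun (t : ℝ) (w : E) => {w : E | ‖w‖ < t}.indicator
          (fun w => ENNReal.ofReal t ^ (-((n : ℝ) + 1)) * (‖w‖ₑ ^ (k + 1) * f (x + w))) w) =
            {p : ℝ × E | ‖p.2‖ < p.1}.indicator fun p =>
              ENNReal.ofReal p.1 ^ (-((n : ℝ) + 1)) * (‖p.2‖ₑ ^ (k + 1) * f (x + p.2)) := by
          ext ⟨t, w⟩
          simp [indicator_apply]
        rw [this]
        exact Measurable.indicator (by fun_prop)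
          (measurableSet_lt (by fun_prop) (by fun_prop))
    _ ≤ ∫⁻ w, f (x + w) * ‖w‖ₑ ^ (-((n : ℝ) - (k + 1 : ℕ))) := by
        refine lintegral_mono_ae ?_
        filter_upwards [measure_eq_zero_iff_ae_notMem.1 (measure_singleton (μ := volume) (0 : E))]
          with w hw
        have hw0 : 0 < ‖w‖ := norm_pos_iff.2 hw
        calc _ = ∫⁻ t in Ioi ‖w‖,
              ENNReal.ofReal t ^ (-((n : ℝ) + 1)) * (‖w‖ₑ ^ (k + 1) * f (x + w)) := by
              rw [← inter_eq_left.2 (Ioi_subset_Ioi (norm_nonneg w)),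
                ← Measure.restrict_restrict measurableSet_Ioi,
                ← lintegral_indicator (s := Ioi ‖w‖) measurableSet_Ioi]
              rfl
          _ = (∫⁻ t in Ioi ‖w‖, ENNReal.ofReal t ^ (-((n : ℝ) + 1))) *
                (‖w‖ₑ ^ (k + 1) * f (x + w)) := lintegral_mul_const _ (by fun_prop)
          _ ≤ ENNReal.ofReal ‖w‖ ^ (-(n : ℝ)) * (‖w‖ₑ ^ (k + 1) * f (x + w)) := by
              gcongr; exact setLIntegral_Ioi_ofReal_rpow_neg hn0 hw0
          _ = _ := by
              have e : -((n : ℝ) - (k + 1 : ℕ)) = -n + (k + 1 : ℕ) := by ring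
              rw [ofReal_norm, e, ENNReal.rpow_add _ _ (by simpa using hw) enorm_ne_top,
                ENNReal.rpow_natCast]
              ring
    _ = ∫⁻ y, f y * edist x y ^ (-((n : ℝ) - (k + 1 : ℕ))) := by
        rw [← lintegral_add_left_eq_self (fun y => f y * edist x y ^ (-((n : ℝ) - (k + 1 : ℕ)))) x]
        simp only [edist_eq_enorm_sub, sub_add_cancel_left, enorm_neg]

end Potential

section Trace

variable {E : Type*} [NormedAddCommGroup E] [InnerProductSpace ℝ E] [FiniteDimensional ℝ E]
  [MeasurableSpace E] [BorelSpace E]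

/-- A nonlocal relative isoperimetric inequality on balls. -/
theorem volume_inter_ball_mul_volume_ball_diff_le {S : Set E} (hS : MeasurableSet S) (c : E)
    {ε : ℝ} {N : ℕ} (hN : 0 < N) :
    volume (S ∩ Metric.ball c (N * ε)) * volume (Metric.ball c (N * ε) \ S) ≤
      (N : ℝ≥0∞) ^ (Module.finrank ℝ E + 1) * ∫⁻ h in Metric.ball (0 : E) (2 * ε),
        volume (S ∩ Metric.ball c (N * ε) ∩ {a | a + h ∉ S}) := by
  set n := Module.finrank ℝ E
  set B := Metric.ball c (N * ε) with hB
  have hBm : MeasurableSet B := measurableSet_ball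
  have hN' : (0 : ℝ) < N := by exact_mod_cast hN
  set T : Set (E × E) := {q | q.1 ∈ S ∩ B ∧ q.1 + (N : ℝ) • q.2 ∈ B \ S} with hT
  have hTm : MeasurableSet T := by
    refine MeasurableSet.inter (measurable_fst (hS.inter hBm)) ?_
    have : Measurable fun q : E × E => q.1 + (N : ℝ) • q.2 := by fun_prop
    exact this (hBm.diff hS)
  have hN0 : (N : ℝ≥0∞) ≠ 0 := by exact_mod_cast hN.ne'
  have h1 : volume (S ∩ B) * volume (B \ S) =
      (N : ℝ≥0∞) ^ n * ((volume : Measure E).prod volume) T := by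
    rw [Measure.prod_apply hTm, ← lintegral_const_mul _ (measurable_measure_prodMk_left hTm)]
    rw [mul_comm, ← setLIntegral_const, ← lintegral_indicator (hS.inter hBm)]
    congr 1 with x
    by_cases hx : x ∈ S ∩ B
    · rw [indicator_of_mem hx]
      have : Prod.mk x ⁻¹' T = (fun h : E => (N : ℝ) • h) ⁻¹' ((fun y => x + y) ⁻¹' (B \ S)) := by
        ext h
        simp only [hT, mem_preimage, mem_ofPred_eq, hx, true_and]
      rw [this, Measure.addHaar_preimage_smul _ hN'.ne', measure_preimage_add, abs_of_pos (by positivity),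
        ENNReal.ofReal_inv_of_pos (by positivity), ENNReal.ofReal_pow hN'.le, ENNReal.ofReal_natCast,
        ← mul_assoc, ENNReal.mul_inv_cancel (pow_ne_zero _ hN0) (by simp), one_mul]
    · rw [indicator_of_notMem hx]
      have : Prod.mk x ⁻¹' T = ∅ := by
        ext h
        simp only [hT, mem_preimage, mem_ofPred_eq, hx, false_and, mem_empty_iff_false]
      simp [this]
  rw [h1, pow_succ, mul_assoc]
  gcongr
  rw [Measure.prod_apply_symm hTm,
    ← lintegral_const_mul' _ _ (by simp), ← lintegral_indicator measurableSet_ball]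
  refine lintegral_mono fun h => ?_
  by_cases hh : h ∈ Metric.ball (0 : E) (2 * ε)
  · rw [indicator_of_mem hh]
    have hsub : (fun x => (x, h)) ⁻¹' T ⊆ ⋃ i ∈ Finset.range N,
        (fun x => x + (i : ℝ) • h) ⁻¹' (S ∩ B ∩ {a | a + h ∉ S}) := by
      rintro x ⟨⟨hxS, hxB⟩, hyB, hyS⟩
      simp only at hxS hxB hyB hyS
      by_contra hcon
      simp only [mem_iUnion, not_exists, Finset.mem_range, mem_preimage, mem_inter_iff, mem_ofPred_eq,
        not_and, not_not] at hcon
      have key : ∀ i : ℕ, i ≤ N → x + (i : ℝ) • h ∈ S := by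
        intro i
        induction i with
        | zero => intro _; simpa using hxS
        | succ i ih =>
          intro hi
          have hi' : i ≤ N := by omega
          have hb : x + (i : ℝ) • h ∈ B := by
            have := (convex_ball c (N * ε)).add_smul_sub_mem hxB hyB
              (t := (i : ℝ) / N) ⟨by positivity, by
                rw [div_le_one hN']; exact_mod_cast hi'⟩
            rw [add_sub_cancel_left, smul_smul, div_mul_cancel₀ _ hN'.ne'] at this
            exact this
          have := hcon i (by omega) ⟨ih hi', hb⟩
          rw [add_assoc] at this
          have e : ((i + 1 : ℕ) : ℝ) • h = (i : ℝ) • h + h := by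
            push_cast; rw [add_smul, one_smul]
          rwa [e]
      exact hyS (key N le_rfl)
    calc _ ≤ _ := measure_mono hsub
      _ ≤ ∑ i ∈ Finset.range N, volume ((fun x => x + (i : ℝ) • h) ⁻¹' (S ∩ B ∩ {a | a + h ∉ S})) :=
          measure_biUnion_finset_le _ _
      _ = _ := by simp only [measure_preimage_add_right, Finset.sum_const, Finset.card_range, nsmul_eq_mul]
  · have : (fun x => (x, h)) ⁻¹' T = ∅ := by
      ext x
      simp only [mem_preimage, mem_empty_iff_false, iff_false]
      rintro ⟨⟨_, hxB⟩, hyB, _⟩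
      apply hh
      simp only at hxB hyB
      rw [hB, Metric.mem_ball] at hxB hyB
      have h3 : dist (x + (N : ℝ) • h) x < N * ε + N * ε :=
        (dist_triangle_right _ _ c).trans_lt (add_lt_add hyB hxB)
      rw [dist_self_add_left, norm_smul, Real.norm_of_nonneg hN'.le] at h3
      rw [mem_ball_zero_iff]
      nlinarith
    rw [this]; simp

theorem exists_radius_rpow_le {S : Set E} (hS : MeasurableSet S) (hSt : volume S ≠ ∞)
    (hn : 0 < Module.finrank ℝ E) {ε : ℝ≥0} (hε : 0 < ε) {x : E} (hx : Metric.ball x ε ⊆ S) :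
    ∃ r : ℝ≥0, 0 < r ∧
      volume (Metric.ball (0 : E) 1) * (r : ℝ≥0∞) ^ Module.finrank ℝ E ≤
        2 ^ (Module.finrank ℝ E + 1) * volume S ∧
      volume (Metric.ball (0 : E) 1) ^ 2 * (r : ℝ≥0∞) ^ ((Module.finrank ℝ E : ℝ) - 1) ≤
        2 ^ (Module.finrank ℝ E + 2) * (ε : ℝ≥0∞) ^ (-((Module.finrank ℝ E : ℝ) + 1)) *
          ∫⁻ h in Metric.ball (0 : E) (2 * ε), volume (S ∩ Metric.ball x r ∩ {a | a + h ∉ S}) := by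
  set n := Module.finrank ℝ E with hnE
  set ω := volume (Metric.ball (0 : E) 1)
  have hω0 : ω ≠ 0 := (Metric.measure_ball_pos _ _ one_pos).ne'
  have hωt : ω ≠ ∞ := measure_ball_lt_top.ne
  have hε0 : (ε : ℝ≥0∞) ≠ 0 := by exact_mod_cast hε.ne'
  set R : ℕ → ℝ≥0 := fun k => 2 ^ k * ε with hR
  have hRpos : ∀ k, 0 < R k := fun k => by positivity
  have hvol : ∀ k, volume (Metric.ball x (R k)) = ω * (R k : ℝ≥0∞) ^ n := fun k =>
    volume_ball_eq x (hRpos k)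
  have hex : ∃ k, 2 * volume (S ∩ Metric.ball x (R k)) ≤ volume (Metric.ball x (R k)) := by
    obtain ⟨k, hk⟩ := ENNReal.exists_nat_mul_gt (a := ω * (ε : ℝ≥0∞) ^ n) (b := 2 * volume S)
      (mul_ne_zero hω0 (pow_ne_zero _ hε0)) (ENNReal.mul_ne_top (by simp) hSt)
    refine ⟨k, ?_⟩
    calc _ ≤ 2 * volume S := by gcongr; exact inter_subset_left
      _ ≤ k * (ω * (ε : ℝ≥0∞) ^ n) := hk.le
      _ ≤ 2 ^ (k * n) * (ω * (ε : ℝ≥0∞) ^ n) := by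
          gcongr
          have : k ≤ 2 ^ (k * n) := (Nat.le_mul_of_pos_right k hn).trans Nat.lt_two_pow_self.le
          exact_mod_cast this
      _ = _ := by
          rw [hvol, hR]
          push_cast
          rw [mul_pow, ← pow_mul]
          ring
  classical
  set k := Nat.find hex with hk
  have hk1 : 2 * volume (S ∩ Metric.ball x (R k)) ≤ volume (Metric.ball x (R k)) :=
    Nat.find_spec hex
  have hkpos : k ≠ 0 := by
    intro h0
    rw [h0] at hk1
    have e : R 0 = ε := by simp [hR]
    rw [e, inter_eq_right.2 hx, two_mul] at hk1
    have hb : 0 < volume (Metric.ball x (ε : ℝ)) :=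
      Metric.measure_ball_pos _ _ (by exact_mod_cast hε)
    exact absurd hk1 (not_le.2 (ENNReal.lt_add_right measure_ball_lt_top.ne hb.ne'))
  obtain ⟨j, hj⟩ := Nat.exists_eq_succ_of_ne_zero hkpos
  have hj1 : volume (Metric.ball x (R j)) < 2 * volume (S ∩ Metric.ball x (R j)) := by
    have : j < Nat.find hex := by omega
    exact not_le.1 (Nat.find_min hex this)
  set b := volume (Metric.ball x (R k)) with hb
  set v := volume (S ∩ Metric.ball x (R k)) with hv
  set w := volume (Metric.ball x (R k) \ S) with hw
  have hvw : v + w = b := by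
    rw [hv, hw, inter_comm]
    exact measure_inter_add_sdiff _ hS
  have hvt : v ≠ ∞ := (measure_mono_top inter_subset_left).mt hSt
  have hbv : b ≤ 2 ^ (n + 1) * v := by
    have hbj : b = 2 ^ n * volume (Metric.ball x (R j)) := by
      rw [hb, hvol, hvol, hj, hR]
      push_cast
      rw [Nat.succ_eq_add_one, pow_succ]
      simp only [mul_pow]
      ring
    rw [hbj, pow_succ, mul_assoc]
    gcongr
    refine hj1.le.trans ?_
    gcongr
    exact hv ▸ measure_mono (inter_subset_inter_right _ (Metric.ball_subset_ball (by
      rw [hj]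
      simp only [hR]
      push_cast
      gcongr
      · norm_num
      · omega)))
  have hbw : b ≤ 2 * w := by
    have : v ≤ w := by
      rw [← hvw, two_mul] at hk1
      exact (ENNReal.add_le_add_iff_left hvt).1 hk1
    rw [← hvw, two_mul]
    gcongr
  have hP := volume_inter_ball_mul_volume_ball_diff_le hS x (ε := ε)
    (N := 2 ^ k) (by positivity)
  have eR : ((2 ^ k : ℕ) : ℝ) * (ε : ℝ) = (R k : ℝ) := by simp [hR]
  rw [eR] at hP
  have hRk0 : (R k : ℝ≥0∞) ≠ 0 := by exact_mod_cast (hRpos k).ne'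
  refine ⟨R k, hRpos k, ?_, ?_⟩
  · rw [← hvol]
    refine hbv.trans ?_
    gcongr
    exact measure_mono inter_subset_left
  · set W := ∫⁻ h in Metric.ball (0 : E) (2 * ε), volume (S ∩ Metric.ball x (R k) ∩ {a | a + h ∉ S})
    calc ω ^ 2 * (R k : ℝ≥0∞) ^ ((n : ℝ) - 1)
        = b * b * (R k : ℝ≥0∞) ^ (-((n : ℝ) + 1)) := by
          have e : (n : ℝ) - 1 = (n : ℝ) + n + -((n : ℝ) + 1) := by ring
          rw [e, ENNReal.rpow_add _ _ hRk0 ENNReal.coe_ne_top,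
            ENNReal.rpow_add _ _ hRk0 ENNReal.coe_ne_top, ENNReal.rpow_natCast, hb, hvol]
          ring
      _ ≤ (2 ^ (n + 1) * v) * (2 * w) * (R k : ℝ≥0∞) ^ (-((n : ℝ) + 1)) := by gcongr
      _ = 2 ^ (n + 2) * (v * w) * (R k : ℝ≥0∞) ^ (-((n : ℝ) + 1)) := by ring
      _ ≤ 2 ^ (n + 2) * (((2 ^ k : ℕ) : ℝ≥0∞) ^ (n + 1) * W) *
            (R k : ℝ≥0∞) ^ (-((n : ℝ) + 1)) := by gcongr
      _ = 2 ^ (n + 2) * (((2 ^ k : ℕ) : ℝ≥0∞) ^ (n + 1) * (R k : ℝ≥0∞) ^ (-((n : ℝ) + 1))) * W := by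
          ring
      _ = _ := by
          congr 2
          have e1 : (R k : ℝ≥0∞) = ((2 ^ k : ℕ) : ℝ≥0∞) * ε := by simp [hR]
          have e2 : (n : ℝ) + 1 = (n + 1 : ℕ) := by push_cast; ring
          have h20 : ((2 ^ k : ℕ) : ℝ≥0∞) ≠ 0 := by simp
          have h2t : ((2 ^ k : ℕ) : ℝ≥0∞) ≠ ∞ := ENNReal.natCast_ne_top _
          rw [e1, ENNReal.mul_rpow_of_ne_top h2t ENNReal.coe_ne_top, e2,
            ENNReal.rpow_neg (((2 ^ k : ℕ) : ℝ≥0∞)), ENNReal.rpow_natCast, ← mul_assoc,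
            ENNReal.mul_inv_cancel (pow_ne_zero _ h20) (ENNReal.pow_ne_top h2t), one_mul]

theorem exists_measure_erosion_le (hn : 0 < Module.finrank ℝ E) :
    ∃ C : ℝ≥0∞, C ≠ ∞ ∧ ∀ (η : Measure E) (A : ℝ≥0), IsFrostman η A (Module.finrank ℝ E - 1) →
      ∀ S : Set E, MeasurableSet S → volume S ≠ ∞ → ∀ ε : ℝ≥0, 0 < ε →
        η {x | Metric.ball x ε ⊆ S} ≤ C * A * (ε : ℝ≥0∞) ^ (-((Module.finrank ℝ E : ℝ) + 1)) *
          ∫⁻ h in Metric.ball (0 : E) (2 * ε), volume (S ∩ {a | a + h ∉ S}) := by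
  set n := Module.finrank ℝ E with hnE
  set ω := volume (Metric.ball (0 : E) 1)
  have hω0 : ω ≠ 0 := (Metric.measure_ball_pos _ _ one_pos).ne'
  have hωt : ω ≠ ∞ := measure_ball_lt_top.ne
  have hn1 : (0 : ℝ) ≤ (n : ℝ) - 1 := by
    have : (1 : ℝ) ≤ n := by exact_mod_cast hn
    linarith
  refine ⟨6 ^ ((n : ℝ) - 1) * (ω ^ 2)⁻¹ * 2 ^ (n + 2), ?_, ?_⟩
  · refine ENNReal.mul_ne_top (ENNReal.mul_ne_top ?_ ?_) (by simp)
    · exact ENNReal.rpow_ne_top_of_nonneg hn1 (by simp)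
    · exact ENNReal.inv_ne_top.2 (pow_ne_zero _ hω0)
  intro η A hη S hS hSt ε hε
  set t := {x : E | Metric.ball x ε ⊆ S}
  have hch : ∀ x : E, ∃ r : ℝ≥0, x ∈ t → 0 < r ∧
      ω * (r : ℝ≥0∞) ^ n ≤ 2 ^ (n + 1) * volume S ∧
      ω ^ 2 * (r : ℝ≥0∞) ^ ((n : ℝ) - 1) ≤ 2 ^ (n + 2) * (ε : ℝ≥0∞) ^ (-((n : ℝ) + 1)) *
          ∫⁻ h in Metric.ball (0 : E) (2 * ε), volume (S ∩ Metric.ball x r ∩ {a | a + h ∉ S}) := by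
    intro x
    by_cases hx : x ∈ t
    · obtain ⟨r, hr⟩ := exists_radius_rpow_le hS hSt hn hε hx
      exact ⟨r, fun _ => hr⟩
    · exact ⟨0, fun h => absurd h hx⟩
  choose r hr using hch
  set M := ((2 ^ (n + 1) * volume S / ω) ^ ((n : ℝ)⁻¹)) with hM
  have hMt : M ≠ ∞ := ENNReal.rpow_ne_top_of_nonneg (by positivity)
    (ENNReal.div_ne_top (ENNReal.mul_ne_top (by simp) hSt) hω0)
  have hbound : ∀ x ∈ t, (r x : ℝ) ≤ M.toReal := by
    intro x hx
    have h := (hr x hx).2.1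
    have h2 : (r x : ℝ≥0∞) ≤ M := by
      rw [hM, ENNReal.le_rpow_inv_iff (by exact_mod_cast hn), ENNReal.rpow_natCast,
        ENNReal.le_div_iff_mul_le (Or.inl hω0) (Or.inl hωt), mul_comm]
      exact h
    have := ENNReal.toReal_mono hMt h2
    simpa using this
  obtain ⟨u, hut, hdisj, hcov⟩ := Vitali.exists_disjoint_subfamily_covering_enlargement_closedBall
    t (fun x => x) (fun x => (r x : ℝ)) M.toReal hbound 5 (by norm_num)
  have hdisj' : u.PairwiseDisjoint fun a => Metric.ball a (r a : ℝ) :=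
    hdisj.mono fun a => Metric.ball_subset_closedBall
  have hpos : ∀ a ∈ u, 0 < r a := fun a ha => (hr a (hut ha)).1
  have hcount : u.Countable := by
    refine hdisj'.countable_of_isOpen (fun a _ => Metric.isOpen_ball) fun a ha => ?_
    exact Metric.nonempty_ball.2 (by exact_mod_cast hpos a ha)
  have hsub : t ⊆ ⋃ a ∈ u, Metric.ball a ((6 * r a : ℝ≥0) : ℝ) := by
    intro x hx
    obtain ⟨b, hb, hxb⟩ := hcov x hx
    refine mem_iUnion₂.2 ⟨b, hb, ?_⟩
    have h1 := hxb (Metric.mem_closedBall_self (NNReal.coe_nonneg _))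
    have h2 : (0 : ℝ) < r b := by exact_mod_cast hpos b hb
    refine Metric.closedBall_subset_ball ?_ h1
    push_cast
    linarith
  have : Countable u := hcount.to_subtype
  set W : E → E → ℝ≥0∞ := fun x h => volume (S ∩ Metric.ball x (r x) ∩ {a | a + h ∉ S}) with hW
  have hWm : ∀ x, Measurable (W x) := by
    intro x
    have hT : MeasurableSet {q : E × E | q.1 ∈ S ∩ Metric.ball x (r x) ∧ q.1 + q.2 ∈ Sᶜ} := by
      refine MeasurableSet.inter (measurable_fst (hS.inter measurableSet_ball)) ?_
      have : Measurable fun q : E × E => q.1 + q.2 := by fun_prop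
      exact this hS.compl
    exact measurable_measure_prodMk_right hT
  calc η t ≤ ∑' a : u, η (Metric.ball (a : E) ((6 * r a : ℝ≥0) : ℝ)) :=
        (measure_mono hsub).trans (measure_biUnion_le η hcount _)
    _ ≤ ∑' a : u, (6 ^ ((n : ℝ) - 1) * (ω ^ 2)⁻¹ * 2 ^ (n + 2)) * A *
          (ε : ℝ≥0∞) ^ (-((n : ℝ) + 1)) * ∫⁻ h in Metric.ball (0 : E) (2 * ε), W a h := by
        refine ENNReal.tsum_le_tsum fun a => ?_
        obtain ⟨h1, -, h2⟩ := hr a (hut a.2)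
        have h3 : (r a : ℝ≥0∞) ^ ((n : ℝ) - 1) ≤ (ω ^ 2)⁻¹ * (2 ^ (n + 2) *
            (ε : ℝ≥0∞) ^ (-((n : ℝ) + 1)) * ∫⁻ h in Metric.ball (0 : E) (2 * ε), W a h) := by
          refine le_trans ?_ (mul_le_mul_right h2 _)
          rw [← mul_assoc, ENNReal.inv_mul_cancel (pow_ne_zero _ hω0) (ENNReal.pow_ne_top hωt),
            one_mul]
        calc _ ≤ A * ((6 * r a : ℝ≥0) : ℝ≥0∞) ^ ((n : ℝ) - 1) := hη _ _ (by positivity)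
          _ = A * (6 ^ ((n : ℝ) - 1) * (r a : ℝ≥0∞) ^ ((n : ℝ) - 1)) := by
              rw [ENNReal.coe_mul, ENNReal.mul_rpow_of_nonneg _ _ hn1]
              norm_num
          _ ≤ _ := by
              refine (mul_le_mul_right (mul_le_mul_right h3 _) _).trans_eq ?_
              ring
    _ = (6 ^ ((n : ℝ) - 1) * (ω ^ 2)⁻¹ * 2 ^ (n + 2)) * A *
          (ε : ℝ≥0∞) ^ (-((n : ℝ) + 1)) *
            ∫⁻ h in Metric.ball (0 : E) (2 * ε), ∑' a : u, W a h := by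
        rw [ENNReal.tsum_mul_left, lintegral_tsum fun a : u => (hWm a).aemeasurable]
    _ ≤ _ := by
        gcongr with h
        have hDm : MeasurableSet {a | a + h ∉ S} := by
          have : Measurable fun a : E => a + h := by fun_prop
          exact this hS.compl
        calc _ ≤ volume (⋃ a : u, S ∩ Metric.ball (a : E) (r a) ∩ {a | a + h ∉ S}) := by
              refine tsum_meas_le_meas_iUnion_of_disjoint _
                (fun a => (hS.inter measurableSet_ball).inter hDm) ?_
              intro a b hab
              refine (hdisj' a.2 b.2 (Subtype.coe_injective.ne hab)).mono ?_ ?_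
              · exact inter_subset_left.trans inter_subset_right
              · exact inter_subset_left.trans inter_subset_right
          _ ≤ _ := by
              refine measure_mono (iUnion_subset fun a => ?_)
              exact inter_subset_inter_left _ inter_subset_left

theorem lintegral_volume_superlevel_diff_le {F : Type*} [NormedAddCommGroup F] [NormedSpace ℝ F]
    {v : E → F} (hv : ContDiff ℝ 1 v) (h : E) :
    ∫⁻ s in Ioi (0 : ℝ), volume ({x | s < ‖v x‖} ∩ {a | a + h ∉ {x | s < ‖v x‖}}) ≤
      ‖h‖ₑ * ∫⁻ x, ‖fderiv ℝ v x‖ₑ := by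
  have hcont : Continuous fun x => ‖v x‖ := hv.continuous.norm
  set T : Set (ℝ × E) := {q | q.1 < ‖v q.2‖ ∧ ‖v (q.2 + h)‖ ≤ q.1} with hT
  have hTm : MeasurableSet T := by
    refine MeasurableSet.inter (measurableSet_lt measurable_fst ?_)
      (measurableSet_le ?_ measurable_fst)
    · exact (hcont.comp continuous_snd).measurable
    · exact (hcont.comp (continuous_snd.add continuous_const)).measurable
  have hfd : Measurable fun x => ‖fderiv ℝ v x‖ₑ :=
    (hv.continuous_fderiv one_ne_zero).enorm.measurable
  have hseg : ∀ a : E, ENNReal.ofReal (‖v a‖ - ‖v (a + h)‖) ≤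
      ∫⁻ t in Icc (0 : ℝ) 1, ‖h‖ₑ * ‖fderiv ℝ v (a + t • h)‖ₑ := by
    intro a
    have h1 : ContDiff ℝ 1 fun t : ℝ => v (a + t • h) := hv.comp (by fun_prop)
    have h2 := enorm_sub_le_lintegral_deriv_of_contDiffOn_Icc (h1.contDiffOn (s := Icc 0 1))
      zero_le_one
    simp only [one_smul, zero_smul, add_zero] at h2
    calc _ ≤ ENNReal.ofReal ‖v (a + h) - v a‖ := by
          refine ENNReal.ofReal_le_ofReal ?_
          rw [norm_sub_rev]
          exact norm_sub_norm_le _ _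
      _ = ‖v (a + h) - v a‖ₑ := ofReal_norm _
      _ ≤ _ := h2
      _ ≤ _ := by
          refine lintegral_mono fun t => ?_
          have hd : HasDerivAt (fun r : ℝ => v (a + r • h)) (fderiv ℝ v (a + t • h) h) t := by
            have h1 : HasDerivAt (fun r : ℝ => a + r • h) h t := by
              simpa using ((hasDerivAt_id t).smul_const h).const_add a
            exact ((hv.differentiable one_ne_zero) _).hasFDerivAt.comp_hasDerivAt t h1
          simp only [hd.deriv]
          rw [mul_comm]
          exact ContinuousLinearMap.le_opENorm _ _
  calc _ = ∫⁻ s in Ioi (0 : ℝ), volume (Prod.mk s ⁻¹' T) := by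
        congr 1 with s
        congr 1 with a
        simp [hT]
    _ = ∫⁻ a : E, (volume.restrict (Ioi (0 : ℝ))) ((fun s => (s, a)) ⁻¹' T) := by
        rw [← Measure.prod_apply hTm, Measure.prod_apply_symm hTm]
    _ ≤ ∫⁻ a : E, ∫⁻ t in Icc (0 : ℝ) 1, ‖h‖ₑ * ‖fderiv ℝ v (a + t • h)‖ₑ := by
        refine lintegral_mono fun a => le_trans ?_ (hseg a)
        rw [← Real.volume_Ico]
        refine (Measure.restrict_apply_le _ _).trans (measure_mono ?_)
        rintro s ⟨hs1, hs2⟩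
        exact ⟨hs2, hs1⟩
    _ = ∫⁻ t in Icc (0 : ℝ) 1, ∫⁻ a : E, ‖h‖ₑ * ‖fderiv ℝ v (a + t • h)‖ₑ := by
        refine lintegral_lintegral_swap (Measurable.aemeasurable ?_)
        have : Measurable fun q : E × ℝ => q.1 + q.2 • h := by fun_prop
        exact (hfd.comp this).const_mul _
    _ = ∫⁻ t in Icc (0 : ℝ) 1, ‖h‖ₑ * ∫⁻ x, ‖fderiv ℝ v x‖ₑ := by
        congr 1 with t
        rw [lintegral_const_mul' _ _ enorm_ne_top,
          lintegral_add_right_eq_self (fun x => ‖fderiv ℝ v x‖ₑ)]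
    _ = _ := by simp

/-- Trace inequality for measures of codimension at most one. -/
theorem exists_lintegral_enorm_le_lintegral_fderiv (hn : 0 < Module.finrank ℝ E)
    (F : Type*) [NormedAddCommGroup F] [NormedSpace ℝ F] :
    ∃ C : ℝ≥0∞, C ≠ ∞ ∧ ∀ (η : Measure E) (A : ℝ≥0), IsFrostman η A (Module.finrank ℝ E - 1) →
      ∀ v : E → F, ContDiff ℝ 1 v → HasCompactSupport v →
        ∫⁻ x, ‖v x‖ₑ ∂η ≤ C * A * ∫⁻ x, ‖fderiv ℝ v x‖ₑ := by
  obtain ⟨C, hC, hero⟩ := exists_measure_erosion_le (E := E) hn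
  set n := Module.finrank ℝ E with hnE
  set ω := volume (Metric.ball (0 : E) 1)
  have hωt : ω ≠ ∞ := measure_ball_lt_top.ne
  refine ⟨C * (ω * 2 ^ (n + 1)), ENNReal.mul_ne_top hC (ENNReal.mul_ne_top hωt (by simp)), ?_⟩
  intro η A hη v hv hc
  obtain ⟨L, hL⟩ := hv.lipschitzWith_of_hasCompactSupport hc one_ne_zero
  have hcont : Continuous fun x => ‖v x‖ := hv.continuous.norm
  have hKt : η (tsupport v) ≠ ∞ := by
    obtain ⟨R, hR⟩ := (Metric.isBounded_iff_subset_ball (0 : E)).1 hc.isCompact.isBounded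
    refine ne_top_of_le_ne_top ?_ (measure_mono (hR.trans (Metric.ball_subset_ball
      (le_max_left R 1))))
    have h1 : (0 : ℝ) ≤ max R 1 := le_max_of_le_right zero_le_one
    lift max R 1 to ℝ≥0 using h1 with R' hR'
    have h0 : 0 < R' := by
      have : (0 : ℝ) < R' := hR' ▸ lt_max_of_lt_right one_pos
      exact_mod_cast this
    refine ne_top_of_le_ne_top ?_ (hη 0 R' h0)
    exact ENNReal.mul_ne_top ENNReal.coe_ne_top
      (ENNReal.rpow_ne_top_of_ne_zero (by exact_mod_cast h0.ne') ENNReal.coe_ne_top)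
  set Φ := ∫⁻ x, ‖fderiv ℝ v x‖ₑ
  have hmain : ∀ ε : ℝ≥0, 0 < ε →
      ∫⁻ x, ‖v x‖ₑ ∂η ≤ (L * η (tsupport v)) * ε + C * (ω * 2 ^ (n + 1)) * A * Φ := by
    intro ε hε
    have hε0 : (ε : ℝ≥0∞) ≠ 0 := by exact_mod_cast hε.ne'
    set δ : ℝ := L * ε with hδ
    have hδ0 : 0 ≤ δ := by positivity
    have hpt : ∀ x, ‖v x‖ₑ ≤ (tsupport v).indicator (fun _ => ENNReal.ofReal δ) x +
        ENNReal.ofReal (max (‖v x‖ - δ) 0) := by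
      intro x
      by_cases hx : x ∈ tsupport v
      · rw [indicator_of_mem hx, ← ENNReal.ofReal_add hδ0 (le_max_right _ _), ← ofReal_norm]
        refine ENNReal.ofReal_le_ofReal ?_
        linarith [le_max_left (‖v x‖ - δ) 0]
      · rw [image_eq_zero_of_notMem_tsupport hx]
        simp
    have hlayer : ∫⁻ x, ENNReal.ofReal (max (‖v x‖ - δ) 0) ∂η ≤
        ∫⁻ s in Ioi (0 : ℝ), η {x | Metric.ball x ε ⊆ {y | s < ‖v y‖}} := by
      have hm : Measurable fun x => max (‖v x‖ - δ) 0 :=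
        ((hcont.sub continuous_const).max continuous_const).measurable
      rw [lintegral_eq_lintegral_meas_lt η (f := fun x => max (‖v x‖ - δ) 0)
        (Filter.Eventually.of_forall fun x => le_max_right _ _) hm.aemeasurable]
      refine setLIntegral_mono' measurableSet_Ioi fun s hs => measure_mono ?_
      intro x hx y hy
      have hs0 : (0 : ℝ) < s := hs
      rw [mem_ofPred_eq, lt_max_iff] at hx
      have hx' : s < ‖v x‖ - δ := hx.resolve_right (not_lt.2 hs0.le)
      have h1 := hL.dist_le_mul x y
      have h2 : dist x y ≤ ε := by rw [dist_comm]; exact (Metric.mem_ball.1 hy).le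
      have h3 : (L : ℝ) * dist x y ≤ δ := mul_le_mul_of_nonneg_left h2 L.2
      have h4 : ‖v x‖ - ‖v y‖ ≤ dist (v x) (v y) := by
        rw [dist_eq_norm]; exact norm_sub_norm_le _ _
      rw [mem_ofPred_eq]
      linarith
    have hper : ∫⁻ s in Ioi (0 : ℝ), η {x | Metric.ball x ε ⊆ {y | s < ‖v y‖}} ≤
        C * (ω * 2 ^ (n + 1)) * A * Φ := by
      have hTm : MeasurableSet {q : (ℝ × E) × E | q.1.1 < ‖v q.2‖ ∧ ‖v (q.2 + q.1.2)‖ ≤ q.1.1} := by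
        refine MeasurableSet.inter (measurableSet_lt measurable_fst.fst ?_)
          (measurableSet_le ?_ measurable_fst.fst)
        · exact (hcont.comp continuous_snd).measurable
        · exact (hcont.comp (by fun_prop)).measurable
      have hWm : Measurable (Function.uncurry fun (s : ℝ) (h : E) =>
          volume ({x | s < ‖v x‖} ∩ {a | a + h ∉ {x | s < ‖v x‖}})) := by
        convert measurable_measure_prodMk_left (ν := (volume : Measure E)) hTm using 2 with q
        simp only [Function.uncurry]
        congr 1
        ext a
        simp
      calc _ ≤ ∫⁻ s in Ioi (0 : ℝ), C * A * (ε : ℝ≥0∞) ^ (-((n : ℝ) + 1)) *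
            ∫⁻ h in Metric.ball (0 : E) (2 * ε),
              volume ({x | s < ‖v x‖} ∩ {a | a + h ∉ {x | s < ‖v x‖}}) := by
            refine setLIntegral_mono' measurableSet_Ioi fun s hs => ?_
            refine hero η A hη _ (measurableSet_lt measurable_const hcont.measurable) ?_ ε hε
            refine ne_top_of_le_ne_top hc.isCompact.measure_lt_top.ne
              (measure_mono (t := tsupport v) ?_)
            intro x hx
            by_contra hxs
            rw [mem_ofPred_eq, image_eq_zero_of_notMem_tsupport hxs, norm_zero] at hx
            exact absurd hx (not_lt.2 (le_of_lt hs))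
        _ = C * A * (ε : ℝ≥0∞) ^ (-((n : ℝ) + 1)) * ∫⁻ h in Metric.ball (0 : E) (2 * ε),
              ∫⁻ s in Ioi (0 : ℝ),
                volume ({x | s < ‖v x‖} ∩ {a | a + h ∉ {x | s < ‖v x‖}}) := by
            rw [lintegral_const_mul _ hWm.lintegral_prod_right,
              lintegral_lintegral_swap hWm.aemeasurable]
        _ ≤ C * A * (ε : ℝ≥0∞) ^ (-((n : ℝ) + 1)) * ∫⁻ h in Metric.ball (0 : E) (2 * ε),
              (2 * ε) * Φ := by
            refine mul_le_mul_right (setLIntegral_mono' measurableSet_ball fun h hh => ?_) _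
            refine (lintegral_volume_superlevel_diff_le hv h).trans ?_
            gcongr
            rw [← ofReal_norm]
            refine ENNReal.ofReal_le_of_le_toReal ?_
            simpa using (mem_ball_zero_iff.1 hh).le
        _ = C * A * (ε : ℝ≥0∞) ^ (-((n : ℝ) + 1)) * ((2 * ε) * Φ *
              (ω * ((2 * ε : ℝ≥0) : ℝ≥0∞) ^ n)) := by
            rw [setLIntegral_const]
            congr 2
            rw [← volume_ball_eq (0 : E) (by positivity)]
            simp
        _ = C * (ω * 2 ^ (n + 1)) * A * Φ *
              ((ε : ℝ≥0∞) ^ (-((n : ℝ) + 1)) * (ε : ℝ≥0∞) ^ (n + 1)) := by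
            push_cast
            ring
        _ = _ := by
            have e : (n : ℝ) + 1 = (n + 1 : ℕ) := by push_cast; ring
            rw [e, ENNReal.rpow_neg, ENNReal.rpow_natCast,
              ENNReal.inv_mul_cancel (pow_ne_zero _ hε0) (ENNReal.pow_ne_top ENNReal.coe_ne_top),
              mul_one]
    calc _ ≤ ∫⁻ x, ((tsupport v).indicator (fun _ => ENNReal.ofReal δ) x +
            ENNReal.ofReal (max (‖v x‖ - δ) 0)) ∂η := lintegral_mono hpt
      _ = ENNReal.ofReal δ * η (tsupport v) + ∫⁻ x, ENNReal.ofReal (max (‖v x‖ - δ) 0) ∂η := by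
          rw [lintegral_add_left (measurable_const.indicator (isClosed_tsupport v).measurableSet),
            lintegral_indicator_const (isClosed_tsupport v).measurableSet]
      _ ≤ _ := by
          refine add_le_add ?_ (hlayer.trans hper)
          · rw [hδ, ENNReal.ofReal_mul L.coe_nonneg, ENNReal.ofReal_coe_nnreal, ENNReal.ofReal_coe_nnreal]
            exact le_of_eq (by ring)
  set B := (L : ℝ≥0∞) * η (tsupport v)
  have hB : B ≠ ∞ := ENNReal.mul_ne_top ENNReal.coe_ne_top hKt
  refine ENNReal.le_of_forall_pos_le_add fun δ hδ _ => ?_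
  obtain ⟨ε, hε, hεδ⟩ := ENNReal.exists_nnreal_pos_mul_lt hB (b := δ) (by exact_mod_cast hδ.ne')
  refine (hmain ε hε).trans ?_
  rw [add_comm]
  gcongr
  rw [mul_comm]
  exact hεδ.le

end Trace

section PotentialIntegral

variable {E : Type*} [NormedAddCommGroup E] [InnerProductSpace ℝ E] [FiniteDimensional ℝ E]
  [MeasurableSpace E] [BorelSpace E]

theorem exists_setLIntegral_ball_edist_rpow_neg_le {β : ℝ} (hβ : 0 ≤ β)
    (hβn : β < Module.finrank ℝ E) :
    ∃ C : ℝ≥0∞, C ≠ ∞ ∧ ∀ (x y : E) (r : ℝ≥0), 0 < r →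
      ∫⁻ z in Metric.ball x r, edist y z ^ (-β) ≤ C * (r : ℝ≥0∞) ^ (Module.finrank ℝ E : ℝ) *
        ∑' k : ℕ, (Metric.ball x ((2 ^ (k + 1) * r : ℝ≥0) : ℝ)).indicator
          (fun _ => ((2 ^ k * r : ℝ≥0) : ℝ≥0∞) ^ (-β)) y := by
  obtain ⟨C, hC, h⟩ := lintegral_rpow_neg_le (X := E) hβ hβn
  set n := Module.finrank ℝ E with hnE
  set ω := volume (Metric.ball (0 : E) 1)
  have hω0 : ω ≠ 0 := (Metric.measure_ball_pos _ _ one_pos).ne'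
  have hωt : ω ≠ ∞ := measure_ball_lt_top.ne
  have hn : (0 : ℝ) < n := hβ.trans_lt hβn
  have h2 : (2 : ℝ≥0∞) ^ β ≠ ∞ := ENNReal.rpow_ne_top_of_nonneg hβ (by simp)
  refine ⟨C * ω + ω * 2 ^ β, ENNReal.add_ne_top.2 ⟨ENNReal.mul_ne_top hC hωt,
    ENNReal.mul_ne_top hωt h2⟩, ?_⟩
  intro x y r hr
  have hr0 : (r : ℝ≥0∞) ≠ 0 := by exact_mod_cast hr.ne'
  by_cases hy : dist y x < 2 * r
  · refine le_trans ?_ (mul_le_mul_right (ENNReal.le_tsum 0) _)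
    rw [indicator_of_mem (by simpa using hy)]
    have h1 := h (volume.restrict (Metric.ball x r)) (fun z => edist y z) (by fun_prop) ω hω0 hωt
      (fun ρ hρ => by
        refine (Measure.restrict_apply_le _ _).trans ?_
        rw [ofPred_edist_lt, volume_ball_eq y hρ, ENNReal.rpow_natCast])
    refine h1.trans ?_
    rw [Measure.restrict_apply_univ, volume_ball_eq x hr]
    calc C * (ω ^ (β / n) * (ω * (r : ℝ≥0∞) ^ n) ^ (1 - β / n))
        = C * ω * ((r : ℝ≥0∞) ^ (n : ℝ) * (r : ℝ≥0∞) ^ (-β)) := by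
          rw [ENNReal.mul_rpow_of_ne_top hωt (ENNReal.pow_ne_top ENNReal.coe_ne_top), ← mul_assoc,
            ← mul_assoc, mul_assoc C, ← ENNReal.rpow_add _ _ hω0 hωt, ← ENNReal.rpow_natCast,
            ← ENNReal.rpow_mul, ← ENNReal.rpow_add _ _ hr0 ENNReal.coe_ne_top]
          congr 2
          · rw [add_sub_cancel, ENNReal.rpow_one]
          · rw [mul_sub, mul_one, mul_div_cancel₀ _ hn.ne']; ring
      _ ≤ _ := by
          rw [← mul_assoc, pow_zero, one_mul]
          gcongr
          exact le_self_add
  · push Not at hy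
    have hr' : (0 : ℝ) < r := by exact_mod_cast hr
    obtain ⟨k, hk1, hk2⟩ := exists_nat_pow_near (x := dist y x / r) (y := 2)
      (by rw [le_div_iff₀ hr']; linarith) one_lt_two
    rw [le_div_iff₀ hr'] at hk1
    rw [div_lt_iff₀ hr'] at hk2
    refine le_trans ?_ (mul_le_mul_right (ENNReal.le_tsum k) _)
    rw [indicator_of_mem (by simpa using hk2)]
    calc _ ≤ ∫⁻ z in Metric.ball x r, 2 ^ β * ((2 ^ k * r : ℝ≥0) : ℝ≥0∞) ^ (-β) := by
          refine setLIntegral_mono' measurableSet_ball fun z hz => ?_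
          have hz' : dist z x < r := Metric.mem_ball.1 hz
          have h3 : 2 ^ k * (r : ℝ) ≤ 2 * dist y z := by
            have := dist_triangle y z x
            linarith
          have h4 : ((2 ^ k * r : ℝ≥0) : ℝ≥0∞) / 2 ≤ edist y z := by
            rw [ENNReal.div_le_iff (by simp) (by simp), mul_comm _ (2 : ℝ≥0∞), edist_nndist]
            have h5 : 2 ^ k * r ≤ 2 * nndist y z := h3
            exact_mod_cast h5
          refine (ENNReal.rpow_neg_le_rpow_neg hβ h4).trans_eq ?_
          rw [ENNReal.div_eq_inv_mul, ENNReal.mul_rpow_of_ne_top (by simp) ENNReal.coe_ne_top,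
            ENNReal.inv_rpow, ENNReal.rpow_neg, inv_inv]
      _ = ω * 2 ^ β * (r : ℝ≥0∞) ^ (n : ℝ) * ((2 ^ k * r : ℝ≥0) : ℝ≥0∞) ^ (-β) := by
          rw [setLIntegral_const, volume_ball_eq x hr, ENNReal.rpow_natCast]
          ring
      _ ≤ _ := by
          gcongr
          exact le_add_self

/-- The Riesz potential of a Frostman measure is a Frostman measure. -/
theorem exists_isFrostman_withDensity_potential {D : ℝ} (hD : 0 ≤ D)
    (hDn : D + 1 < Module.finrank ℝ E) :
    ∃ C : ℝ≥0, ∀ (ν : Measure E) [IsFiniteMeasure ν] (A : ℝ≥0), IsFrostman ν A D →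
      IsFrostman (volume.withDensity fun y => ∫⁻ x, edist x y ^ (-(D + 1)) ∂ν) (C * A)
        (Module.finrank ℝ E - 1) := by
  obtain ⟨C, hC, h⟩ := exists_setLIntegral_ball_edist_rpow_neg_le (E := E) (β := D + 1)
    (by positivity) hDn
  lift C to ℝ≥0 using hC
  set n := Module.finrank ℝ E with hnE
  refine ⟨C * 2 ^ D * 2, fun ν _ A hν x r hr => ?_⟩
  have hr0 : (r : ℝ≥0∞) ≠ 0 := by exact_mod_cast hr.ne'
  have hsum : ∀ k : ℕ, ((2 ^ k * r : ℝ≥0) : ℝ≥0∞) ^ (-(D + 1)) *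
      (A * ((2 ^ (k + 1) * r : ℝ≥0) : ℝ≥0∞) ^ D) =
        A * 2 ^ D * (r : ℝ≥0∞) ^ (-1 : ℝ) * (2⁻¹) ^ k := by
    intro k
    have hk0 : ((2 ^ k * r : ℝ≥0) : ℝ≥0∞) ≠ 0 := by
      have : 0 < 2 ^ k * r := by positivity
      exact_mod_cast this.ne'
    have e1 : ((2 ^ (k + 1) * r : ℝ≥0) : ℝ≥0∞) = 2 * ((2 ^ k * r : ℝ≥0) : ℝ≥0∞) := by
      push_cast; ring
    rw [e1, ENNReal.mul_rpow_of_nonneg _ _ hD]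
    have e2 : ((2 ^ k * r : ℝ≥0) : ℝ≥0∞) ^ (-(D + 1)) * ((2 ^ k * r : ℝ≥0) : ℝ≥0∞) ^ D =
        (r : ℝ≥0∞) ^ (-1 : ℝ) * (2⁻¹) ^ k := by
      rw [← ENNReal.rpow_add _ _ hk0 ENNReal.coe_ne_top]
      have : -(D + 1) + D = -1 := by ring
      rw [this, ENNReal.rpow_neg_one, ENNReal.rpow_neg_one, ENNReal.coe_mul,
        ENNReal.mul_inv (Or.inr ENNReal.coe_ne_top) (Or.inr hr0), mul_comm]
      push_cast
      rw [ENNReal.inv_pow]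
    calc _ = A * 2 ^ D * (((2 ^ k * r : ℝ≥0) : ℝ≥0∞) ^ (-(D + 1)) *
          ((2 ^ k * r : ℝ≥0) : ℝ≥0∞) ^ D) := by ring
      _ = _ := by rw [e2]; ring
  rw [withDensity_apply _ measurableSet_ball]
  calc ∫⁻ y in Metric.ball x r, (∫⁻ z, edist z y ^ (-(D + 1)) ∂ν)
      = ∫⁻ z, (∫⁻ y in Metric.ball x r, edist z y ^ (-(D + 1))) ∂ν :=
        lintegral_lintegral_swap (Measurable.aemeasurable (by fun_prop))
    _ ≤ ∫⁻ z, C * (r : ℝ≥0∞) ^ (n : ℝ) *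
        ∑' k : ℕ, (Metric.ball x ((2 ^ (k + 1) * r : ℝ≥0) : ℝ)).indicator
          (fun _ => ((2 ^ k * r : ℝ≥0) : ℝ≥0∞) ^ (-(D + 1))) z ∂ν :=
        lintegral_mono fun z => h x z r hr
    _ = C * (r : ℝ≥0∞) ^ (n : ℝ) * ∑' k : ℕ, ((2 ^ k * r : ℝ≥0) : ℝ≥0∞) ^ (-(D + 1)) *
          ν (Metric.ball x ((2 ^ (k + 1) * r : ℝ≥0) : ℝ)) := by
        have hm : ∀ k : ℕ, Measurable ((Metric.ball x ((2 ^ (k + 1) * r : ℝ≥0) : ℝ)).indicator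
          (fun _ : E => ((2 ^ k * r : ℝ≥0) : ℝ≥0∞) ^ (-(D + 1)))) := fun k =>
          measurable_const.indicator measurableSet_ball
        rw [lintegral_const_mul _ (Measurable.tsum hm), lintegral_tsum fun k => (hm k).aemeasurable]
        congr 2 with k
        rw [lintegral_indicator_const measurableSet_ball]
    _ ≤ C * (r : ℝ≥0∞) ^ (n : ℝ) * ∑' k : ℕ, A * 2 ^ D * (r : ℝ≥0∞) ^ (-1 : ℝ) * (2⁻¹) ^ k := by
        refine mul_le_mul_right (ENNReal.tsum_le_tsum fun k => ?_) _
        rw [← hsum]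
        gcongr
        exact hν _ _ (by positivity)
    _ = C * 2 ^ D * 2 * A * ((r : ℝ≥0∞) ^ (n : ℝ) * (r : ℝ≥0∞) ^ (-1 : ℝ)) := by
        rw [ENNReal.tsum_mul_left, ENNReal.tsum_geometric, ENNReal.one_sub_inv_two, inv_inv]
        ring
    _ = _ := by
        rw [← ENNReal.rpow_add _ _ hr0 ENNReal.coe_ne_top, ← sub_eq_add_neg]
        rw [ENNReal.coe_mul, ENNReal.coe_mul, ENNReal.coe_mul, ENNReal.coe_rpow_of_nonneg _ hD]
        rfl

end PotentialIntegral

section WeakType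

variable {E : Type*} [NormedAddCommGroup E] [InnerProductSpace ℝ E] [FiniteDimensional ℝ E]
  [MeasurableSpace E] [BorelSpace E]

section Distribution

variable {X : Type*} [TopologicalSpace X] [MeasurableSpace X] [BorelSpace X]

theorem measurable_measure_ge {X : Type*} [MeasurableSpace X] (μ : Measure X) [SFinite μ]
    {f : X → ℝ} (hf : Measurable f) : Measurable fun x => μ {y | f x ≤ f y} :=
  measurable_measure_prodMk_left
    (measurableSet_le (hf.comp measurable_fst) (hf.comp measurable_snd))

theorem measure_measure_ge_lt_le (μ : Measure X) [IsFiniteMeasure μ] [μ.InnerRegularCompactLTTop]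
    {f : X → ℝ} (hf : Continuous f) (r : ℝ≥0∞) : μ {x | μ {y | f x ≤ f y} < r} ≤ r := by
  have hm : MeasurableSet {x | μ {y | f x ≤ f y} < r} :=
    measurableSet_lt (measurable_measure_ge μ hf.measurable) measurable_const
  rw [hm.measure_eq_iSup_isCompact_of_ne_top (measure_ne_top μ _)]
  refine iSup₂_le fun K hK => iSup_le fun hKc => ?_
  rcases K.eq_empty_or_nonempty with rfl | hne
  · simp
  · obtain ⟨x, hx, hmin⟩ := hKc.exists_isMinOn hne hf.continuousOn
    exact (measure_mono fun y hy => hmin hy).trans (le_of_lt (hK hx))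

/-- The weight `x ↦ μ {f x ≤ f} ^ (-γ)` turns `μ` into a measure comparable to `μ ^ (1 - γ)` on
superlevel sets of `f` and dominated by it elsewhere. -/
theorem exists_withDensity_le_rpow {γ : ℝ} (hγ : 0 ≤ γ) (hγ1 : γ < 1) :
    ∃ C : ℝ≥0∞, C ≠ ∞ ∧ ∀ (μ : Measure X) [IsFiniteMeasure μ] [μ.InnerRegularCompactLTTop]
      (f : X → ℝ), Continuous f →
        (∀ F, MeasurableSet F →
          μ.withDensity (fun x => μ {y | f x ≤ f y} ^ (-γ)) F ≤ C * μ F ^ (1 - γ)) ∧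
        ∀ s, μ {x | s < f x} ^ (1 - γ) ≤
          μ.withDensity (fun x => μ {y | f x ≤ f y} ^ (-γ)) {x | s < f x} := by
  obtain ⟨C, hC, h⟩ := lintegral_rpow_neg_le (X := X) hγ hγ1
  refine ⟨C, hC, fun μ _ _ f hf => ⟨fun F hF => ?_, fun s => ?_⟩⟩
  · rw [withDensity_apply _ hF]
    have := h (μ.restrict F) _ (measurable_measure_ge μ hf.measurable) 1 one_ne_zero
      ENNReal.one_ne_top (fun r hr => by
        rw [one_mul, ENNReal.rpow_one]
        exact (Measure.restrict_apply_le _ _).trans (measure_measure_ge_lt_le μ hf r))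
    simpa using this
  · have hm : MeasurableSet {x | s < f x} := measurableSet_lt measurable_const hf.measurable
    rw [withDensity_apply _ hm]
    rcases eq_or_ne (μ {x | s < f x}) 0 with h0 | h0
    · rw [h0, ENNReal.zero_rpow_of_pos (by linarith)]
      exact zero_le
    · calc _ = ∫⁻ x in {x | s < f x}, μ {x | s < f x} ^ (-γ) ∂μ := by
            rw [setLIntegral_const, sub_eq_neg_add, ENNReal.rpow_add _ _ h0 (measure_ne_top μ _),
              ENNReal.rpow_one]
        _ ≤ _ := by
            refine setLIntegral_mono' hm fun x hx => ENNReal.rpow_neg_le_rpow_neg hγ ?_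
            exact measure_mono fun y hy => by
              rw [mem_ofPred_eq] at *
              exact lt_of_lt_of_le hx hy

end Distribution

/-- Estimate for the distribution function in the limiting case `p = 1`. -/
theorem IsFrostman.exists_lintegral_measure_rpow_le {μ : Measure E} [IsFiniteMeasure μ] {A : ℝ≥0}
    {d : ℝ} (hμ : IsFrostman μ A d) {m : ℕ} (hm : 1 ≤ m) (hmn : m < Module.finrank ℝ E)
    (hd : (Module.finrank ℝ E : ℝ) - m ≤ d) :
    ∃ C : ℝ≥0∞, C ≠ ∞ ∧ ∀ u : E → ℝ, ContDiff ℝ (⊤ : ℕ∞) u → HasCompactSupport u →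
      ∫⁻ s in Ioi (0 : ℝ), μ {x | s < |u x|} ^ (((Module.finrank ℝ E : ℝ) - m) / d) ≤
        C * ∫⁻ x, ‖iteratedFDeriv ℝ m u x‖ₑ := by
  have hmn' : (m : ℝ) < Module.finrank ℝ E := by exact_mod_cast hmn
  have hn : 0 < Module.finrank ℝ E := by omega
  have hd0 : 0 < d := by linarith
  set q : ℝ := ((Module.finrank ℝ E : ℝ) - m) / d with hq
  have hq0 : 0 < q := div_pos (by linarith) hd0
  have hq1 : q ≤ 1 := by rw [hq, div_le_one hd0]; exact hd
  have hqd : d * q = (Module.finrank ℝ E : ℝ) - m := by rw [hq]; field_simp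
  obtain ⟨C₀, hC₀, hw⟩ := exists_withDensity_le_rpow (X := E) (γ := 1 - q) (by linarith)
    (by linarith)
  lift C₀ to ℝ≥0 using hC₀
  simp only [sub_sub_cancel] at hw
  set A' : ℝ≥0 := C₀ * A ^ q
  obtain ⟨k, rfl⟩ : ∃ k, m = k + 1 := ⟨m - 1, by omega⟩
  obtain ⟨C₁, hC₁, htr⟩ := exists_lintegral_enorm_le_lintegral_fderiv (E := E) hn (E [×k]→L[ℝ] ℝ)
  have hcd : ∀ {u : E → ℝ}, ContDiff ℝ (⊤ : ℕ∞) u → ContDiff ℝ 1 (iteratedFDeriv ℝ k u) :=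
    fun hu => hu.iteratedFDeriv_right (by exact_mod_cast le_top)
  have hred : ∃ C : ℝ≥0∞, C ≠ ∞ ∧ ∀ (ν : Measure E) [IsFiniteMeasure ν],
      IsFrostman ν A' ((Module.finrank ℝ E : ℝ) - (k + 1 : ℕ)) →
        ∀ u : E → ℝ, ContDiff ℝ (⊤ : ℕ∞) u → HasCompactSupport u →
          ∫⁻ x, ‖u x‖ₑ ∂ν ≤ C * ∫⁻ x, ‖iteratedFDeriv ℝ (k + 1) u x‖ₑ := by
    rcases Nat.eq_zero_or_pos k with rfl | hk
    · refine ⟨C₁ * A', ENNReal.mul_ne_top hC₁ ENNReal.coe_ne_top, fun ν _ hν u hu hc => ?_⟩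
      have := htr ν A' (by simpa using hν) _ (hcd hu) (hc.iteratedFDeriv 0)
      simp_rw [enorm_fderiv_iteratedFDeriv] at this
      refine le_trans (le_of_eq ?_) this
      congr 1 with x
      rw [← ofReal_norm, ← ofReal_norm, norm_iteratedFDeriv_zero]
    · obtain ⟨C₂, hC₂, hpot⟩ := exists_enorm_le_riesz_potential (E := E) (m := k) hk (by omega)
      obtain ⟨C₃, hη⟩ := exists_isFrostman_withDensity_potential (E := E)
        (D := (Module.finrank ℝ E : ℝ) - (k + 1 : ℕ)) (by linarith) (by
          have : (1 : ℝ) ≤ k := by exact_mod_cast hk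
          push_cast
          linarith)
      refine ⟨C₂ * (C₁ * (C₃ * A' : ℝ≥0)), ENNReal.mul_ne_top hC₂
        (ENNReal.mul_ne_top hC₁ ENNReal.coe_ne_top), fun ν _ hν u hu hc => ?_⟩
      have h1 := htr _ _ (hη ν A' hν) _ (hcd hu) (hc.iteratedFDeriv k)
      simp_rw [enorm_fderiv_iteratedFDeriv] at h1
      have hexp : -((Module.finrank ℝ E : ℝ) - (k + 1 : ℕ) + 1) =
        -((Module.finrank ℝ E : ℝ) - k) := by push_cast; ring
      rw [hexp] at h1
      have hcm : Measurable fun y => ‖iteratedFDeriv ℝ k u y‖ₑ := (hcd hu).continuous.enorm.measurable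
      calc _ ≤ ∫⁻ x, C₂ * (∫⁻ y, ‖iteratedFDeriv ℝ k u y‖ₑ *
              edist x y ^ (-((Module.finrank ℝ E : ℝ) - k))) ∂ν :=
            lintegral_mono fun x => hpot u hu hc x
        _ = C₂ * ∫⁻ x, (∫⁻ y, ‖iteratedFDeriv ℝ k u y‖ₑ *
              edist x y ^ (-((Module.finrank ℝ E : ℝ) - k))) ∂ν :=
            lintegral_const_mul' _ _ hC₂
        _ = C₂ * ∫⁻ y, (∫⁻ x, ‖iteratedFDeriv ℝ k u y‖ₑ *
              edist x y ^ (-((Module.finrank ℝ E : ℝ) - k)) ∂ν) := by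
            rw [lintegral_lintegral_swap (Measurable.aemeasurable
              ((hcm.comp measurable_snd).mul (by fun_prop)))]
        _ = C₂ * ∫⁻ y, ‖iteratedFDeriv ℝ k u y‖ₑ ∂(volume.withDensity fun y =>
              ∫⁻ x, edist x y ^ (-((Module.finrank ℝ E : ℝ) - k)) ∂ν) := by
            congr 1
            rw [lintegral_withDensity_eq_lintegral_mul _
              (Measurable.lintegral_prod_left (by fun_prop)) hcm]
            congr 1 with y
            rw [lintegral_const_mul' _ _ enorm_ne_top, Pi.mul_apply, mul_comm]
        _ ≤ _ := by rw [mul_assoc]; gcongr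
  obtain ⟨C, hC, hred⟩ := hred
  refine ⟨C, hC, fun u hu hc => ?_⟩
  obtain ⟨hup, hlow⟩ := hw μ (fun x => |u x|) hu.continuous.abs
  set ν := μ.withDensity fun x => μ {y | |u x| ≤ |u y|} ^ (-(1 - q))
  have : IsFiniteMeasure ν := ⟨(hup univ MeasurableSet.univ).trans_lt
    (ENNReal.mul_lt_top ENNReal.coe_lt_top
      (ENNReal.rpow_lt_top_of_nonneg hq0.le (measure_ne_top μ _)))⟩
  have hν : IsFrostman ν A' ((Module.finrank ℝ E : ℝ) - (k + 1 : ℕ)) := fun x r hr => by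
    refine (hup _ measurableSet_ball).trans ?_
    calc _ ≤ C₀ * (A * (r : ℝ≥0∞) ^ d) ^ q := by gcongr; exact hμ x r hr
      _ = _ := by
        rw [ENNReal.mul_rpow_of_nonneg _ _ hq0.le, ← ENNReal.rpow_mul, hqd, ENNReal.coe_mul,
          ENNReal.coe_rpow_of_nonneg _ hq0.le, mul_assoc]
  calc _ ≤ ∫⁻ s in Ioi (0 : ℝ), ν {x | s < |u x|} := lintegral_mono fun s => hlow s
    _ = ∫⁻ x, ENNReal.ofReal |u x| ∂ν :=
        (lintegral_eq_lintegral_meas_lt ν (Filter.Eventually.of_forall fun x => abs_nonneg _)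
          hu.continuous.abs.measurable.aemeasurable).symm
    _ = ∫⁻ x, ‖u x‖ₑ ∂ν := by
        congr 1 with x
        rw [← ofReal_norm, Real.norm_eq_abs]
    _ ≤ _ := hred ν hν u hu hc

end WeakType

section Rearrangement

variable {X : Type*} [MeasurableSpace X]

theorem lt_measure_of_lt_rearr {μ : Measure X} {u : X → ℝ} {s t : ℝ}
    (h : ENNReal.ofReal s < rearr μ u t) : ENNReal.ofReal t < μ {x | s < |u x|} := by
  by_contra hcon
  rw [not_lt] at hcon
  refine absurd h (not_lt.2 (sInf_le (le_trans (measure_mono fun x hx => ?_) hcon)))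
  exact (ENNReal.ofReal_lt_ofReal_iff'.1 hx).1

theorem le_volume_ofReal_lt (a : ℝ≥0∞) :
    a ≤ (volume.restrict (Ioi (0 : ℝ))) {s | ENNReal.ofReal s < a} := by
  rw [Measure.restrict_apply (measurableSet_lt (by fun_prop) measurable_const)]
  rcases eq_or_ne a ∞ with rfl | ha
  · simp
  · calc a = volume (Ioo 0 a.toReal) := by simp [ha]
      _ ≤ _ := by
        refine measure_mono fun s hs => ⟨?_, hs.1⟩
        rw [mem_ofPred_eq, ENNReal.ofReal_lt_iff_lt_toReal hs.1.le ha]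
        exact hs.2

theorem lintegral_Ioo_ofReal_rpow_sub_one {q b : ℝ} (hq : 0 < q) (hb : 0 ≤ b) :
    ∫⁻ t in Ioo (0 : ℝ) b, ENNReal.ofReal (t ^ (q - 1)) = ENNReal.ofReal q⁻¹ * ENNReal.ofReal b ^ q := by
  have hint : IntervalIntegrable (fun t : ℝ => t ^ (q - 1)) volume 0 b :=
    intervalIntegral.intervalIntegrable_rpow' (by linarith)
  rw [← ofReal_integral_eq_lintegral_ofReal
    (((intervalIntegrable_iff_integrableOn_Ioc_of_le hb).1 hint).mono_set Ioo_subset_Ioc_self)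
    ((ae_restrict_mem measurableSet_Ioo).mono fun t ht => Real.rpow_nonneg ht.1.le _),
    ← integral_Ioc_eq_integral_Ioo, ← intervalIntegral.integral_of_le hb,
    integral_rpow (Or.inl (by linarith)), sub_add_cancel, Real.zero_rpow hq.ne', sub_zero,
    ENNReal.ofReal_rpow_of_nonneg hb hq.le, ← ENNReal.ofReal_mul (by positivity), div_eq_inv_mul]

theorem lintegral_rpow_mul_rearr_le {q : ℝ} (hq : 0 < q) (μ : Measure X) [IsFiniteMeasure μ]
    (u : X → ℝ) (M : ℝ) :
    ∫⁻ t in Ioo (0 : ℝ) M, ENNReal.ofReal (t ^ (q - 1)) * rearr μ u t ≤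
      ENNReal.ofReal q⁻¹ * ∫⁻ s in Ioi (0 : ℝ), μ {x | s < |u x|} ^ q := by
  have hanti : Antitone fun s : ℝ => μ {x | s < |u x|} := fun s s' hs =>
    measure_mono fun x hx => lt_of_le_of_lt hs hx
  have hT : MeasurableSet {z : ℝ × ℝ | ENNReal.ofReal z.1 < μ {x | z.2 < |u x|}} :=
    measurableSet_lt (by fun_prop) (hanti.measurable.comp measurable_snd)
  calc _ ≤ ∫⁻ t in Ioo (0 : ℝ) M, ENNReal.ofReal (t ^ (q - 1)) *
        ∫⁻ s in Ioi (0 : ℝ), {z : ℝ × ℝ | ENNReal.ofReal z.1 < μ {x | z.2 < |u x|}}.indicator 1 (t, s) := by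
        refine lintegral_mono fun t => mul_le_mul_right ?_ _
        refine (le_volume_ofReal_lt _).trans ?_
        rw [← lintegral_indicator_one (measurableSet_lt (by fun_prop) measurable_const)]
        refine lintegral_mono fun s => ?_
        by_cases h : ENNReal.ofReal s < rearr μ u t
        · rw [indicator_of_mem (by exact h), indicator_of_mem (by exact lt_measure_of_lt_rearr h)]
          exact le_rfl
        · rw [indicator_of_notMem (by exact h)]
          exact zero_le
    _ ≤ ∫⁻ t in Ioi (0 : ℝ), ∫⁻ s in Ioi (0 : ℝ), ENNReal.ofReal (t ^ (q - 1)) *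
          {z : ℝ × ℝ | ENNReal.ofReal z.1 < μ {x | z.2 < |u x|}}.indicator 1 (t, s) := by
        refine (lintegral_mono_set Ioo_subset_Ioi_self).trans (le_of_eq ?_)
        congr 1 with t
        rw [lintegral_const_mul' _ _ ENNReal.ofReal_ne_top]
    _ = ∫⁻ s in Ioi (0 : ℝ), ∫⁻ t in Ioi (0 : ℝ), ENNReal.ofReal (t ^ (q - 1)) *
          {z : ℝ × ℝ | ENNReal.ofReal z.1 < μ {x | z.2 < |u x|}}.indicator 1 (t, s) := by
        refine lintegral_lintegral_swap (Measurable.aemeasurable ?_)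
        exact Measurable.mul (by fun_prop) (measurable_one.indicator hT)
    _ ≤ ∫⁻ s in Ioi (0 : ℝ), ENNReal.ofReal q⁻¹ * μ {x | s < |u x|} ^ q := by
        refine lintegral_mono fun s => ?_
        have hfin := measure_ne_top μ {x | s < |u x|}
        rw [← ENNReal.ofReal_toReal hfin,
          ← lintegral_Ioo_ofReal_rpow_sub_one hq ENNReal.toReal_nonneg,
          ← lintegral_indicator measurableSet_Ioi, ← lintegral_indicator measurableSet_Ioo]
        refine lintegral_mono fun t => ?_
        by_cases ht : t ∈ Ioi (0 : ℝ)
        · by_cases hts : ENNReal.ofReal t < μ {x | s < |u x|}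
          · have : t ∈ Ioo 0 (μ {x | s < |u x|}).toReal :=
              ⟨ht, (ENNReal.ofReal_lt_iff_lt_toReal (le_of_lt ht) hfin).1 hts⟩
            rw [indicator_of_mem ht, indicator_of_mem this]
            exact mul_le_of_le_one_right' (indicator_le_self _ _ _)
          · rw [indicator_of_mem ht, indicator_of_notMem (by exact hts), mul_zero]
            exact zero_le
        · rw [indicator_of_notMem ht]
          exact zero_le
    _ = _ := lintegral_const_mul' _ _ ENNReal.ofReal_ne_top

end Rearrangement

theorem lintegral_Ioi_ofReal_rpow_neg {q c : ℝ} (hq : 0 < q) (hc : 0 < c) :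
    ∫⁻ t in Ioi c, ENNReal.ofReal t ^ (-q - 1) =
      ENNReal.ofReal q⁻¹ * ENNReal.ofReal c ^ (-q) := by
  have hlt : -q - 1 < -1 := by linarith
  calc ∫⁻ t in Ioi c, ENNReal.ofReal t ^ (-q - 1)
      = ∫⁻ t in Ioi c, ENNReal.ofReal (t ^ (-q - 1)) :=
        setLIntegral_congr_fun measurableSet_Ioi fun t (ht : c < t) =>
          ENNReal.ofReal_rpow_of_pos (hc.trans ht)
    _ = ENNReal.ofReal (∫ t in Ioi c, t ^ (-q - 1)) := by
        rw [ofReal_integral_eq_lintegral_ofReal (integrableOn_Ioi_rpow_of_lt hlt hc)]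
        filter_upwards [ae_restrict_mem measurableSet_Ioi] with t (ht : c < t)
        exact Real.rpow_nonneg (hc.trans ht).le _
    _ = _ := by
        rw [integral_Ioi_rpow_of_lt hlt hc, ENNReal.ofReal_rpow_of_pos hc, sub_add_cancel,
          neg_div_neg_eq, div_eq_inv_mul, ENNReal.ofReal_mul (by positivity)]

/-- Kernel comparing the level `T` with the dyadic level `2 ^ j`. -/
noncomputable def dyadicKernel (α β : ℝ) (T : ℝ≥0∞) (j : ℤ) : ℝ≥0∞ :=
  min (T ^ α * 2 ^ (-(β * j))) (T ^ (-α) * 2 ^ (β * j))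

theorem ENNReal.tsum_mul_rpow_le {ι : Type*} {p : ℝ} (hp : 1 ≤ p) (w f : ι → ℝ≥0∞) :
    (∑' i, w i * f i) ^ p ≤ (∑' i, w i) ^ (p - 1) * ∑' i, w i * f i ^ p := by
  have hp0 : 0 < p := by linarith
  have h : ∑' i, w i * f i ≤ (∑' i, w i) ^ (1 - p⁻¹) * (∑' i, w i * f i ^ p) ^ p⁻¹ := by
    rw [ENNReal.tsum_eq_iSup_sum]
    refine iSup_le fun s => (ENNReal.inner_le_weight_mul_Lp_of_nonneg s hp w f).trans ?_
    have h1 : 0 ≤ 1 - p⁻¹ := sub_nonneg.2 (inv_le_one_of_one_le₀ hp)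
    gcongr <;> exact ENNReal.sum_le_tsum s
  refine (ENNReal.rpow_le_rpow h hp0.le).trans (le_of_eq ?_)
  rw [ENNReal.mul_rpow_of_nonneg _ _ hp0.le, ← ENNReal.rpow_mul, ← ENNReal.rpow_mul,
    inv_mul_cancel₀ hp0.ne', ENNReal.rpow_one, sub_mul, inv_mul_cancel₀ hp0.ne', one_mul]

theorem exists_tsum_dyadicKernel_le (α : ℝ) {β : ℝ} (hβ : 0 < β) :
    ∃ C : ℝ≥0∞, C ≠ ∞ ∧ ∀ T : ℝ≥0∞, T ≠ 0 → T ≠ ∞ → ∑' j, dyadicKernel α β T j ≤ C := by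
  set y : ℝ≥0∞ := 2 ^ β with hy
  have hy0 : y ≠ 0 := by simp [hy]
  have hyt : y ≠ ∞ := by simp [hy]
  have hy1 : 1 < y := ENNReal.one_lt_rpow (by norm_num) hβ
  have hyi : y⁻¹ < 1 := ENNReal.inv_lt_one.2 hy1
  refine ⟨y * (1 - y⁻¹)⁻¹ + y * (1 - y⁻¹)⁻¹, ?_, fun T hT0 hTt => ?_⟩
  · have : (1 - y⁻¹)⁻¹ ≠ ∞ := ENNReal.inv_ne_top.2 (tsub_pos_of_lt hyi).ne'
    have := ENNReal.mul_ne_top hyt this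
    exact ENNReal.add_ne_top.2 ⟨this, this⟩
  have hxy : ∀ i : ℤ, (2 : ℝ≥0∞) ^ (β * i) = y ^ i := fun i => by
    rw [ENNReal.rpow_mul, ENNReal.rpow_intCast]
  have hxy' : ∀ i : ℤ, (2 : ℝ≥0∞) ^ (-(β * i)) = y ^ (-i) := fun i => by
    rw [← hxy]; push_cast; ring_nf
  obtain ⟨j0, hj0⟩ := ENNReal.exists_mem_Ico_zpow (x := T ^ α) (y := y)
    (by simp [hT0, hTt]) (by simp [hT0, hTt]) hy1 hyt
  have hz : ∀ i k : ℤ, y ^ i * y ^ k = y ^ (i + k) := fun i k => (ENNReal.zpow_add hy0 hyt i k).symm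
  have hgeo : ∑' k : ℕ, y * y⁻¹ ^ k = y * (1 - y⁻¹)⁻¹ := by
    rw [ENNReal.tsum_mul_left, ENNReal.tsum_geometric]
  have hzk : ∀ k : ℕ, y * y⁻¹ ^ k = y ^ (1 - k : ℤ) := fun k => by
    rw [sub_eq_add_neg, ← hz, zpow_one, ENNReal.zpow_neg, zpow_natCast, ENNReal.inv_pow]
  rw [← (Equiv.addLeft j0).tsum_eq, ← (HasSum.of_nat_of_neg_add_one
    (f := fun i : ℤ => dyadicKernel α β T (Equiv.addLeft j0 i))
    ENNReal.summable.hasSum ENNReal.summable.hasSum).tsum_eq.symm]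
  refine add_le_add ?_ ?_
  · rw [← hgeo]
    refine ENNReal.tsum_le_tsum fun k => (min_le_left _ _).trans ?_
    rw [hxy', hzk]
    refine (mul_le_mul_left hj0.2.le _).trans (le_of_eq ?_)
    rw [hz]; congr 1; simp only [Equiv.coe_addLeft]; ring
  · rw [← hgeo]
    refine ENNReal.tsum_le_tsum fun k => (min_le_right _ _).trans ?_
    rw [hxy, hzk, ENNReal.rpow_neg]
    refine (mul_le_mul_left (ENNReal.inv_le_inv.2 hj0.1) _).trans ?_
    rw [← ENNReal.zpow_neg, hz]
    refine ENNReal.zpow_le_of_le hy1.le ?_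
    simp

theorem lintegral_dyadicKernel_le {α : ℝ} (hα : 0 < α) (β : ℝ) (j : ℤ) :
    ∫⁻ t in Ioi (0 : ℝ), ENNReal.ofReal t ^ (-1 : ℝ) * dyadicKernel α β (ENNReal.ofReal t) j ≤
      ENNReal.ofReal α⁻¹ + ENNReal.ofReal α⁻¹ := by
  set b : ℝ := 2 ^ (β * j / α) with hb
  have hb0 : 0 < b := by positivity
  have hB : ENNReal.ofReal b = 2 ^ (β * j / α) := by
    rw [hb, ← ENNReal.ofReal_rpow_of_pos two_pos]; norm_num
  have hBα : ENNReal.ofReal b ^ α = 2 ^ (β * j) := by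
    rw [hB, ← ENNReal.rpow_mul, div_mul_cancel₀ _ hα.ne']
  have hBα' : ENNReal.ofReal b ^ (-α) = 2 ^ (-(β * j)) := by
    rw [ENNReal.rpow_neg, hBα, ← ENNReal.rpow_neg]
  have h2 : ∀ r : ℝ, (2 : ℝ≥0∞) ^ r * 2 ^ (-r) = 1 := fun r => by
    rw [← ENNReal.rpow_add _ _ two_ne_zero (by simp), add_neg_cancel, ENNReal.rpow_zero]
  have h2t : ∀ r : ℝ, (2 : ℝ≥0∞) ^ r ≠ ∞ := fun r => by simp
  have hT : ∀ t : ℝ, 0 < t → ∀ r : ℝ, ENNReal.ofReal t ^ (-1 : ℝ) * ENNReal.ofReal t ^ r =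
      ENNReal.ofReal t ^ (r - 1) := fun t ht r => by
    rw [← ENNReal.rpow_add _ _ (by simpa using ht) ENNReal.ofReal_ne_top]; ring_nf
  rw [← Ioc_union_Ioi_eq_Ioi hb0.le]
  refine (lintegral_union_le _ _ _).trans (add_le_add ?_ ?_)
  · calc _ ≤ ∫⁻ t in Ioo (0 : ℝ) b, ENNReal.ofReal (t ^ (α - 1)) * 2 ^ (-(β * j)) := by
          rw [← setLIntegral_congr (Ioo_ae_eq_Ioc (μ := volume) (a := (0 : ℝ)) (b := b))]
          refine setLIntegral_mono' measurableSet_Ioo fun t ht => ?_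
          rw [← ENNReal.ofReal_rpow_of_pos ht.1, ← hT t ht.1, mul_assoc]
          exact mul_le_mul_right (min_le_left _ _) _
      _ ≤ _ := by
          rw [lintegral_mul_const' _ _ (h2t _), lintegral_Ioo_ofReal_rpow_sub_one hα hb0.le, hBα,
            mul_assoc, h2, mul_one]
  · calc _ ≤ ∫⁻ t in Ioi b, ENNReal.ofReal t ^ (-α - 1) * 2 ^ (β * j) := by
          refine setLIntegral_mono' measurableSet_Ioi fun t ht => ?_
          rw [← hT t (hb0.trans ht), mul_assoc]
          exact mul_le_mul_right (min_le_right _ _) _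
      _ ≤ _ := by
          rw [lintegral_mul_const' _ _ (h2t _), lintegral_Ioi_ofReal_rpow_neg hα hb0, hBα',
            mul_assoc, mul_comm (2 ^ _), h2, mul_one]

/-- Schur test for the dyadic kernel. -/
theorem exists_lintegral_tsum_dyadicKernel_rpow_le {α β p : ℝ} (hα : 0 < α) (hβ : 0 < β)
    (hp : 1 ≤ p) : ∃ C : ℝ≥0∞, C ≠ ∞ ∧ ∀ a : ℤ → ℝ≥0∞,
      ∫⁻ t in Ioi (0 : ℝ), ENNReal.ofReal t ^ (-1 : ℝ) *
        (∑' j, dyadicKernel α β (ENNReal.ofReal t) j * a j) ^ p ≤ C * ∑' j, a j ^ p := by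
  obtain ⟨K, hK, hKs⟩ := exists_tsum_dyadicKernel_le α hβ
  refine ⟨K ^ (p - 1) * (ENNReal.ofReal α⁻¹ + ENNReal.ofReal α⁻¹), ?_, fun a => ?_⟩
  · exact ENNReal.mul_ne_top (ENNReal.rpow_ne_top_of_nonneg (by linarith) hK) (by simp)
  have hp1 : 0 ≤ p - 1 := by linarith
  have hKt : K ^ (p - 1) ≠ ∞ := ENNReal.rpow_ne_top_of_nonneg hp1 hK
  have hmeas : ∀ j, Measurable fun t : ℝ => dyadicKernel α β (ENNReal.ofReal t) j := fun j => by
    unfold dyadicKernel; fun_prop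
  calc _ ≤ ∫⁻ t in Ioi (0 : ℝ), K ^ (p - 1) * ∑' j, (ENNReal.ofReal t ^ (-1 : ℝ) *
        dyadicKernel α β (ENNReal.ofReal t) j) * a j ^ p := by
        refine setLIntegral_mono' measurableSet_Ioi fun t ht => ?_
        have ht0 : ENNReal.ofReal t ≠ 0 := by simpa using ht
        simp only [mul_assoc]
        rw [ENNReal.tsum_mul_left, mul_left_comm]
        refine mul_le_mul_right ((ENNReal.tsum_mul_rpow_le hp _ _).trans ?_) _
        gcongr
        exact hKs _ ht0 ENNReal.ofReal_ne_top
    _ = K ^ (p - 1) * ∑' j, (∫⁻ t in Ioi (0 : ℝ), ENNReal.ofReal t ^ (-1 : ℝ) *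
        dyadicKernel α β (ENNReal.ofReal t) j) * a j ^ p := by
        rw [lintegral_const_mul' _ _ hKt, lintegral_tsum fun j => by
          have := hmeas j
          fun_prop]
        congr 2 with j
        have := hmeas j
        rw [lintegral_mul_const _ (by fun_prop)]
    _ ≤ _ := by
        rw [mul_assoc, ← ENNReal.tsum_mul_left (a := _ + _)]
        refine mul_le_mul_right (ENNReal.tsum_le_tsum fun j => ?_) _
        exact mul_le_mul_left (lintegral_dyadicKernel_le hα β j) _

theorem volume_restrict_Ioi_rpow_le {p : ℝ} (hp : 1 ≤ p) {S : Set ℝ} (hS : MeasurableSet S) :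
    (volume.restrict (Ioi (0 : ℝ))) S ^ p ≤
      2 ^ p * ∫⁻ σ in S ∩ Ioi 0, ENNReal.ofReal (σ ^ (p - 1)) := by
  have hp0 : 0 < p := by linarith
  have hp1 : 0 ≤ p - 1 := by linarith
  rw [Measure.restrict_apply hS]
  set l := volume (S ∩ Ioi (0 : ℝ)) with hl
  have key : ∀ c : ℝ, 0 < c → ENNReal.ofReal c ^ (p - 1) * (l - ENNReal.ofReal c) ≤
      ∫⁻ σ in S ∩ Ioi 0, ENNReal.ofReal (σ ^ (p - 1)) := by
    intro c hc
    have h1 : l - ENNReal.ofReal c ≤ volume (S ∩ Ioi c) := by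
      rw [tsub_le_iff_right]
      calc l ≤ volume (S ∩ Ioi c ∪ Ioc 0 c) := measure_mono fun x hx => by
            rcases lt_or_ge c x with h | h
            · exact Or.inl ⟨hx.1, h⟩
            · exact Or.inr ⟨hx.2, h⟩
        _ ≤ _ := (measure_union_le _ _).trans (by simp)
    calc _ ≤ ENNReal.ofReal c ^ (p - 1) * volume (S ∩ Ioi c) := mul_le_mul_right h1 _
      _ = ∫⁻ σ in S ∩ Ioi c, ENNReal.ofReal c ^ (p - 1) := by simp
      _ ≤ ∫⁻ σ in S ∩ Ioi c, ENNReal.ofReal (σ ^ (p - 1)) := by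
        refine setLIntegral_mono' (hS.inter measurableSet_Ioi) fun σ hσ => ?_
        rw [← ENNReal.ofReal_rpow_of_pos (hc.trans hσ.2)]
        exact ENNReal.rpow_le_rpow (ENNReal.ofReal_le_ofReal hσ.2.le) hp1
      _ ≤ _ := lintegral_mono_set (inter_subset_inter_right _ (Ioi_subset_Ioi hc.le))
  rcases eq_or_ne l ∞ with ht | ht
  · have := key 1 one_pos
    rw [ht, ENNReal.ofReal_one, ENNReal.one_rpow, one_mul, ENNReal.top_sub ENNReal.one_ne_top,
      top_le_iff] at this
    rw [this, ENNReal.mul_top (by simp)]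
    exact le_top
  rcases eq_or_ne l 0 with h0 | h0
  · rw [h0, ENNReal.zero_rpow_of_pos hp0]
    exact zero_le
  have hc := key (l / 2).toReal (ENNReal.toReal_pos (by simp [h0]) (by simp [ht, ENNReal.div_eq_top]))
  rw [ENNReal.ofReal_toReal (by simp [ht, ENNReal.div_eq_top]), ENNReal.sub_half ht] at hc
  have e : (l / 2) ^ (p - 1) * (l / 2) = (l / 2) ^ p := by
    conv_lhs => rw [← ENNReal.rpow_one (l / 2)]
    rw [← ENNReal.rpow_mul, one_mul, ← ENNReal.rpow_add _ _ (by simp [h0])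
      (by simp [ht, ENNReal.div_eq_top]), sub_add_cancel]
  rw [e] at hc
  refine le_trans (le_of_eq ?_) (mul_le_mul_right hc _)
  rw [← ENNReal.mul_rpow_of_nonneg _ _ hp0.le, ENNReal.mul_div_cancel two_ne_zero (by simp)]

section Layers

variable {X : Type*} [MeasurableSpace X]

/-- The levels at which the distribution function of `f` has size comparable to `2 ^ j`. -/
def dyadicLevels (ν : Measure X) (f : X → ℝ) (j : ℤ) : Set ℝ :=
  {σ | ν {y | σ < f y} ∈ Ico ((2 : ℝ≥0∞) ^ j) ((2 : ℝ≥0∞) ^ (j + 1))}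

theorem measurableSet_dyadicLevels (ν : Measure X) (f : X → ℝ) (j : ℤ) :
    MeasurableSet (dyadicLevels ν f j) := by
  have hanti : Antitone fun s : ℝ => ν {x | s < f x} := fun s s' hs =>
    measure_mono fun x hx => lt_of_le_of_lt hs hx
  exact hanti.measurable measurableSet_Ico

theorem pairwise_disjoint_dyadicLevels (ν : Measure X) (f : X → ℝ) :
    Pairwise (Function.onFun Disjoint (dyadicLevels ν f)) := by
  have key : ∀ i j : ℤ, i < j → Disjoint (dyadicLevels ν f i) (dyadicLevels ν f j) := by
    intro i j hij
    refine disjoint_left.2 fun σ hi hj => ?_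
    have h : (2 : ℝ≥0∞) ^ (i + 1) ≤ 2 ^ j := ENNReal.zpow_le_of_le (by norm_num) (by lia)
    exact absurd (hi.2.trans_le h) (not_lt.2 hj.1)
  intro i j hij
  rcases hij.lt_or_gt with h | h
  · exact key i j h
  · exact (key j i h).symm

theorem tsum_dyadicLevels_rpow_le {p : ℝ} (hp : 1 ≤ p) (ν : Measure X) {f : X → ℝ}
    (hf : Measurable f) (hf0 : ∀ x, 0 ≤ f x) :
    ∑' j : ℤ, (volume.restrict (Ioi (0 : ℝ))) (dyadicLevels ν f j) ^ p * 2 ^ j ≤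
      2 ^ p * ∫⁻ x, ENNReal.ofReal (f x ^ p) ∂ν := by
  have hm : ∀ j, MeasurableSet (dyadicLevels ν f j ∩ Ioi 0) := fun j =>
    (measurableSet_dyadicLevels ν f j).inter measurableSet_Ioi
  calc _ ≤ ∑' j : ℤ, 2 ^ p * ∫⁻ σ in dyadicLevels ν f j ∩ Ioi 0,
        ν {y | σ < f y} * ENNReal.ofReal (σ ^ (p - 1)) := by
        refine ENNReal.tsum_le_tsum fun j => ?_
        refine (mul_le_mul_left (volume_restrict_Ioi_rpow_le hp
          (measurableSet_dyadicLevels ν f j)) _).trans ?_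
        rw [mul_assoc, mul_comm _ ((2 : ℝ≥0∞) ^ j),
          ← lintegral_const_mul' _ _ (ENNReal.zpow_ne_top two_ne_zero (by simp) _)]
        refine mul_le_mul_right (setLIntegral_mono' (hm j) fun σ hσ => ?_) _
        exact mul_le_mul_left hσ.1.1 _
    _ = 2 ^ p * ∫⁻ σ in ⋃ j, dyadicLevels ν f j ∩ Ioi 0,
          ν {y | σ < f y} * ENNReal.ofReal (σ ^ (p - 1)) := by
        rw [ENNReal.tsum_mul_left, lintegral_iUnion hm]
        exact fun i j hij => (pairwise_disjoint_dyadicLevels ν f hij).mono inter_subset_left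
          inter_subset_left
    _ ≤ 2 ^ p * ∫⁻ σ in Ioi (0 : ℝ), ν {y | σ < f y} * ENNReal.ofReal (σ ^ (p - 1)) :=
        mul_le_mul_right (lintegral_mono_set (iUnion_subset fun j => inter_subset_right)) _
    _ ≤ _ := by
        rw [lintegral_rpow_eq_lintegral_meas_lt_mul ν (.of_forall hf0) hf.aemeasurable
          (by linarith)]
        refine mul_le_mul_right (le_mul_of_one_le_left' ?_) _
        rwa [ENNReal.one_le_ofReal]

end Layers

theorem lintegral_mul_le_lintegral_superlevel {X Y : Type*} [MeasurableSpace X]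
    [MeasurableSpace Y] (μ : Measure X) (ν : Measure Y) [SFinite μ] [SFinite ν] {f : Y → ℝ}
    (hf : Measurable f) {K : X → Y → ℝ≥0∞} (hK : Measurable (Function.uncurry K)) :
    ∫⁻ x, (∫⁻ y, ENNReal.ofReal (f y) * K x y ∂ν) ∂μ ≤
      ∫⁻ σ in Ioi (0 : ℝ), (∫⁻ x, (∫⁻ y in {y | σ < f y}, K x y ∂ν) ∂μ) := by
  set I : Y → ℝ → ℝ≥0∞ := fun y σ => {z : Y × ℝ | z.2 < f z.1}.indicator 1 (y, σ) with hI
  have hIm : Measurable (Function.uncurry I) :=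
    measurable_one.indicator (measurableSet_lt measurable_snd (hf.comp measurable_fst))
  have hx : ∀ x, ∫⁻ y, ENNReal.ofReal (f y) * K x y ∂ν ≤
      ∫⁻ σ in Ioi (0 : ℝ), (∫⁻ y, I y σ * K x y ∂ν) := by
    intro x
    rw [lintegral_lintegral_swap]
    · refine lintegral_mono fun y => ?_
      have hIy : Measurable fun σ => I y σ := hIm.comp measurable_prodMk_left
      rw [lintegral_mul_const _ hIy]
      refine mul_le_mul_left ?_ _
      calc ENNReal.ofReal (f y) = ∫⁻ σ in Ioi (0 : ℝ), (Ioo 0 (f y)).indicator 1 σ := by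
            rw [lintegral_indicator_one measurableSet_Ioo,
              Measure.restrict_apply measurableSet_Ioo, inter_eq_left.2 Ioo_subset_Ioi_self]
            simp
        _ ≤ _ := by
            refine lintegral_mono fun σ => ?_
            by_cases h : σ < f y
            · rw [hI]
              beta_reduce
              rw [indicator_of_mem (a := (y, σ)) (by exact h)]
              exact indicator_le_self _ _ _
            · rw [indicator_of_notMem fun h' => h h'.2]
              exact zero_le
    · refine Measurable.aemeasurable (Measurable.mul ?_ ?_)
      · exact hIm.comp measurable_swap
      · exact hK.comp (measurable_const.prodMk measurable_snd)
  calc _ ≤ ∫⁻ x, (∫⁻ σ in Ioi (0 : ℝ), (∫⁻ y, I y σ * K x y ∂ν)) ∂μ := lintegral_mono hx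
    _ = ∫⁻ σ in Ioi (0 : ℝ), (∫⁻ x, (∫⁻ y, I y σ * K x y ∂ν) ∂μ) := by
        refine lintegral_lintegral_swap (Measurable.aemeasurable ?_)
        refine Measurable.lintegral_prod_right' (f := fun z : (X × ℝ) × Y =>
          I z.2 z.1.2 * K z.1.1 z.2) (Measurable.mul ?_ ?_)
        · exact hIm.comp (by fun_prop : Measurable fun z : (X × ℝ) × Y => (z.2, z.1.2))
        · exact hK.comp (by fun_prop : Measurable fun z : (X × ℝ) × Y => (z.1.1, z.2))
    _ = _ := by
        congr 1 with σ
        congr 1 with x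
        rw [← lintegral_indicator (measurableSet_lt measurable_const hf)]
        congr 1 with y
        by_cases h : σ < f y
        · rw [indicator_of_mem (by exact h), hI]
          beta_reduce
          rw [indicator_of_mem (a := (y, σ)) (by exact h), Pi.one_apply, one_mul]
        · rw [indicator_of_notMem (by exact h), hI]
          beta_reduce
          rw [indicator_of_notMem (a := (y, σ)) (by exact h), zero_mul]

theorem ENNReal.rpow_le_two_mul_zpow_rpow {V : ℝ≥0∞} {j : ℤ} {r : ℝ} (hV : V ≤ 2 ^ (j + 1))
    (hr : 0 ≤ r) (hr1 : r ≤ 1) : V ^ r ≤ 2 * ((2 : ℝ≥0∞) ^ j) ^ r := by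
  refine (ENNReal.rpow_le_rpow hV hr).trans ?_
  rw [ENNReal.zpow_add two_ne_zero (by simp), zpow_one, mul_comm,
    ENNReal.mul_rpow_of_nonneg _ _ hr]
  refine mul_le_mul_left ?_ _
  conv_rhs => rw [← ENNReal.rpow_one 2]
  exact ENNReal.rpow_le_rpow_of_exponent_le (by norm_num) hr1

theorem ENNReal.rpow_one_sub_le {g T : ℝ≥0∞} (hT : T ≤ g) (hg0 : g ≠ 0) (hgt : g ≠ ∞) {r : ℝ}
    (hr : 0 ≤ r) : g ^ (1 - r) ≤ g * T ^ (-r) := by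
  rw [sub_eq_add_neg, ENNReal.rpow_add _ _ hg0 hgt, ENNReal.rpow_one]
  exact mul_le_mul_right (ENNReal.rpow_neg_le_rpow_neg hr hT) _

/-- Two-sided estimate for the Riesz kernel at dyadic scales. -/
theorem IsFrostman.exists_riesz_bilinear_dyadic_le {E : Type*} [NormedAddCommGroup E]
    [InnerProductSpace ℝ E] [FiniteDimensional ℝ E] [MeasurableSpace E] [BorelSpace E]
    {μ : Measure E} [IsFiniteMeasure μ] {A : ℝ≥0} {d : ℝ} (hμ : IsFrostman μ A d) (hd : 0 < d)
    (hn : 0 < Module.finrank ℝ E) {κ p : ℝ} (hκ : 0 < κ) (hp : 1 < p) (hκd : κ / d < p⁻¹) :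
    ∃ α β : ℝ, 0 < α ∧ 0 < β ∧ ∃ C : ℝ≥0∞, C ≠ ∞ ∧ ∀ (G F : Set E) (T : ℝ≥0∞) (j : ℤ),
      MeasurableSet G → MeasurableSet F → T ≠ 0 → T ≤ μ G → volume F ≤ 2 ^ (j + 1) →
        ∫⁻ x in G, (∫⁻ y in F, edist x y ^
            (-(κ + ((Module.finrank ℝ E : ℝ) - Module.finrank ℝ E / p)))) ∂μ ≤
          C * μ G * (T ^ (-(κ / d)) * (dyadicKernel α β T j * ((2 : ℝ≥0∞) ^ j) ^ p⁻¹)) := by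
  set n := Module.finrank ℝ E
  have hn' : (0 : ℝ) < n := by exact_mod_cast hn
  have hpi : p⁻¹ < 1 := inv_lt_one_of_one_lt₀ hp
  have hpi0 : 0 < p⁻¹ := inv_pos.2 (by linarith)
  set b : ℝ := n - n / p with hb
  have hb0 : 0 < b := by
    have : b = n * (1 - p⁻¹) := by rw [hb]; ring
    rw [this]
    exact mul_pos hn' (by linarith)
  have hbn : b / n = 1 - p⁻¹ := by rw [hb]; field_simp
  obtain ⟨ε, hε0, hεκ, hεb, hεl⟩ : ∃ ε : ℝ, 0 < ε ∧ ε ≤ κ ∧ ε ≤ b ∧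
      ε * (1 / d + 1 / n) < p⁻¹ - κ / d := by
    set δ := (p⁻¹ - κ / d) / (2 * (1 / d + 1 / n))
    have hs : 0 < 1 / d + 1 / (n : ℝ) := by positivity
    have hg : 0 < p⁻¹ - κ / d := by linarith
    have hδ : 0 < δ := by positivity
    refine ⟨min δ (min κ b), by simp [hδ, hκ, hb0], by simp, by simp, ?_⟩
    calc _ ≤ δ * (1 / d + 1 / n) := by gcongr; exact min_le_left _ _
      _ = (p⁻¹ - κ / d) / 2 := by simp only [δ]; field_simp
      _ < _ := by linarith
  have hε' : ε / d + ε / n < p⁻¹ - κ / d := by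
    have : ε * (1 / d + 1 / n) = ε / d + ε / n := by ring
    linarith
  have hα : 0 < ε / d := by positivity
  have hβ : 0 < ε / n := by positivity
  have hκd0 : 0 < κ / d := by positivity
  have hc1 : (κ - ε) / d = κ / d - ε / d := by ring
  have hc2 : (κ + ε) / d = κ / d + ε / d := by ring
  have hc3 : (b + ε) / n = 1 - p⁻¹ + ε / n := by rw [← hbn]; ring
  have hc4 : (b - ε) / n = 1 - p⁻¹ - ε / n := by rw [← hbn]; ring
  obtain ⟨C1, hC1, h1⟩ := hμ.exists_riesz_bilinear_le hd hn (a := κ - ε) (b := b + ε)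
    (by linarith) (by linarith) (by linarith) (by rw [hc1, hc3]; linarith)
  obtain ⟨C2, hC2, h2⟩ := hμ.exists_riesz_bilinear_le hd hn (a := κ + ε) (b := b - ε)
    (by linarith) (by linarith) (by linarith) (by rw [hc2, hc4]; linarith)
  refine ⟨ε / d, ε / n, hα, hβ, 2 * (C1 + C2), by finiteness, ?_⟩
  intro G F T j hG hF hT0 hTG hFj
  have hGt : μ G ≠ ∞ := measure_ne_top _ _
  have hG0 : μ G ≠ 0 := (pos_iff_ne_zero.2 hT0 |>.trans_le hTG).ne'
  have hTt : T ≠ ∞ := ne_top_of_le_ne_top hGt hTG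
  have hY0 : (2 : ℝ≥0∞) ^ j ≠ 0 := (ENNReal.zpow_pos two_ne_zero (by simp) j).ne'
  have hYt : (2 : ℝ≥0∞) ^ j ≠ ∞ := ENNReal.zpow_ne_top two_ne_zero (by simp) _
  have hFt : volume F ≠ ∞ :=
    ne_top_of_le_ne_top (ENNReal.zpow_ne_top two_ne_zero (by simp) _) hFj
  have hY : ∀ r : ℝ, ((2 : ℝ≥0∞) ^ j) ^ r = 2 ^ (r * j) := fun r => by
    rw [← ENNReal.rpow_intCast, ← ENNReal.rpow_mul, mul_comm]
  have e1 : κ - ε + (b + ε) = κ + b := by ring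
  have e2 : κ + ε + (b - ε) = κ + b := by ring
  have g1 := h1 G F hG hF hFt
  have g2 := h2 G F hG hF hFt
  rw [e1, hc1, hc3] at g1
  rw [e2, hc2, hc4] at g2
  have hd1 : ε / n ≤ p⁻¹ := by linarith
  have hd2 : p⁻¹ + ε / n ≤ 1 := by
    have : 0 ≤ (b - ε) / n := div_nonneg (by linarith) hn'.le
    linarith
  have hd3 : ε / d ≤ κ / d := by gcongr
  rw [dyadicKernel, ← min_mul_mul_right, ← min_mul_mul_left, ← min_mul_mul_left]
  refine le_min ?_ ?_
  · calc _ ≤ _ := g1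
      _ ≤ (C1 + C2) * ((μ G * T ^ (-(κ / d - ε / d))) *
            (2 * ((2 : ℝ≥0∞) ^ j) ^ (1 - (1 - p⁻¹ + ε / n)))) := by
          gcongr
          · exact le_self_add
          · exact ENNReal.rpow_one_sub_le hTG hG0 hGt (by linarith)
          · exact ENNReal.rpow_le_two_mul_zpow_rpow hFj (by linarith) (by linarith)
      _ = _ := by
          have t1 : -(κ / d - ε / d) = -(κ / d) + ε / d := by ring
          have t2 : 1 - (1 - p⁻¹ + ε / n) = p⁻¹ + -(ε / n) := by ring
          rw [t1, t2, ENNReal.rpow_add _ _ hT0 hTt, ENNReal.rpow_add _ _ hY0 hYt,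
            hY (-(ε / n)), neg_mul]
          ring
  · calc _ ≤ _ := g2
      _ ≤ (C1 + C2) * ((μ G * T ^ (-(κ / d + ε / d))) *
            (2 * ((2 : ℝ≥0∞) ^ j) ^ (1 - (1 - p⁻¹ - ε / n)))) := by
          gcongr
          · exact le_add_self
          · exact ENNReal.rpow_one_sub_le hTG hG0 hGt (by linarith)
          · exact ENNReal.rpow_le_two_mul_zpow_rpow hFj (by linarith) (by linarith)
      _ = _ := by
          have t1 : -(κ / d + ε / d) = -(κ / d) + -(ε / d) := by ring
          have t2 : 1 - (1 - p⁻¹ - ε / n) = p⁻¹ + (ε / n) := by ring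
          rw [t1, t2, ENNReal.rpow_add _ _ hT0 hTt, ENNReal.rpow_add _ _ hY0 hYt,
            hY (ε / n)]
          ring

section LorentzTrace

variable {E : Type*} [NormedAddCommGroup E] [InnerProductSpace ℝ E] [FiniteDimensional ℝ E]
  [MeasurableSpace E] [BorelSpace E]

theorem lintegral_le_tsum_dyadicLevels {X : Type*} [MeasurableSpace X] (ν : Measure X)
    (f : X → ℝ) {B : ℝ → ℝ≥0∞} {D : ℤ → ℝ≥0∞}
    (hB0 : ∀ σ, 0 < σ → ν {y | σ < f y} = 0 → B σ = 0)
    (hfin : ∀ σ, 0 < σ → ν {y | σ < f y} ≠ ∞)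
    (hB : ∀ j, ∀ σ ∈ dyadicLevels ν f j, B σ ≤ D j) :
    ∫⁻ σ in Ioi (0 : ℝ), B σ ≤
      ∑' j, (volume.restrict (Ioi (0 : ℝ))) (dyadicLevels ν f j) * D j := by
  calc _ ≤ ∫⁻ σ in Ioi (0 : ℝ), ∑' j, (dyadicLevels ν f j).indicator (fun _ => D j) σ := by
        refine setLIntegral_mono' measurableSet_Ioi fun σ hσ => ?_
        rcases eq_or_ne (ν {y | σ < f y}) 0 with h0 | h0
        · rw [hB0 σ hσ h0]
          exact zero_le
        obtain ⟨j, hj⟩ := ENNReal.exists_mem_Ico_zpow h0 (hfin σ hσ) (y := 2) (by norm_num)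
          (by simp)
        have hj : σ ∈ dyadicLevels ν f j := hj
        refine le_trans ?_ (ENNReal.le_tsum j)
        rw [indicator_of_mem hj]
        exact hB j σ hj
    _ = _ := by
        rw [lintegral_tsum fun j =>
          (measurable_const.indicator (measurableSet_dyadicLevels ν f j)).aemeasurable]
        congr 1 with j
        rw [lintegral_indicator_const (measurableSet_dyadicLevels ν f j), mul_comm]

/-- Dyadic pointwise bound for the rearrangement of a test function. -/
theorem IsFrostman.exists_rearr_le {μ : Measure E} [IsFiniteMeasure μ] {A : ℝ≥0} {d : ℝ}
    (hμ : IsFrostman μ A d) (hd : 0 < d) {m : ℕ} (hm : 1 ≤ m) (hmn : m < Module.finrank ℝ E)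
    {p : ℝ} (hp : 1 < p) (hpm : m * p < Module.finrank ℝ E)
    (hpd : (Module.finrank ℝ E : ℝ) - m * p < d) :
    ∃ α β : ℝ, 0 < α ∧ 0 < β ∧ ∃ C : ℝ≥0∞, C ≠ ∞ ∧
      ∀ u : E → ℝ, ContDiff ℝ (⊤ : ℕ∞) u → HasCompactSupport u → ∀ t : ℝ, 0 < t →
        rearr μ u t ≤ C * (ENNReal.ofReal t ^ (-(((Module.finrank ℝ E : ℝ) - m * p) / (d * p))) *
          ∑' j : ℤ, dyadicKernel α β (ENNReal.ofReal t) j *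
            ((volume.restrict (Ioi (0 : ℝ)))
              (dyadicLevels volume (fun y => ‖iteratedFDeriv ℝ m u y‖) j) *
                ((2 : ℝ≥0∞) ^ j) ^ p⁻¹)) := by
  set n := Module.finrank ℝ E
  have hp0 : 0 < p := by linarith
  have hκ : 0 < (n : ℝ) / p - m := by rw [sub_pos, lt_div_iff₀ hp0]; exact hpm
  have hκe : ((n : ℝ) / p - m) / d = ((n : ℝ) - m * p) / (d * p) := by field_simp
  have hκd : ((n : ℝ) / p - m) / d < p⁻¹ := by
    rw [hκe, div_lt_iff₀ (by positivity)]
    field_simp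
    exact hpd
  obtain ⟨α, β, hα, hβ, C, hC, hbil⟩ :=
    hμ.exists_riesz_bilinear_dyadic_le hd (by lia) hκ hp hκd
  obtain ⟨K, hK, hpot⟩ := exists_enorm_le_riesz_potential (E := E) hm hmn
  refine ⟨α, β, hα, hβ, K * C, ENNReal.mul_ne_top hK hC, fun u hu hcu t ht => ?_⟩
  set f : E → ℝ := fun y => ‖iteratedFDeriv ℝ m u y‖ with hf
  have hfc : Continuous f := (hu.continuous_iteratedFDeriv (m := m) (by exact_mod_cast le_top)).norm
  set T := ENNReal.ofReal t with hT
  have hT0 : T ≠ 0 := by simpa [hT] using ht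
  rw [← hκe]
  set L : ℤ → ℝ≥0∞ := fun j => T ^ (-(((n : ℝ) / p - m) / d)) *
    (dyadicKernel α β T j * ((2 : ℝ≥0∞) ^ j) ^ p⁻¹) with hL
  have hfm : ∀ σ, MeasurableSet {y | σ < f y} := fun σ =>
    measurableSet_lt measurable_const hfc.measurable
  refine ENNReal.le_of_forall_nnreal_lt fun s hs => ?_
  rw [← ENNReal.ofReal_coe_nnreal] at hs
  set G := {x | (s : ℝ) < |u x|} with hG
  have hTG : T < μ G := lt_measure_of_lt_rearr hs
  have hGm : MeasurableSet G := measurableSet_lt measurable_const hu.continuous.abs.measurable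
  have hG0 : μ G ≠ 0 := (zero_le.trans_lt hTG).ne'
  have hGt : μ G ≠ ∞ := measure_ne_top _ _
  have hmain : μ G * s ≤ μ G * (K * ∑' j, (volume.restrict (Ioi (0 : ℝ)))
      (dyadicLevels volume f j) * (C * L j)) := by
    calc μ G * s = ∫⁻ x in G, (s : ℝ≥0∞) ∂μ := by simp [mul_comm]
      _ ≤ ∫⁻ x in G, ‖u x‖ₑ ∂μ := by
          refine setLIntegral_mono' hGm fun x hx => ?_
          rw [← ENNReal.ofReal_coe_nnreal, ← ofReal_norm]
          exact ENNReal.ofReal_le_ofReal (le_of_lt hx)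
      _ ≤ ∫⁻ x in G, K * (∫⁻ y, ENNReal.ofReal (f y) * edist x y ^ (-((n : ℝ) - m))) ∂μ := by
          refine lintegral_mono fun x => (hpot u hu hcu x).trans (le_of_eq ?_)
          simp only [hf, ofReal_norm, n]
      _ = K * ∫⁻ x in G, (∫⁻ y, ENNReal.ofReal (f y) * edist x y ^ (-((n : ℝ) - m))) ∂μ :=
          lintegral_const_mul' _ _ hK
      _ ≤ K * ∫⁻ σ in Ioi (0 : ℝ), (∫⁻ x in G, (∫⁻ y in {y | σ < f y},
            edist x y ^ (-((n : ℝ) - m))) ∂μ) := by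
          refine mul_le_mul_right (lintegral_mul_le_lintegral_superlevel _ _ hfc.measurable ?_) _
          exact Measurable.pow_const measurable_edist _
      _ ≤ K * ∑' j, (volume.restrict (Ioi (0 : ℝ))) (dyadicLevels volume f j) *
            (C * μ G * L j) := by
          refine mul_le_mul_right (lintegral_le_tsum_dyadicLevels _ _ ?_ ?_ ?_) _
          · intro σ _ h0
            simp [Measure.restrict_eq_zero.2 h0]
          · intro σ hσ
            have hsub : {y | σ < f y} ⊆ tsupport u := fun y (hy : σ < f y) => by
              refine support_iteratedFDeriv_subset (𝕜 := ℝ) m fun h => ?_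
              simp only [hf, h, norm_zero] at hy
              exact absurd hy hσ.not_gt
            exact ((measure_mono hsub).trans_lt hcu.isCompact.measure_lt_top).ne
          · intro j σ hσ
            have := hbil G {y | σ < f y} T j hGm (hfm σ) hT0 hTG.le hσ.2.le
            have e : -((n : ℝ) / p - m + ((n : ℝ) - n / p)) = -((n : ℝ) - m) := by ring
            rwa [e] at this
      _ = _ := by
          rw [mul_left_comm (μ G), ← ENNReal.tsum_mul_left (a := μ G)]
          congr 2 with j
          ring
  rw [ENNReal.mul_le_mul_iff_right hG0 hGt] at hmain
  refine hmain.trans (le_of_eq ?_)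
  rw [mul_assoc, ← ENNReal.tsum_mul_left (a := T ^ _), ← ENNReal.tsum_mul_left (a := C)]
  congr 2 with j
  simp only [hL]
  ring

theorem IsFrostman.exists_lintegral_rearr_rpow_le {μ : Measure E} [IsFiniteMeasure μ] {A : ℝ≥0}
    {d : ℝ} (hμ : IsFrostman μ A d) (hd : 0 < d) {m : ℕ} (hm : 1 ≤ m)
    (hmn : m < Module.finrank ℝ E) {p : ℝ} (hp : 1 < p) (hpm : m * p < Module.finrank ℝ E)
    (hpd : (Module.finrank ℝ E : ℝ) - m * p < d) :
    ∃ C : ℝ≥0∞, C ≠ ∞ ∧ ∀ u : E → ℝ, ContDiff ℝ (⊤ : ℕ∞) u → HasCompactSupport u →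
      ∫⁻ t in Ioi (0 : ℝ), (ENNReal.ofReal
        (t ^ (((Module.finrank ℝ E : ℝ) - m * p) / (d * p) - 1 / p)) * rearr μ u t) ^ p ≤
          C * ∫⁻ x, ENNReal.ofReal (‖iteratedFDeriv ℝ m u x‖ ^ p) := by
  obtain ⟨α, β, hα, hβ, C, hC, hrearr⟩ := hμ.exists_rearr_le hd hm hmn hp hpm hpd
  obtain ⟨K, hK, hschur⟩ := exists_lintegral_tsum_dyadicKernel_rpow_le hα hβ hp.le
  have hp0 : 0 < p := by linarith
  have hCp : C ^ p ≠ ∞ := ENNReal.rpow_ne_top_of_nonneg hp0.le hC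
  refine ⟨C ^ p * (K * 2 ^ p), ENNReal.mul_ne_top hCp (ENNReal.mul_ne_top hK (by simp)),
    fun u hu hcu => ?_⟩
  set γ : ℝ := ((Module.finrank ℝ E : ℝ) - m * p) / (d * p)
  set f : E → ℝ := fun y => ‖iteratedFDeriv ℝ m u y‖ with hf
  have hfc : Continuous f := (hu.continuous_iteratedFDeriv (m := m) (by exact_mod_cast le_top)).norm
  set a : ℤ → ℝ≥0∞ := fun j => (volume.restrict (Ioi (0 : ℝ))) (dyadicLevels volume f j) *
    ((2 : ℝ≥0∞) ^ j) ^ p⁻¹ with ha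
  have hap : ∀ j, a j ^ p = (volume.restrict (Ioi (0 : ℝ))) (dyadicLevels volume f j) ^ p *
      2 ^ j := fun j => by
    rw [ha, ENNReal.mul_rpow_of_nonneg _ _ hp0.le, ← ENNReal.rpow_mul, inv_mul_cancel₀ hp0.ne',
      ENNReal.rpow_one]
  calc _ ≤ ∫⁻ t in Ioi (0 : ℝ), C ^ p * (ENNReal.ofReal t ^ (-1 : ℝ) *
        (∑' j, dyadicKernel α β (ENNReal.ofReal t) j * a j) ^ p) := by
        refine setLIntegral_mono' measurableSet_Ioi fun t ht => ?_
        have ht0 : ENNReal.ofReal t ≠ 0 := by simpa using ht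
        calc _ ≤ (ENNReal.ofReal t ^ (γ - 1 / p) * (C * (ENNReal.ofReal t ^ (-γ) *
              ∑' j, dyadicKernel α β (ENNReal.ofReal t) j * a j))) ^ p := by
              rw [← ENNReal.ofReal_rpow_of_pos ht]
              gcongr
              exact hrearr u hu hcu t ht
          _ = (C * (ENNReal.ofReal t ^ (-(1 / p)) *
              ∑' j, dyadicKernel α β (ENNReal.ofReal t) j * a j)) ^ p := by
              have e : -(1 / p) = γ - 1 / p + -γ := by ring
              rw [e, ENNReal.rpow_add _ _ ht0 ENNReal.ofReal_ne_top]
              congr 1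
              ring
          _ = _ := by
              have e : -(1 / p) * p = -1 := by field_simp
              rw [ENNReal.mul_rpow_of_nonneg _ _ hp0.le, ENNReal.mul_rpow_of_nonneg _ _ hp0.le,
                ← ENNReal.rpow_mul, e]
    _ ≤ C ^ p * (K * ∑' j, a j ^ p) := by
        rw [lintegral_const_mul' _ _ hCp]
        exact mul_le_mul_right (hschur a) _
    _ ≤ C ^ p * (K * (2 ^ p * ∫⁻ x, ENNReal.ofReal (f x ^ p))) := by
        simp only [hap]
        gcongr
        exact tsum_dyadicLevels_rpow_le hp.le volume hfc.measurable fun x => norm_nonneg _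
    _ = _ := by ring

end LorentzTrace

/-- **Optimal Lorentz trace inequality for classical Sobolev spaces, `p < n/m`:**
`‖u‖_{L^{dp/(n-mp),p}(Ω,μ)} ≤ C ‖∇^m u‖_{L^p(Ω)}` for every `d`-Frostman measure `μ`,
sharpening the classical embeddings of Adams and Maz'ya. -/
theorem optimal_lorentz_trace (n m : ℕ) (hn : 2 ≤ n) (hm : 1 ≤ m) (hmn : m < n)
    (d p : ℝ)
    (hdp : ((n : ℝ) - m ≤ d ∧ d ≤ n ∧ 1 ≤ p) ∨
        (0 < d ∧ d < (n : ℝ) - m ∧ ((n : ℝ) - d) / m < p))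
    (hp : p < (n : ℝ) / m)
    (Ω : Set (EuclideanSpace ℝ (Fin n))) (hΩ : IsOpen Ω) (hΩvol : volume Ω < ⊤)
    (μ : Measure (EuclideanSpace ℝ (Fin n))) (hfin : IsFiniteMeasure μ) (hsupp : μ Ωᶜ = 0)
    (hFrostman : ∃ A : ℝ, ∀ (x : EuclideanSpace ℝ (Fin n)) (r : ℝ), 0 < r →
        μ (Metric.ball x r ∩ Ω) ≤ ENNReal.ofReal (A * r ^ d)) :
    ∃ C : ℝ, 0 < C ∧
      ∀ u : EuclideanSpace ℝ (Fin n) → ℝ, ContDiff ℝ (⊤ : ℕ∞) u → HasCompactSupport u →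
        tsupport u ⊆ Ω →
        (∫⁻ t in Set.Ioo (0 : ℝ) ((μ Ω).toReal),
            (ENNReal.ofReal (t ^ (((n : ℝ) - m * p) / (d * p) - 1 / p)) *
              rearr μ u t) ^ p) ^ (1 / p) ≤
          ENNReal.ofReal C *
            (∫⁻ x in Ω, ENNReal.ofReal (‖iteratedFDeriv ℝ m u x‖ ^ p)) ^ (1 / p) := by
  have hn0 : (0 : ℝ) < n := by exact_mod_cast (by lia : 0 < n)
  have hm0 : (0 : ℝ) < m := by exact_mod_cast hm
  have hmn' : (m : ℝ) < n := by exact_mod_cast hmn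
  have hpm : m * p < n := by rwa [lt_div_iff₀ hm0, mul_comm] at hp
  have hd0 : 0 < d := by
    rcases hdp with h | h
    · linarith [h.1]
    · exact h.1
  have hfr : Module.finrank ℝ (EuclideanSpace ℝ (Fin n)) = n := finrank_euclideanSpace_fin
  obtain ⟨A, hA⟩ := hFrostman
  have hμ : IsFrostman μ A.toNNReal d := by
    intro x r hr
    have h1 : μ (Metric.ball x r) = μ (Metric.ball x r ∩ Ω) :=
      (measure_inter_conull hsupp).symm
    rw [h1]
    refine (hA x r (by exact_mod_cast hr)).trans (le_of_eq ?_)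
    rw [ENNReal.ofReal_mul' (by positivity), ← ENNReal.ofReal_rpow_of_pos (by exact_mod_cast hr),
      ENNReal.ofReal_coe_nnreal]
    rfl
  obtain ⟨hp1, K, hK, hmain⟩ : 1 ≤ p ∧ ∃ K : ℝ≥0∞, K ≠ ∞ ∧
      ∀ u : EuclideanSpace ℝ (Fin n) → ℝ, ContDiff ℝ (⊤ : ℕ∞) u → HasCompactSupport u →
        ∫⁻ t in Set.Ioo (0 : ℝ) ((μ Ω).toReal),
            (ENNReal.ofReal (t ^ (((n : ℝ) - m * p) / (d * p) - 1 / p)) *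
              rearr μ u t) ^ p ≤
          K * ∫⁻ x, ENNReal.ofReal (‖iteratedFDeriv ℝ m u x‖ ^ p) := by
    have hgt : 1 < p → (n : ℝ) - m * p < d → ∃ K : ℝ≥0∞, K ≠ ∞ ∧
      ∀ u : EuclideanSpace ℝ (Fin n) → ℝ, ContDiff ℝ (⊤ : ℕ∞) u → HasCompactSupport u →
        ∫⁻ t in Set.Ioo (0 : ℝ) ((μ Ω).toReal),
            (ENNReal.ofReal (t ^ (((n : ℝ) - m * p) / (d * p) - 1 / p)) *
              rearr μ u t) ^ p ≤
          K * ∫⁻ x, ENNReal.ofReal (‖iteratedFDeriv ℝ m u x‖ ^ p) := by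
      intro hp1 hpd
      obtain ⟨K, hK, h⟩ := hμ.exists_lintegral_rearr_rpow_le hd0 hm (by rwa [hfr]) hp1
        (by rwa [hfr]) (by rwa [hfr])
      rw [hfr] at h
      exact ⟨K, hK, fun u hu hcu =>
        (lintegral_mono_set Ioo_subset_Ioi_self).trans (h u hu hcu)⟩
    rcases hdp with ⟨hd1, -, hp1⟩ | ⟨-, hd1, hp1⟩
    · refine ⟨hp1, ?_⟩
      rcases hp1.eq_or_lt with rfl | hp1
      · obtain ⟨K, hK, h⟩ := hμ.exists_lintegral_measure_rpow_le hm (by rwa [hfr]) (by rwa [hfr])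
        rw [hfr] at h
        have hq : 0 < ((n : ℝ) - m) / d := div_pos (by linarith) hd0
        refine ⟨ENNReal.ofReal (((n : ℝ) - m) / d)⁻¹ * K,
          ENNReal.mul_ne_top ENNReal.ofReal_ne_top hK, fun u hu hcu => ?_⟩
        simp only [mul_one, ENNReal.rpow_one, div_one, Real.rpow_one, ofReal_norm]
        refine (lintegral_rpow_mul_rearr_le hq μ u _).trans ?_
        rw [mul_assoc]
        exact mul_le_mul_right (h u hu hcu) _
      · exact hgt hp1 (by nlinarith)
    · have h1 : n - d < m * p := by rwa [div_lt_iff₀ hm0, mul_comm] at hp1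
      have h2 : 1 < p := by nlinarith
      exact ⟨h2.le, hgt h2 (by linarith)⟩
  have hp0 : 0 < p := by linarith
  have hip : 0 ≤ 1 / p := by positivity
  have hKp : K ^ (1 / p) ≠ ∞ := ENNReal.rpow_ne_top_of_nonneg hip hK
  refine ⟨(K ^ (1 / p)).toReal + 1, by positivity, fun u hu hcu hsu => ?_⟩
  have hset : ∫⁻ x, ENNReal.ofReal (‖iteratedFDeriv ℝ m u x‖ ^ p) =
      ∫⁻ x in Ω, ENNReal.ofReal (‖iteratedFDeriv ℝ m u x‖ ^ p) := by
    refine (setLIntegral_eq_of_support_subset fun x hx => ?_).symm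
    refine hsu (support_iteratedFDeriv_subset (𝕜 := ℝ) m fun h => hx ?_)
    simp [h, hp0.ne']
  calc _ ≤ (K * ∫⁻ x, ENNReal.ofReal (‖iteratedFDeriv ℝ m u x‖ ^ p)) ^ (1 / p) :=
        ENNReal.rpow_le_rpow (hmain u hu hcu) hip
    _ ≤ _ := by
        rw [hset, ENNReal.mul_rpow_of_nonneg _ _ hip]
        refine mul_le_mul_left ?_ _
        rw [← ENNReal.ofReal_toReal hKp]
        exact ENNReal.ofReal_le_ofReal (by simp)
end
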